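/- arXiv:1710.02308 — 2 statements merged into one kernel-verified Lean document; each statement's English description precedes it below -/
import Mathlib

section
/- (Generating martingale, finite-volume identity.) Let α∈(−∞,0]^{V_∞} be zero outside a finite set, and for m∈{n,n+1} define α^{(m)}∈ℝ^{Ṽ_m} by α^{(m)}_i=α_i for i∈V_m and α^{(m)}_{δ_m}=Σ_{j∈V_∞∖V_m}α_j. Let a∈(0,∞)^{V_n} and b∈ℝ^{V_n}. Then ∫ exp(Σ_{j∈Ṽ_{n+1}}α^{(n+1)}_j e^{u_j}(1+i s_j))·exp(−Σ_{j∈V_n}[(a_j²+b_j²−1)β^{V_{n+1}}_j(u)+b_jθ^{V_{n+1}}_j(u,s)]) dμ^W_{n+1}(u,s) = ∫ exp(Σ_{j∈Ṽ_n}α^{(n)}_j e^{u_j}(1+i s_j))·exp(−Σ_{j∈V_n}[(a_j²+b_j²−1)β^{V_n}_j(u)+b_jθ^{V_n}_j(u,s)]) dμ^W_n(u,s), where i denotes the imaginary unit and both integrals are of complex-valued functions. -/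
open MeasureTheory Real Finset BigOperators

noncomputable section

/-- The matrix `A^W(u)`: off-diagonal entries `-W i j * exp (u i + u j)`,
diagonal entries `∑ k, W i k * exp (u i + u k)`. -/
def Amat {V : Type*} [Fintype V] [DecidableEq V] (W : V → V → ℝ) (u : V → ℝ) :
    Matrix V V ℝ :=
  Matrix.of fun i j =>
    if i = j then ∑ k, W i k * Real.exp (u i + u k)
    else -(W i j * Real.exp (u i + u j))

/-- The restriction `A^W_{VV}(u)` of `A^W(u)` to `V×V` where `V = Ṽ∖{δ}`. -/
def AVV {V : Type*} [Fintype V] [DecidableEq V] (W : V → V → ℝ) (δ : V) (u : V → ℝ) :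
    Matrix {i : V // i ≠ δ} {i : V // i ≠ δ} ℝ :=
  Matrix.of fun i j => Amat W u i.1 j.1

/-- The density `ρ^W(u,s)`.  The product over undirected edges
`∏_{(i∼j)∈Ẽ} e^{−W_{ij}(cosh(u_i−u_j)−1)}` is written as
`exp(−(1/2)·Σ_{i,j} W_{ij}(cosh(u_i−u_j)−1))` (sum over all ordered pairs), which agrees
with it since `W` is symmetric and vanishes on the diagonal and off the edge set. -/
def rhoW {V : Type*} [Fintype V] [DecidableEq V] (W : V → V → ℝ) (δ : V) (u s : V → ℝ) :
    ℝ :=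
  Real.exp (-(1 / 2) * ∑ i, ∑ j, s i * Amat W u i j * s j)
    * (AVV W δ u).det
    * Real.exp (-((1 / 2) * ∑ i, ∑ j, W i j * (Real.cosh (u i - u j) - 1)))

/-- Extension of a vector indexed by `V = Ṽ∖{δ}` to `Ṽ` by the value `0` at `δ`. -/
def extendByZero {V : Type*} [DecidableEq V] (δ : V) (x : {i : V // i ≠ δ} → ℝ) : V → ℝ :=
  fun i => if h : i = δ then 0 else x ⟨i, h⟩

/-- The reference measure on `(ℝ^Ṽ)×(ℝ^Ṽ)`: Lebesgue measure on the coordinates in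
`V = Ṽ∖{δ}`, with the coordinates at `δ` fixed to `0` (Dirac measure at `0`). -/
def baseMeasure {V : Type*} [Fintype V] [DecidableEq V] (δ : V) :
    Measure ((V → ℝ) × (V → ℝ)) :=
  Measure.map
    (fun p : ({i : V // i ≠ δ} → ℝ) × ({i : V // i ≠ δ} → ℝ) =>
      (extendByZero δ p.1, extendByZero δ p.2))
    volume

/-- The measure `μ^W(du ds) = ρ^W(u,s)·∏_{i∈V}(2π)^{−1} e^{−u_i} du_i ds_i` on `Ω_V`. -/
def muW {V : Type*} [Fintype V] [DecidableEq V] (W : V → V → ℝ) (δ : V) :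
    Measure ((V → ℝ) × (V → ℝ)) :=
  (baseMeasure δ).withDensity fun p =>
    ENNReal.ofReal (rhoW W δ p.1 p.2 *
      ∏ i : {i : V // i ≠ δ}, Real.exp (-(p.1 i.1)) / (2 * Real.pi))

/-- `β_i(u) = (1/2)·Σ_j W_{ij} e^{u_j−u_i}`. -/
def betaW {V : Type*} [Fintype V] (W : V → V → ℝ) (u : V → ℝ) (i : V) : ℝ :=
  (1 / 2) * ∑ j, W i j * Real.exp (u j - u i)

/-- `θ_i(u,s) = Σ_j W_{ij} e^{u_j}(s_i−s_j)`. -/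
def thetaW {V : Type*} [Fintype V] (W : V → V → ℝ) (u s : V → ℝ) (i : V) : ℝ :=
  ∑ j, W i j * Real.exp (u j) * (s i - s j)

/-- The weights of the wired finite graph `G̃_S` with vertex set `S ∪ {δ_S}`, encoded as
`Option {i // i ∈ S}` with `none` playing the role of the distinguished vertex `δ_S`:
`W^{(S)}_{ij} = W_{ij}` for `i,j ∈ S` and `W^{(S)}_{iδ_S} = Σ_{j∉S} W_{ij}`. -/
def wiredW {Vinf : Type*} (W : Vinf → Vinf → ℝ) (S : Finset Vinf) :
    Option {i : Vinf // i ∈ S} → Option {i : Vinf // i ∈ S} → ℝ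
  | some i, some j => W i.1 j.1
  | some i, none => ∑' j : {j : Vinf // j ∉ S}, W i.1 j.1
  | none, some j => ∑' k : {k : Vinf // k ∉ S}, W j.1 k.1
  | none, none => 0

/-- The extension `α^{(S)}` of `α` to the wired vertex set `S ∪ {δ_S}`:
`α^{(S)}_i = α_i` for `i ∈ S` and `α^{(S)}_{δ_S} = Σ_{j∉S} α_j`. -/
def alphaExt {Vinf : Type*} (α : Vinf → ℝ) (S : Finset Vinf) :
    Option {i : Vinf // i ∈ S} → ℝ :=
  fun v => v.elim (∑' j : {j : Vinf // j ∉ S}, α j.1) (fun i => α i.1)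

set_option linter.unusedSectionVars false

lemma gaussHalf_lintegral : ∫⁻ y : ℝ, ENNReal.ofReal (Real.exp (-(y^2)/2)) = ENNReal.ofReal (√(2*π)) := by
  rw [← ofReal_integral_eq_lintegral_ofReal]
  · have := integral_gaussian (1/2)
    rw [show π / (1/2) = 2 * π by ring] at this
    rw [← this]
    congr 2
    ext y; congr 1; ring
  · have := integrable_exp_neg_mul_sq (b := 1/2) (by norm_num)
    refine this.congr (Filter.Eventually.of_forall fun y => ?_)
    simp only; congr 1; ring
  · exact Filter.Eventually.of_forall fun y => (Real.exp_pos _).le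

lemma igPos (a c : ℝ) (ha : 0 < a) (hc : 0 < c) :
    ∫⁻ t in Set.Ioi (0:ℝ), ENNReal.ofReal (Real.exp (-(a^2*t)/2 - c^2/(2*t)) / √t)
      = ENNReal.ofReal (√(2*π)/a * Real.exp (-(a*c))) := by
  set f : ℝ → ℝ := fun t => Real.exp (-(a^2*t)/2 - c^2/(2*t)) with hf

  set φ : ℝ → ℝ := fun t => a * √t - c / √t with hφ
  have hder : ∀ t ∈ Set.Ioi (0:ℝ), HasDerivWithinAt φ (a / (2*√t) + c / (2 * (t * √t))) (Set.Ioi 0) t := by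
    intro t ht
    have ht' : (0:ℝ) < t := ht
    have hs : 0 < √t := Real.sqrt_pos.2 ht'
    have h1 := Real.hasDerivAt_sqrt ht'.ne'
    have h2 := (h1.const_mul a).sub ((hasDerivAt_const t c).div h1 hs.ne')
    refine (h2.congr_deriv ?_).hasDerivWithinAt
    have : √t ^ 2 = t := Real.sq_sqrt ht'.le
    rw [this]; field_simp; ring
  have hmono : StrictMonoOn φ (Set.Ioi 0) := by
    intro x hx y hy hxy
    have hx' : (0:ℝ) < x := hx
    have hsx : 0 < √x := Real.sqrt_pos.2 hx'
    have hsy : √x < √y := Real.sqrt_lt_sqrt hx'.le hxy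
    have h1 : a * √x < a * √y := by gcongr
    have h2 : c / √y < c / √x := by gcongr
    simp only [hφ]; linarith
  have himg : φ '' Set.Ioi 0 = Set.univ := by
    ext y
    simp only [Set.mem_image, Set.mem_Ioi, Set.mem_univ, iff_true]
    set d := √(y^2 + 4*a*c) with hd
    have hd2 : d^2 = y^2 + 4*a*c := Real.sq_sqrt (by positivity)
    have hdy : |y| < d := by
      rw [hd]; apply Real.lt_sqrt_of_sq_lt; rw [sq_abs]; nlinarith [mul_pos ha hc]
    have hpos : 0 < y + d := by linarith [neg_abs_le y]
    refine ⟨((y+d)/(2*a))^2, by positivity, ?_⟩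
    simp only [hφ]
    rw [Real.sqrt_sq (by positivity)]
    field_simp
    nlinarith
  have e1 := lintegral_image_eq_lintegral_abs_deriv_mul measurableSet_Ioi hder hmono.injOn
    (fun y => ENNReal.ofReal (Real.exp (-(y^2)/2)))
  rw [himg, Measure.restrict_univ, gaussHalf_lintegral] at e1

  have hder2 : ∀ t ∈ Set.Ioi (0:ℝ), HasDerivWithinAt (fun t => c^2/a^2/t) (-(c^2/a^2)/t^2) (Set.Ioi 0) t := by
    intro t ht
    have ht' : (0:ℝ) < t := ht
    have h2 := ((hasDerivAt_const t (c^2/a^2)).div (hasDerivAt_id t) ht'.ne')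
    refine (h2.congr_deriv ?_).hasDerivWithinAt
    simp
  have hinj2 : Set.InjOn (fun t : ℝ => c^2/a^2/t) (Set.Ioi 0) := by
    intro x hx y hy hxy
    have hx' : (0:ℝ) < x := hx
    have hy' : (0:ℝ) < y := hy
    simp only at hxy
    field_simp at hxy
    exact hxy.symm
  have himg2 : (fun t : ℝ => c^2/a^2/t) '' Set.Ioi 0 = Set.Ioi 0 := by
    ext y
    simp only [Set.mem_image, Set.mem_Ioi]
    constructor
    · rintro ⟨x, hx, rfl⟩; positivity
    · intro hy; exact ⟨c^2/a^2/y, by positivity, by field_simp⟩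
  have e2 := lintegral_image_eq_lintegral_abs_deriv_mul measurableSet_Ioi hder2 hinj2
    (fun t => ENNReal.ofReal (a / (2*√t) * f t))
  rw [himg2] at e2
  have e3 : ∫⁻ t in Set.Ioi (0:ℝ), ENNReal.ofReal (a / (2*√t) * f t) =
      ∫⁻ t in Set.Ioi (0:ℝ), ENNReal.ofReal (c / (2*(t*√t)) * f t) := by
    rw [e2]
    refine setLIntegral_congr_fun measurableSet_Ioi fun t ht => ?_
    have ht' : (0:ℝ) < t := ht
    have hs : 0 < √t := Real.sqrt_pos.2 ht'
    try simp only
    rw [← ENNReal.ofReal_mul (abs_nonneg _)]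
    congr 1
    have h1 : √(c^2/a^2/t) = c / a / √t := by
      rw [Real.sqrt_div (by positivity), Real.sqrt_div (by positivity), Real.sqrt_sq hc.le, Real.sqrt_sq ha.le]
    have h2 : f (c^2/a^2/t) = f t := by
      simp only [hf]; congr 1; field_simp; ring
    rw [h1, h2, neg_div, abs_neg, abs_of_pos (by positivity)]
    have : √t ^ 2 = t := Real.sq_sqrt ht'.le
    field_simp
    rw [this]
  have e4 : ENNReal.ofReal (√(2*π)) = ENNReal.ofReal (a * Real.exp (a*c)) *
      ∫⁻ t in Set.Ioi (0:ℝ), ENNReal.ofReal (f t / √t) := by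
    rw [e1]
    have hfm : Measurable f := by fun_prop
    have : ∫⁻ t in Set.Ioi (0:ℝ), ENNReal.ofReal |a / (2*√t) + c / (2 * (t * √t))| *
        ENNReal.ofReal (Real.exp (-(φ t ^2)/2)) =
        ∫⁻ t in Set.Ioi (0:ℝ), ENNReal.ofReal (Real.exp (a*c)) *
          (ENNReal.ofReal (a / (2*√t) * f t) + ENNReal.ofReal (c / (2*(t*√t)) * f t)) := by
      refine setLIntegral_congr_fun measurableSet_Ioi fun t ht => ?_
      have ht' : (0:ℝ) < t := ht
      have hs : 0 < √t := Real.sqrt_pos.2 ht'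
      have hft : 0 < f t := Real.exp_pos _
      try simp only
      rw [← ENNReal.ofReal_mul (abs_nonneg _), ← ENNReal.ofReal_add (by positivity) (by positivity),
        ← ENNReal.ofReal_mul (by positivity), abs_of_pos (by positivity)]
      congr 1
      have : Real.exp (-(φ t ^2)/2) = Real.exp (a*c) * f t := by
        simp only [hf, ← Real.exp_add, hφ]
        congr 1
        have h3 : √t ^ 2 = t := Real.sq_sqrt ht'.le
        have h4 : (a * √t - c/√t)^2 = a^2 * t - 2*a*c + c^2/t := by
          rw [sub_sq, mul_pow, div_pow, h3]; field_simp
        rw [h4]; field_simp; ring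
      rw [this]; ring
    rw [this, lintegral_const_mul _ (by fun_prop), lintegral_add_left (by fun_prop), ← e3,
      ENNReal.ofReal_mul ha.le, mul_assoc, mul_left_comm]
    congr 1
    rw [← lintegral_add_left (by fun_prop), ← lintegral_const_mul _ (by fun_prop)]
    refine setLIntegral_congr_fun measurableSet_Ioi fun t ht => ?_
    have ht' : (0:ℝ) < t := ht
    have hs : 0 < √t := Real.sqrt_pos.2 ht'
    have hft : 0 < f t := Real.exp_pos _
    try simp only
    rw [← ENNReal.ofReal_add (by positivity) (by positivity), ← ENNReal.ofReal_mul (by positivity)]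
    congr 1
    field_simp; ring
  have hk : 0 < a * Real.exp (a*c) := by positivity
  have : √(2*π)/a * Real.exp (-(a*c)) = (a * Real.exp (a*c))⁻¹ * √(2*π) := by
    rw [Real.exp_neg]; field_simp
  rw [this, ENNReal.ofReal_mul (by positivity), e4, ← mul_assoc, ← ENNReal.ofReal_mul (by positivity),
    inv_mul_cancel₀ hk.ne']
  simp [hf]

lemma igZero (a : ℝ) (ha : 0 < a) :
    ∫⁻ t in Set.Ioi (0:ℝ), ENNReal.ofReal (Real.exp (-(a^2*t)/2) / √t)
      = ENNReal.ofReal (√(2*π)/a) := by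
  have h := Real.integral_rpow_mul_exp_neg_mul_Ioi (a := 1/2) (r := a^2/2) (by norm_num) (by positivity)
  rw [Real.Gamma_one_half_eq] at h
  have hval : (1 / (a^2/2)) ^ (1/2 : ℝ) * √π = √(2*π)/a := by
    rw [← Real.sqrt_eq_rpow, ← Real.sqrt_mul (by positivity),
      show 1 / (a^2/2) * π = 2*π / a^2 by field_simp, Real.sqrt_div (by positivity), Real.sqrt_sq ha.le]
  rw [hval] at h
  have hpos : √(2*π)/a ≠ 0 := by positivity
  have hInt := MeasureTheory.Integrable.of_integral_ne_zero (h ▸ hpos)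
  rw [← h, ofReal_integral_eq_lintegral_ofReal hInt]
  · refine setLIntegral_congr_fun measurableSet_Ioi fun t ht => ?_
    have ht' : (0:ℝ) < t := ht
    try simp only
    congr 1
    rw [show (1/2 : ℝ) - 1 = -(1/2) by norm_num, Real.rpow_neg ht'.le, ← Real.sqrt_eq_rpow]
    rw [show -(a^2*t)/2 = -(a^2/2*t) by ring]; field_simp
  · refine (ae_restrict_iff' measurableSet_Ioi).2 (Filter.Eventually.of_forall fun t ht => ?_)
    have ht' : (0:ℝ) < t := ht
    simp only [Pi.zero_apply]; positivity

lemma igInt (a c : ℝ) (ha : 0 < a) (hc : 0 ≤ c) :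
    ∫⁻ t in Set.Ioi (0:ℝ), ENNReal.ofReal (Real.exp (-(a^2*t)/2 - c^2/(2*t)) / √t)
      = ENNReal.ofReal (√(2*π)/a * Real.exp (-(a*c))) := by
  rcases hc.eq_or_lt with rfl | hc
  · simpa using igZero a ha
  · exact igPos a c ha hc

/-- The matrix `2β - w`. -/
def Hm {ι : Type*} [DecidableEq ι] (w : ι → ι → ℝ) (β : ι → ℝ) : Matrix ι ι ℝ :=
  Matrix.diagonal (fun i => 2 * β i) - Matrix.of w

/-- Quadratic form of the inverse. -/
def quadInv {ι : Type*} [Fintype ι] [DecidableEq ι] (w : ι → ι → ℝ) (η : ι → ℝ) (β : ι → ℝ) : ℝ :=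
  η ⬝ᵥ ((Hm w β)⁻¹).mulVec η

/-- The density in the `β` coordinates. -/
def gfun {ι : Type*} [Fintype ι] [DecidableEq ι] (w : ι → ι → ℝ) (a η : ι → ℝ) (β : ι → ℝ) : ℝ :=
  Real.exp (-∑ i, a i ^ 2 * β i - (1/2) * quadInv w η β) / √(Hm w β).det

/-- The density cut off to the positive definite region. -/
def Gfun {ι : Type*} [Fintype ι] [DecidableEq ι] (w : ι → ι → ℝ) (a η : ι → ℝ) : (ι → ℝ) → ENNReal :=
  Set.indicator {β | (Hm w β).PosDef} (fun β => ENNReal.ofReal (gfun w a η β))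

section basic
variable {ι : Type*} [Fintype ι] [DecidableEq ι]

lemma Hm_isHermitian {w : ι → ι → ℝ} (hs : ∀ i j, w i j = w j i) (β : ι → ℝ) :
    (Hm w β).IsHermitian := by
  ext i j
  by_cases h : i = j
  · subst h; simp [Hm]
  · simp [Hm, Matrix.diagonal_apply_ne _ h, Matrix.diagonal_apply_ne _ (Ne.symm h), hs i j]

lemma continuous_Hm (w : ι → ι → ℝ) : Continuous (Hm w) := by
  have h : Continuous (fun β : ι → ℝ => (fun i => 2 * β i)) := by fun_prop
  exact (Continuous.matrix_diagonal h).sub continuous_const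

lemma posDef_iff_psd_det (M : Matrix ι ι ℝ) : M.PosDef ↔ M.PosSemidef ∧ M.det ≠ 0 := by
  constructor
  · intro h; exact ⟨h.posSemidef, h.det_pos.ne'⟩
  · rintro ⟨h1, h2⟩; exact h1.posDef_iff_det_ne_zero.2 h2

lemma measurableSet_posDef {w : ι → ι → ℝ} (hs : ∀ i j, w i j = w j i) :
    MeasurableSet {β | (Hm w β).PosDef} := by
  have : {β | (Hm w β).PosDef} = (⋂ x : ι → ℝ, {β | 0 ≤ x ⬝ᵥ (Hm w β).mulVec x}) ∩
      {β | (Hm w β).det = 0}ᶜ := by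
    ext β
    simp only [Set.mem_ofPred_eq, Set.mem_inter_iff, Set.mem_iInter, Set.mem_compl_iff,
      posDef_iff_psd_det, Matrix.posSemidef_iff_dotProduct_mulVec, Hm_isHermitian hs, true_and,
      star_trivial]
  rw [this]
  have hc := continuous_Hm w
  refine MeasurableSet.inter (IsClosed.measurableSet (isClosed_iInter fun x => ?_)) ?_
  · exact isClosed_le continuous_const (continuous_const.dotProduct (hc.matrix_mulVec continuous_const))
  · exact (IsClosed.measurableSet (isClosed_eq hc.matrix_det continuous_const)).compl

lemma measurable_quadInv (w : ι → ι → ℝ) (η : ι → ℝ) : Measurable (quadInv w η) := by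
  have hc := continuous_Hm w
  have : quadInv w η = fun β => ((Hm w β).det)⁻¹ * (η ⬝ᵥ (Hm w β).adjugate.mulVec η) := by
    ext β
    simp [quadInv, Matrix.inv_def, Matrix.smul_mulVec, dotProduct_smul]
  rw [this]
  exact (hc.matrix_det.measurable.inv).mul
    (continuous_const.dotProduct (hc.matrix_adjugate.matrix_mulVec continuous_const)).measurable

lemma measurable_gfun (w : ι → ι → ℝ) (a η : ι → ℝ) : Measurable (gfun w a η) := by
  have hc := (continuous_Hm w).matrix_det.measurable
  have := measurable_quadInv w η
  unfold gfun
  refine Measurable.div (Measurable.exp (Measurable.sub ?_ (this.const_mul _))) hc.sqrt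
  fun_prop

lemma measurable_Gfun {w : ι → ι → ℝ} (hs : ∀ i j, w i j = w j i) (a η : ι → ℝ) :
    Measurable (Gfun w a η) :=
  (measurable_gfun w a η).ennreal_ofReal.indicator (measurableSet_posDef hs)

/-- Positive definite matrices with nonpositive off-diagonal entries are inverse-nonnegative. -/
lemma mmatrix_nonneg {M : Matrix ι ι ℝ} (hM : M.PosDef) (hoff : ∀ i j, i ≠ j → M i j ≤ 0)
    {x : ι → ℝ} (hx : ∀ i, 0 ≤ M.mulVec x i) : ∀ i, 0 ≤ x i := by
  set y : ι → ℝ := fun i => min (x i) 0 with hy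
  by_contra hcon
  push Not at hcon
  obtain ⟨i₀, hi₀⟩ := hcon
  have hyne : y ≠ 0 := by
    intro h
    have := congrFun h i₀
    simp only [hy, Pi.zero_apply] at this
    rw [min_eq_left hi₀.le] at this
    linarith
  have h1 := hM.dotProduct_mulVec_pos hyne
  rw [star_trivial] at h1
  have h2 : y ⬝ᵥ M.mulVec y ≤ y ⬝ᵥ M.mulVec x := by
    simp only [dotProduct, Matrix.mulVec, Finset.mul_sum]
    refine Finset.sum_le_sum fun i _ => Finset.sum_le_sum fun j _ => ?_
    by_cases hij : i = j
    · subst hij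
      have hd := (hM.diag_pos (i := i)).le
      have : y i * y i = y i * x i := by
        simp only [hy]; rcases le_total (x i) 0 with h | h
        · rw [min_eq_left h]
        · rw [min_eq_right h]; ring
      nlinarith
    · have h3 := hoff i j hij
      have h4 : y i ≤ 0 := min_le_right _ _
      have h5 : y j ≤ x j := min_le_left _ _
      have h6 : 0 ≤ y i * M i j := mul_nonneg_of_nonpos_of_nonpos h4 h3
      nlinarith
  have h3 : y ⬝ᵥ M.mulVec x ≤ 0 :=
    Finset.sum_nonpos fun i _ => mul_nonpos_of_nonpos_of_nonneg (min_le_right _ _) (hx i)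
  linarith

lemma Hm_off {w : ι → ι → ℝ} (hw : ∀ i j, 0 ≤ w i j) (β : ι → ℝ) (i j : ι) (h : i ≠ j) :
    Hm w β i j ≤ 0 := by
  simp [Hm, Matrix.diagonal_apply_ne _ h, hw i j]

lemma mulVec_inv_self {M : Matrix ι ι ℝ} (hM : M.PosDef) (x : ι → ℝ) :
    M.mulVec (M⁻¹.mulVec x) = x := by
  rw [Matrix.mulVec_mulVec, Matrix.mul_nonsing_inv _ ((Matrix.isUnit_iff_isUnit_det _).1 hM.isUnit),
    Matrix.one_mulVec]

lemma inv_eq_of_mulVec {M : Matrix ι ι ℝ} (hM : M.det ≠ 0) {x y : ι → ℝ}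
    (h : M.mulVec x = y) : M⁻¹.mulVec y = x := by
  rw [← h, Matrix.mulVec_mulVec, Matrix.nonsing_inv_mul _ hM.isUnit, Matrix.one_mulVec]

end basic

section step
variable {κ : Type*} [Fintype κ] [DecidableEq κ]


lemma Hm_blocks (w : κ ⊕ PUnit.{1} → κ ⊕ PUnit.{1} → ℝ) (hs : ∀ i j, w i j = w j i)
    (β : κ → ℝ) (x : ℝ) (w' : κ → κ → ℝ) (hw' : w' = fun i j => w (Sum.inl i) (Sum.inl j))
    (v : κ → ℝ) (hv : v = fun i => w (Sum.inl i) (Sum.inr PUnit.unit)) :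
    Hm w (Sum.elim β (fun _ => x)) =
      Matrix.fromBlocks (Hm w' β) (Matrix.of fun i (_ : PUnit.{1}) => -v i)
        (Matrix.of fun i (_ : PUnit.{1}) => -v i).conjTranspose
        (Matrix.diagonal fun _ => 2 * x - w (Sum.inr PUnit.unit) (Sum.inr PUnit.unit)) := by
  subst hw' hv
  ext i j
  rcases i with i | i <;> rcases j with j | j
  · by_cases h : i = j
    · subst h; simp [Hm]
    · simp [Hm, h]
  · simp [Hm]
  · simp [Hm, hs (Sum.inl j)]
  · simp [Hm]

lemma schur_entry (M : Matrix κ κ ℝ) (v : κ → ℝ) (d : ℝ) :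
    (Matrix.diagonal fun _ => d) - (Matrix.of fun i (_ : PUnit.{1}) => -v i).conjTranspose * M *
      (Matrix.of fun i (_ : PUnit.{1}) => -v i)
      = Matrix.diagonal fun _ : PUnit.{1} => d - v ⬝ᵥ M.mulVec v := by
  ext i j
  simp only [Matrix.sub_apply, Matrix.diagonal_apply, Subsingleton.elim i j, if_true]
  congr 1
  rw [Matrix.mul_assoc]
  simp [Matrix.mul_apply, dotProduct, Matrix.mulVec]

lemma step_det (w : κ ⊕ PUnit.{1} → κ ⊕ PUnit.{1} → ℝ) (hs : ∀ i j, w i j = w j i)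
    (β : κ → ℝ) (x : ℝ) (w' : κ → κ → ℝ) (hw' : w' = fun i j => w (Sum.inl i) (Sum.inl j))
    (v : κ → ℝ) (hv : v = fun i => w (Sum.inl i) (Sum.inr PUnit.unit)) (hP : (Hm w' β).PosDef) :
    (Hm w (Sum.elim β (fun _ => x))).det = (Hm w' β).det *
      (2 * x - w (Sum.inr PUnit.unit) (Sum.inr PUnit.unit) - quadInv w' v β) := by
  rw [Hm_blocks w hs β x w' hw' v hv]
  have := hP.isUnit.invertible
  rw [Matrix.det_fromBlocks₁₁, Matrix.invOf_eq_nonsing_inv, schur_entry]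
  simp [quadInv]

lemma step_posDef (w : κ ⊕ PUnit.{1} → κ ⊕ PUnit.{1} → ℝ) (hs : ∀ i j, w i j = w j i)
    (β : κ → ℝ) (x : ℝ) (w' : κ → κ → ℝ) (hw' : w' = fun i j => w (Sum.inl i) (Sum.inl j))
    (v : κ → ℝ) (hv : v = fun i => w (Sum.inl i) (Sum.inr PUnit.unit)) :
    (Hm w (Sum.elim β (fun _ => x))).PosDef ↔ (Hm w' β).PosDef ∧
      0 < 2 * x - w (Sum.inr PUnit.unit) (Sum.inr PUnit.unit) - quadInv w' v β := by
  have key : (Hm w' β).PosDef → ((Hm w (Sum.elim β (fun _ => x))).PosDef ↔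
      0 < 2 * x - w (Sum.inr PUnit.unit) (Sum.inr PUnit.unit) - quadInv w' v β) := by
    intro hP
    rw [posDef_iff_psd_det, step_det w hs β x w' hw' v hv hP, Hm_blocks w hs β x w' hw' v hv]
    have := hP.isUnit.invertible
    rw [Matrix.PosDef.fromBlocks₁₁ _ _ hP, schur_entry, Matrix.posSemidef_diagonal_iff]
    have := hP.det_pos.ne'
    simp only [forall_const, mul_ne_zero_iff, ne_eq, this, not_false_eq_true, true_and]
    unfold quadInv
    constructor
    · rintro ⟨h1, h2⟩; exact lt_of_le_of_ne h1 (Ne.symm h2)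
    · intro h; exact ⟨h.le, h.ne'⟩
  constructor
  · intro h
    have hP : (Hm w' β).PosDef := by
      have := h.submatrix (e := (Sum.inl : κ → κ ⊕ PUnit.{1})) Sum.inl_injective
      rw [Hm_blocks w hs β x w' hw' v hv] at this
      exact this
    exact ⟨hP, (key hP).1 h⟩
  · rintro ⟨hP, h⟩; exact (key hP).2 h

lemma symm_form {M : Matrix κ κ ℝ} (hM : M.IsHermitian) (x y : κ → ℝ) :
    x ⬝ᵥ M.mulVec y = y ⬝ᵥ M.mulVec x := by
  have h : M.transpose = M := by simpa [Matrix.IsHermitian] using hM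
  rw [Matrix.dotProduct_mulVec, ← Matrix.mulVec_transpose, h, dotProduct_comm]

lemma step_quad (w : κ ⊕ PUnit.{1} → κ ⊕ PUnit.{1} → ℝ) (hs : ∀ i j, w i j = w j i)
    (β : κ → ℝ) (x : ℝ) (w' : κ → κ → ℝ) (hw' : w' = fun i j => w (Sum.inl i) (Sum.inl j))
    (v : κ → ℝ) (hv : v = fun i => w (Sum.inl i) (Sum.inr PUnit.unit)) (hP : (Hm w' β).PosDef)
    (t : ℝ) (ht : t = 2 * x - w (Sum.inr PUnit.unit) (Sum.inr PUnit.unit) - quadInv w' v β)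
    (ht0 : 0 < t) (η : κ ⊕ PUnit.{1} → ℝ) (η' : κ → ℝ) (hη' : η' = fun i => η (Sum.inl i)) :
    quadInv w η (Sum.elim β (fun _ => x)) = quadInv w' η' β +
      (η (Sum.inr PUnit.unit) + v ⬝ᵥ (Hm w' β)⁻¹.mulVec η') ^ 2 / t := by
  have hdet : (Hm w (Sum.elim β (fun _ => x))).det ≠ 0 := by
    rw [step_det w hs β x w' hw' v hv hP, ← ht]
    exact mul_ne_zero hP.det_pos.ne' ht0.ne'
  set G := (Hm w' β)⁻¹ with hG
  have hGH : G.IsHermitian := hP.inv.isHermitian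
  set x0 : ℝ := (η (Sum.inr PUnit.unit) + v ⬝ᵥ G.mulVec η') / t with hx0
  have hx0t : t * x0 = η (Sum.inr PUnit.unit) + v ⬝ᵥ G.mulVec η' := by
    rw [hx0]; field_simp
  set X : κ ⊕ PUnit.{1} → ℝ := Sum.elim (G.mulVec (η' + x0 • v)) (fun _ => x0) with hX
  have hsol : (Hm w (Sum.elim β (fun _ => x))).mulVec X = η := by
    rw [Hm_blocks w hs β x w' hw' v hv, Matrix.fromBlocks_mulVec]
    have e1 : (X ∘ Sum.inl) = G.mulVec (η' + x0 • v) := by ext i; simp [hX]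
    have e2 : (X ∘ Sum.inr) = fun _ => x0 := by ext i; simp [hX]
    rw [e1, e2, mulVec_inv_self hP]
    ext i
    rcases i with i | i
    · simp [Matrix.mulVec, dotProduct, hη']; ring
    · simp only [Sum.elim_inr, Pi.add_apply, Matrix.mulVec_diagonal]
      have e3 : ((Matrix.of fun i (_ : PUnit.{1}) => -v i).conjTranspose.mulVec
          (G.mulVec (η' + x0 • v))) i = -(v ⬝ᵥ G.mulVec (η' + x0 • v)) := by
        simp [Matrix.mulVec, dotProduct]
      rw [e3, Matrix.mulVec_add, Matrix.mulVec_smul, dotProduct_add, dotProduct_smul, smul_eq_mul]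
      have e4 : 2 * x - w (Sum.inr PUnit.unit) (Sum.inr PUnit.unit) = t + v ⬝ᵥ G.mulVec v := by
        rw [ht, quadInv]; ring
      rw [e4]
      linear_combination hx0t
  unfold quadInv
  rw [inv_eq_of_mulVec hdet hsol, ← hG]
  have e5 : η ⬝ᵥ X = η' ⬝ᵥ G.mulVec (η' + x0 • v) + η (Sum.inr PUnit.unit) * x0 := by
    simp [dotProduct, hX, hη']
  rw [e5, Matrix.mulVec_add, Matrix.mulVec_smul, dotProduct_add, dotProduct_smul, smul_eq_mul,
    symm_form hGH η' v, ← hx0t]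
  field_simp
  linear_combination x0 * (-hx0t)

lemma step_inner (w : κ ⊕ PUnit.{1} → κ ⊕ PUnit.{1} → ℝ) (hs : ∀ i j, w i j = w j i)
    (hw : ∀ i j, 0 ≤ w i j)
    (β : κ → ℝ) (w' : κ → κ → ℝ) (hw' : w' = fun i j => w (Sum.inl i) (Sum.inl j))
    (v : κ → ℝ) (hv : v = fun i => w (Sum.inl i) (Sum.inr PUnit.unit))
    (η : κ ⊕ PUnit.{1} → ℝ) (η' : κ → ℝ) (hη' : η' = fun i => η (Sum.inl i))
    (hη : ∀ i, 0 ≤ η i)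
    (a : κ ⊕ PUnit.{1} → ℝ) (a' : κ → ℝ) (ha' : a' = fun i => a (Sum.inl i))
    (a0 : ℝ) (ha0 : a0 = a (Sum.inr PUnit.unit)) (ha : 0 < a0) :
    ∫⁻ x : ℝ, Gfun w a η (Sum.elim β (fun _ => x)) =
      ENNReal.ofReal (√(π/2) / a0 * Real.exp (-(a0 * η (Sum.inr PUnit.unit)) -
        (1/2) * (a0^2 * w (Sum.inr PUnit.unit) (Sum.inr PUnit.unit)))) *
        Gfun w' a' (η' + a0 • v) β := by
  by_cases hP : (Hm w' β).PosDef
  swap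
  · have h1 : ∀ x, Gfun w a η (Sum.elim β (fun _ => x)) = 0 := by
      intro x
      unfold Gfun
      rw [Set.indicator_of_notMem]
      simp only [Set.mem_ofPred_eq, step_posDef w hs β x w' hw' v hv]
      tauto
    have h2 : Gfun w' a' (η' + a0 • v) β = 0 := by
      unfold Gfun
      rw [Set.indicator_of_notMem]
      simpa using hP
    simp [h1, h2]
  set w0 := w (Sum.inr PUnit.unit) (Sum.inr PUnit.unit) with hw0
  set η0 := η (Sum.inr PUnit.unit) with hη0
  set k := w0 + quadInv w' v β with hk
  set c := η0 + v ⬝ᵥ (Hm w' β)⁻¹.mulVec η' with hc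
  have hc0 : 0 ≤ c := by
    have h1 : ∀ i, 0 ≤ (Hm w' β)⁻¹.mulVec η' i := by
      apply mmatrix_nonneg hP (Hm_off (by intro i j; rw [hw']; exact hw _ _) β)
      intro i; rw [mulVec_inv_self hP, hη']; exact hη _
    have h2 : 0 ≤ v ⬝ᵥ (Hm w' β)⁻¹.mulVec η' :=
      Finset.sum_nonneg fun i _ => mul_nonneg (by rw [hv]; exact hw _ _) (h1 i)
    have := hη (Sum.inr PUnit.unit)
    rw [hc]; linarith
  have hd : 0 < (Hm w' β).det := hP.det_pos
  have hGx : ∀ x, Gfun w a η (Sum.elim β (fun _ => x)) =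
      ((fun t => (t + k)/2) '' Set.Ioi (0:ℝ)).indicator (fun x =>
        ENNReal.ofReal (gfun w a η (Sum.elim β (fun _ => x)))) x := by
    intro x
    unfold Gfun
    simp only [Set.indicator]
    congr 1
    simp only [Set.mem_ofPred_eq, step_posDef w hs β x w' hw' v hv, Set.mem_image, Set.mem_Ioi, hP,
      true_and, eq_iff_iff]
    constructor
    · intro h; exact ⟨_, h, by rw [hk, hw0]; ring⟩
    · rintro ⟨t, ht, rfl⟩; rw [hk, hw0]; rw [← hw0]; linarith
  have hmeas : MeasurableSet ((fun t => (t + k)/2) '' Set.Ioi (0:ℝ)) := by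
    have : (fun t => (t + k)/2) '' Set.Ioi (0:ℝ) = Set.Ioi (k/2) := by
      ext x
      simp only [Set.mem_image, Set.mem_Ioi]
      constructor
      · rintro ⟨t, ht, rfl⟩; linarith
      · intro h; exact ⟨2*x-k, by linarith, by ring⟩
    rw [this]; exact measurableSet_Ioi
  simp_rw [hGx]
  rw [lintegral_indicator hmeas]
  rw [lintegral_image_eq_lintegral_abs_deriv_mul (f' := fun _ => 1/2) measurableSet_Ioi
    (by intro t _; exact (((hasDerivAt_id t).add_const k).div_const 2).hasDerivWithinAt)
    (by intro x _ y _ h; simp only at h; linarith)]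
  have hpt : ∀ t ∈ Set.Ioi (0:ℝ), ENNReal.ofReal |(1/2:ℝ)| *
      ENNReal.ofReal (gfun w a η (Sum.elim β (fun _ => (t+k)/2))) =
      ENNReal.ofReal (1/2 * Real.exp (-∑ i, a' i ^2 * β i - a0^2 * k/2 - (1/2) * quadInv w' η' β)
          / √(Hm w' β).det) *
        ENNReal.ofReal (Real.exp (-(a0^2*t)/2 - c^2/(2*t)) / √t) := by
    intro t ht
    have ht' : (0:ℝ) < t := ht
    have hs' : 0 < √t := Real.sqrt_pos.2 ht'
    rw [← ENNReal.ofReal_mul (abs_nonneg _), ← ENNReal.ofReal_mul (by positivity)]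
    congr 1
    unfold gfun
    have htt : t = 2 * ((t+k)/2) - w (Sum.inr PUnit.unit) (Sum.inr PUnit.unit) - quadInv w' v β := by
      rw [← hw0, hk]; ring
    rw [step_det w hs β _ w' hw' v hv hP, ← htt,
      step_quad w hs β _ w' hw' v hv hP t htt ht' η η' hη', Real.sqrt_mul hd.le]
    rw [abs_of_pos (by norm_num : (0:ℝ) < 1/2)]
    have : Real.exp (-∑ i, a i ^ 2 * (Sum.elim β (fun _ => (t+k)/2) i : ℝ) - 1/2 * (quadInv w' η' β +
        (η (Sum.inr PUnit.unit) + v ⬝ᵥ (Hm w' β)⁻¹.mulVec η') ^ 2 / t)) =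
        Real.exp (-∑ i, a' i ^2 * β i - a0^2 * k/2 - (1/2) * quadInv w' η' β) *
        Real.exp (-(a0^2*t)/2 - c^2/(2*t)) := by
      rw [← Real.exp_add]
      congr 1
      rw [← hη0, ← hc]
      simp only [Fintype.sum_sum_type, Sum.elim_inl, Sum.elim_inr, Finset.univ_unique,
        Finset.sum_singleton]
      rw [show (default : PUnit.{1}) = PUnit.unit from rfl, ← ha0, ha']
      field_simp
      ring
    rw [this]
    have hsd : 0 < √(Hm w' β).det := Real.sqrt_pos.2 hd
    field_simp
  rw [setLIntegral_congr_fun measurableSet_Ioi hpt, lintegral_const_mul _ (by fun_prop),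
    igInt a0 c ha hc0]
  have hG' : Gfun w' a' (η' + a0 • v) β = ENNReal.ofReal (gfun w' a' (η' + a0 • v) β) := by
    unfold Gfun; rw [Set.indicator_of_mem]; exact hP
  rw [hG', ← ENNReal.ofReal_mul (by positivity), ← ENNReal.ofReal_mul (by positivity)]
  congr 1
  unfold gfun
  have hq : quadInv w' (η' + a0 • v) β = quadInv w' η' β + 2 * a0 * (v ⬝ᵥ (Hm w' β)⁻¹.mulVec η')
      + a0^2 * quadInv w' v β := by
    unfold quadInv
    rw [Matrix.mulVec_add, Matrix.mulVec_smul, dotProduct_add, dotProduct_smul, add_dotProduct,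
      add_dotProduct, smul_dotProduct, smul_dotProduct, symm_form hP.inv.isHermitian η' v]
    simp only [smul_eq_mul]; ring
  have h2pi : √(2*π) = 2 * √(π/2) := by
    rw [show 2*π = 2^2 * (π/2) by ring, Real.sqrt_mul (by positivity), Real.sqrt_sq (by norm_num)]
  have hexp : Real.exp (-∑ i, a' i ^2 * β i - a0^2 * k/2 - (1/2) * quadInv w' η' β) *
      Real.exp (-(a0*c)) = Real.exp (-(a0 * η0) - (1/2) * (a0^2 * w0)) *
      Real.exp (-∑ i, a' i ^2 * β i - (1/2) * quadInv w' (η' + a0 • v) β) := by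
    rw [← Real.exp_add, ← Real.exp_add]
    congr 1
    rw [hq, hk, hc]; ring
  rw [h2pi]
  have hsd : 0 < √(Hm w' β).det := Real.sqrt_pos.2 hd
  generalize Real.exp (-∑ i, a' i ^2 * β i - a0^2 * k/2 - (1/2) * quadInv w' η' β) = E1 at hexp ⊢
  generalize Real.exp (-(a0*c)) = E2 at hexp ⊢
  generalize Real.exp (-(a0 * η0) - (1/2) * (a0^2 * w0)) = E3 at hexp ⊢
  generalize Real.exp (-∑ i, a' i ^2 * β i - (1/2) * quadInv w' (η' + a0 • v) β) = E4 at hexp ⊢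
  field_simp
  linear_combination hexp

end step

/-- The statement of the `β`-integral, for induction. -/
def BetaStmt (ι : Type*) [Fintype ι] : Prop :=
  ∀ (_ : DecidableEq ι) (w : ι → ι → ℝ), (∀ i j, w i j = w j i) → (∀ i j, 0 ≤ w i j) →
    ∀ (a : ι → ℝ), (∀ i, 0 < a i) → ∀ η : ι → ℝ, (∀ i, 0 ≤ η i) →
    ∫⁻ β : ι → ℝ, Gfun w a η β =
      ENNReal.ofReal (√(π/2) ^ Fintype.card ι * (∏ i, a i)⁻¹ *
        Real.exp (-∑ i, a i * η i - (1/2) * ∑ i, ∑ j, w i j * a i * a j))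

lemma betaStmt_equiv {κ ι : Type*} [Fintype κ] [Fintype ι] (e : κ ≃ ι) (h : BetaStmt κ) :
    BetaStmt ι := by
  classical
  intro _ w hs hw a ha η hη
  have h' := h (Classical.decEq _) (fun i j => w (e i) (e j)) (fun _ _ => hs _ _) (fun _ _ => hw _ _)
    (fun i => a (e i)) (fun _ => ha _) (fun i => η (e i)) (fun _ => hη _)
  have hmp := volume_measurePreserving_piCongrLeft (fun _ : ι => ℝ) e
  rw [← hmp.lintegral_comp (measurable_Gfun hs a η)]
  have hpt : ∀ β : κ → ℝ, Gfun w a η (MeasurableEquiv.piCongrLeft (fun _ : ι => ℝ) e β) =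
      Gfun (fun i j => w (e i) (e j)) (fun i => a (e i)) (fun i => η (e i)) β := by
    intro β
    set β' := MeasurableEquiv.piCongrLeft (fun _ : ι => ℝ) e β with hβ'
    have hb : ∀ i, β' (e i) = β i := by
      intro i; exact Equiv.piCongrLeft_apply_apply (P := fun _ : ι => ℝ) e β i
    have hH : Hm (fun i j => w (e i) (e j)) β = (Hm w β').submatrix e e := by
      ext i j
      by_cases hij : i = j
      · subst hij; simp [Hm, hb]
      · have : e i ≠ e j := fun h => hij (e.injective h)
        simp [Hm, hij]
    have hPD : (Hm (fun i j => w (e i) (e j)) β).PosDef ↔ (Hm w β').PosDef := by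
      rw [hH]
      constructor
      · intro h
        have := h.submatrix (e := e.symm) e.symm.injective
        simpa using this
      · intro h; exact h.submatrix e.injective
    have hq : quadInv (fun i j => w (e i) (e j)) (fun i => η (e i)) β = quadInv w η β' := by
      unfold quadInv
      rw [hH, Matrix.inv_submatrix_equiv]
      simp only [dotProduct, Matrix.mulVec, Matrix.submatrix_apply]
      rw [← e.sum_comp]
      refine Finset.sum_congr rfl fun i _ => ?_
      rw [← e.sum_comp]
    have hg : gfun (fun i j => w (e i) (e j)) (fun i => a (e i)) (fun i => η (e i)) β =
        gfun w a η β' := by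
      unfold gfun
      rw [hq, hH, Matrix.det_submatrix_equiv_self, ← e.sum_comp]
      simp only [hb]
    unfold Gfun
    simp only [Set.indicator, Set.mem_ofPred_eq, hPD, hg]
  simp_rw [hpt]
  rw [h', Fintype.card_congr e, ← e.prod_comp, ← e.sum_comp, ← e.sum_comp]
  have e3 : ∑ i, ∑ j, w (e i) (e j) * a (e i) * a (e j) =
      ∑ i, ∑ j, w (e i) j * a (e i) * a j :=
    Finset.sum_congr rfl fun i _ => e.sum_comp (fun j => w (e i) j * a (e i) * a j)
  rw [e3]

lemma betaStmt_empty : BetaStmt PEmpty := by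
  intro _ w hs hw a ha η hη
  have h1 : Gfun w a η = fun _ => 1 := by
    ext β
    unfold Gfun
    rw [Set.indicator_of_mem]
    · simp [gfun, quadInv]
    · show (Hm w β).PosDef
      rw [posDef_iff_psd_det]
      have : Hm w β = 1 := Subsingleton.elim _ _
      rw [this]
      exact ⟨Matrix.PosSemidef.one, by simp⟩
  rw [h1]
  simp
  rw [volume_pi, Measure.pi_univ]; simp

lemma betaStmt_step {κ : Type*} [Fintype κ] (h : BetaStmt κ) : BetaStmt (κ ⊕ PUnit.{1}) := by
  classical
  intro inst w hs hw a ha η hη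
  have hinst : inst = instDecidableEqSum := Subsingleton.elim _ _
  subst hinst
  have hmp := volume_measurePreserving_sumPiEquivProdPi_symm (fun _ : κ ⊕ PUnit.{1} => ℝ)
  have hGm := measurable_Gfun hs a η
  rw [← hmp.lintegral_comp hGm, Measure.volume_eq_prod, lintegral_prod
    (fun z => Gfun w a η ((MeasurableEquiv.sumPiEquivProdPi fun _ : κ ⊕ PUnit.{1} => ℝ).symm z))
    (hGm.comp (MeasurableEquiv.measurable _)).aemeasurable]
  have hin : ∀ β : κ → ℝ, ∫⁻ y : PUnit.{1} → ℝ, Gfun w a η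
      ((MeasurableEquiv.sumPiEquivProdPi fun _ : κ ⊕ PUnit.{1} => ℝ).symm (β, y)) =
      ∫⁻ x : ℝ, Gfun w a η (Sum.elim β (fun _ => x)) := by
    intro β
    have hm2 := (volume_preserving_funUnique PUnit.{1} ℝ)
    rw [← hm2.lintegral_comp_emb (MeasurableEquiv.measurableEmbedding _)]
    refine lintegral_congr fun y => ?_
    congr 1
  simp_rw [hin]
  have hstep := fun β => step_inner w hs hw β _ rfl _ rfl η _ rfl hη a _ rfl _ rfl (ha _)
  simp_rw [hstep]
  have hmm : Measurable (Gfun (fun i j => w (Sum.inl i) (Sum.inl j)) (fun i => a (Sum.inl i))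
    ((fun i => η (Sum.inl i)) + a (Sum.inr PUnit.unit) • fun i => w (Sum.inl i) (Sum.inr PUnit.unit))) :=
    measurable_Gfun (fun _ _ => hs _ _) _ _
  rw [lintegral_const_mul _ hmm, h _ _ (fun _ _ => hs _ _) (fun _ _ => hw _ _) _ (fun _ => ha _) _
    (fun i => by
      have := mul_nonneg (ha (Sum.inr PUnit.unit)).le (hw (Sum.inl i) (Sum.inr PUnit.unit))
      have := hη (Sum.inl i)
      simp only [Pi.add_apply, Pi.smul_apply, smul_eq_mul]; positivity)]
  have hpr : 0 < ∏ i, a (Sum.inl i) := Finset.prod_pos fun i _ => ha _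
  have h0 := ha (Sum.inr PUnit.unit)
  rw [← ENNReal.ofReal_mul (by positivity)]
  congr 1
  simp only [Fintype.card_sum, Fintype.card_punit, Fintype.prod_sum_type, Fintype.sum_sum_type,
    Finset.univ_unique, Finset.sum_singleton, Finset.prod_singleton, pow_succ]
  rw [show (default : PUnit.{1}) = PUnit.unit from rfl]
  have comb : ∀ (s p q m e1 e2 e3 : ℝ), e1 * e2 = e3 →
      s / p * e1 * (m * q⁻¹ * e2) = m * s * (q * p)⁻¹ * e3 := by
    intro s p q m e1 e2 e3 h
    rw [← h, mul_inv, div_eq_mul_inv]; ring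
  apply comb
  rw [← Real.exp_add]
  congr 1
  · simp only [Pi.add_apply, Pi.smul_apply, smul_eq_mul, mul_add, Finset.sum_add_distrib]
    have e1 : ∑ i, w (Sum.inr PUnit.unit) (Sum.inl i) * a (Sum.inr PUnit.unit) * a (Sum.inl i) =
        ∑ i, a (Sum.inl i) * (a (Sum.inr PUnit.unit) * w (Sum.inl i) (Sum.inr PUnit.unit)) :=
      Finset.sum_congr rfl fun i _ => by rw [hs]; ring
    have e2 : ∑ i, w (Sum.inl i) (Sum.inr PUnit.unit) * a (Sum.inl i) * a (Sum.inr PUnit.unit) =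
        ∑ i, a (Sum.inl i) * (a (Sum.inr PUnit.unit) * w (Sum.inl i) (Sum.inr PUnit.unit)) :=
      Finset.sum_congr rfl fun i _ => by ring
    rw [e1, e2]; ring

theorem betaStmt (ι : Type*) [Fintype ι] : BetaStmt ι := by
  refine Fintype.induction_empty_option (P := fun ι _ => BetaStmt ι) ?_ ?_ ?_ ι
  · intro α β _ e h
    exact @betaStmt_equiv α β (Fintype.ofEquiv β e.symm) _ e h
  · exact betaStmt_empty
  · intro α _ h
    exact betaStmt_equiv (Equiv.optionEquivSumPUnit.{0} α).symm (betaStmt_step h)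

section gauss
variable {ι : Type*} [Fintype ι] [DecidableEq ι]

lemma gauss0 {A : Matrix ι ι ℝ} (hA : A.PosDef) (z : ι → ℝ) :
    Integrable (fun s : ι → ℝ => Complex.exp (((-(1/2) * (s ⬝ᵥ A.mulVec s) : ℝ) : ℂ) +
      Complex.I * ((z ⬝ᵥ s : ℝ) : ℂ))) ∧
    ∫ s : ι → ℝ, Complex.exp (((-(1/2) * (s ⬝ᵥ A.mulVec s) : ℝ) : ℂ) +
      Complex.I * ((z ⬝ᵥ s : ℝ) : ℂ)) =
      ((√(2*π) ^ Fintype.card ι / √A.det * Real.exp (-(1/2) * (z ⬝ᵥ A⁻¹.mulVec z)) : ℝ) : ℂ) := by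
  obtain ⟨B, hB⟩ : ∃ B : Matrix ι ι ℝ, A = B.transpose * B := by
    open scoped MatrixOrder in
    obtain ⟨B, hB⟩ := CStarAlgebra.nonneg_iff_eq_star_mul_self.mp hA.posSemidef.nonneg
    exact ⟨B, by simpa [Matrix.star_eq_conjTranspose] using hB⟩
  have hdetA : A.det = B.det ^ 2 := by rw [hB, Matrix.det_mul, Matrix.det_transpose, sq]
  have hdB : B.det ≠ 0 := by
    intro h; have := hA.det_pos; rw [hdetA, h] at this; simp at this
  have hBu : IsUnit B.det := hdB.isUnit
  set y : ι → ℝ := (B⁻¹).transpose.mulVec z with hy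
  set φ : (ι → ℝ) → ℂ := fun v => Complex.exp (-(1/2 : ℂ) * ∑ i, (v i : ℂ)^2 +
    ∑ i, (Complex.I * (y i : ℂ)) * v i) with hφ
  have hφi : Integrable φ := GaussianFourier.integrable_cexp_neg_mul_sum_add (b := 1/2) (by norm_num) _
  have hφv : ∫ v, φ v = _ :=
    GaussianFourier.integral_cexp_neg_mul_sum_add (b := 1/2) (by norm_num) (fun i => Complex.I * (y i : ℂ))
  have hfun : (fun s : ι → ℝ => Complex.exp (((-(1/2) * (s ⬝ᵥ A.mulVec s) : ℝ) : ℂ) +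
      Complex.I * ((z ⬝ᵥ s : ℝ) : ℂ))) = fun s => φ (Matrix.toLin' B s) := by
    ext s
    simp only [hφ, Matrix.toLin'_apply]
    have e1 : s ⬝ᵥ A.mulVec s = ∑ i, (B.mulVec s i)^2 := by
      rw [hB, ← Matrix.mulVec_mulVec, Matrix.dotProduct_mulVec, Matrix.vecMul_transpose]
      simp [dotProduct, sq]
    have e2 : z ⬝ᵥ s = ∑ i, y i * B.mulVec s i := by
      have : y ⬝ᵥ B.mulVec s = z ⬝ᵥ s := by
        rw [hy, Matrix.mulVec_transpose, ← Matrix.dotProduct_mulVec, Matrix.mulVec_mulVec,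
          Matrix.nonsing_inv_mul _ hBu, Matrix.one_mulVec]
      rw [← this]; rfl
    rw [e1, e2]
    congr 1
    push_cast
    simp only [Finset.mul_sum, mul_assoc]
  have hmeas : Measurable (Matrix.toLin' B : (ι → ℝ) → (ι → ℝ)) :=
    (LinearMap.continuous_of_finiteDimensional _).measurable
  have hmap := Real.map_matrix_volume_pi_eq_smul_volume_pi hdB
  have hφi' : Integrable φ (Measure.map (Matrix.toLin' B) volume) := by
    rw [hmap]; exact hφi.smul_measure ENNReal.ofReal_ne_top
  rw [hfun]
  refine ⟨hφi'.comp_measurable hmeas, ?_⟩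
  rw [← integral_map hmeas.aemeasurable hφi'.aestronglyMeasurable, hmap, integral_smul_measure, hφv]
  have e3 : √A.det = |B.det| := by rw [hdetA, Real.sqrt_sq_eq_abs]
  have e4 : z ⬝ᵥ A⁻¹.mulVec z = ∑ i, y i ^2 := by
    have : y ⬝ᵥ y = z ⬝ᵥ A⁻¹.mulVec z := by
      rw [hB, Matrix.mul_inv_rev, ← Matrix.transpose_nonsing_inv, ← Matrix.mulVec_mulVec, ← hy]
      conv_lhs => lhs; rw [hy]
      rw [Matrix.mulVec_transpose, ← Matrix.dotProduct_mulVec]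
    rw [← this]; simp [dotProduct, sq]
  rw [e3, e4, ENNReal.toReal_ofReal (abs_nonneg _), abs_inv]
  have e5 : ((π:ℂ) / (1/2)) ^ ((Fintype.card ι : ℂ)/2) = ((√(2*π) ^ Fintype.card ι : ℝ) : ℂ) := by
    rw [Real.sqrt_eq_rpow, ← Real.rpow_natCast, ← Real.rpow_mul (by positivity),
      Complex.ofReal_cpow (by positivity)]
    congr 1
    · push_cast; ring
    · push_cast; ring
  have e6 : (∑ i, (Complex.I * (y i : ℂ))^2) / (4 * (1/2)) = ((-(1/2) * ∑ i, y i^2 : ℝ) : ℂ) := by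
    simp only [mul_pow, Complex.I_sq]
    push_cast
    rw [← Finset.mul_sum]; ring
  rw [e5, e6, ← Complex.ofReal_exp, ← Complex.ofReal_mul, Complex.real_smul, ← Complex.ofReal_mul]
  congr 1
  ring

lemma gauss1 {A : Matrix ι ι ℝ} (hA : A.PosDef) (z c : ι → ℝ) :
    Integrable (fun s : ι → ℝ => Complex.exp (((-(1/2) * ((s + c) ⬝ᵥ A.mulVec (s + c)) : ℝ) : ℂ) +
      Complex.I * ((z ⬝ᵥ s : ℝ) : ℂ))) ∧
    ∫ s : ι → ℝ, Complex.exp (((-(1/2) * ((s + c) ⬝ᵥ A.mulVec (s + c)) : ℝ) : ℂ) +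
      Complex.I * ((z ⬝ᵥ s : ℝ) : ℂ)) =
      ((√(2*π) ^ Fintype.card ι / √A.det * Real.exp (-(1/2) * (z ⬝ᵥ A⁻¹.mulVec z)) : ℝ) : ℂ) *
        Complex.exp (-(Complex.I * ((z ⬝ᵥ c : ℝ) : ℂ))) := by
  obtain ⟨h1, h2⟩ := gauss0 hA z
  have hfun : (fun s : ι → ℝ => Complex.exp (((-(1/2) * ((s + c) ⬝ᵥ A.mulVec (s + c)) : ℝ) : ℂ) +
      Complex.I * ((z ⬝ᵥ s : ℝ) : ℂ))) = fun s => (fun s => Complex.exp (((-(1/2) * (s ⬝ᵥ A.mulVec s) : ℝ) : ℂ) +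
      Complex.I * ((z ⬝ᵥ s : ℝ) : ℂ))) (s + c) * Complex.exp (-(Complex.I * ((z ⬝ᵥ c : ℝ) : ℂ))) := by
    ext s
    rw [← Complex.exp_add]
    congr 1
    rw [dotProduct_add]; push_cast; ring
  rw [hfun]
  refine ⟨(h1.comp_add_right c).mul_const _, ?_⟩
  rw [integral_mul_const, integral_add_right_eq_self (fun s : ι → ℝ => Complex.exp (((-(1/2) *
    (s ⬝ᵥ A.mulVec s) : ℝ) : ℂ) + Complex.I * ((z ⬝ᵥ s : ℝ) : ℂ))), h2]

end gauss

section uside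
variable {T : Type*} [Fintype T] [DecidableEq T]

/-- Restriction of the weights to `V`. -/
def wV (W : T → T → ℝ) (δ : T) : {i : T // i ≠ δ} → {i : T // i ≠ δ} → ℝ := fun i j => W i.1 j.1

/-- The `β` map in terms of `u` on `V`. -/
def bV (W : T → T → ℝ) (δ : T) (u : {i : T // i ≠ δ} → ℝ) : {i : T // i ≠ δ} → ℝ :=
  fun i => betaW W (extendByZero δ u) i.1

/-- The boundary weights. -/
def etaV (W : T → T → ℝ) (δ : T) : {i : T // i ≠ δ} → ℝ := fun i => W i.1 δ

lemma ext_delta (δ : T) (x : {i : T // i ≠ δ} → ℝ) : extendByZero δ x δ = 0 := by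
  simp [extendByZero]

lemma ext_coe (δ : T) (x : {i : T // i ≠ δ} → ℝ) (i : {i : T // i ≠ δ}) :
    extendByZero δ x i.1 = x i := by
  unfold extendByZero
  rw [dif_neg i.2]

lemma sum_split (δ : T) (f : T → ℝ) : ∑ i, f i = f δ + ∑ i : {i : T // i ≠ δ}, f i.1 :=
  Fintype.sum_eq_add_sum_subtype_ne f δ

lemma conn_induct {W : T → T → ℝ} (hs : ∀ i j, W i j = W j i)
    (hconn : (SimpleGraph.fromRel fun i j : T => 0 < W i j).Connected)
    (S : T → Prop) (hS : ∀ i j, S i → 0 < W i j → S j) (i j : T) (hi : S i) : S j := by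
  obtain ⟨p⟩ := hconn.preconnected i j
  induction p with
  | nil => exact hi
  | cons h p ih =>
    apply ih
    rw [SimpleGraph.fromRel_adj] at h
    rcases h.2 with h | h
    · exact hS _ _ hi h
    · exact hS _ _ hi (by rw [hs]; exact h)

lemma AVV_eq {W : T → T → ℝ} (hd : ∀ i, W i i = 0) (δ : T) (u : {i : T // i ≠ δ} → ℝ) :
    AVV W δ (extendByZero δ u) = Matrix.diagonal (fun i => Real.exp (u i)) *
      Hm (wV W δ) (bV W δ u) * Matrix.diagonal (fun i => Real.exp (u i)) := by
  ext i j
  rw [Matrix.mul_diagonal, Matrix.diagonal_mul]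
  by_cases h : i = j
  · subst h
    simp only [AVV, Amat, Hm, wV, bV, betaW, Matrix.of_apply, if_true, Matrix.sub_apply,
      Matrix.diagonal_apply_eq, hd, sub_zero, ext_coe]
    rw [show ∀ x y : ℝ, x * (2 * (1/2 * y)) * x = (x * y) * x from fun x y => by ring,
      Finset.mul_sum, Finset.sum_mul]
    refine Finset.sum_congr rfl fun k _ => ?_
    rw [mul_left_comm, mul_assoc, ← Real.exp_add, ← Real.exp_add]
    congr 2; ring
  · have h' : i.1 ≠ j.1 := fun h2 => h (Subtype.ext h2)
    simp only [AVV, Amat, Hm, wV, Matrix.of_apply, h', if_false, Matrix.sub_apply,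
      Matrix.diagonal_apply_ne _ h, ext_coe, Real.exp_add]
    ring

lemma Amat_quad {W : T → T → ℝ} (hs : ∀ i j, W i j = W j i) (hd : ∀ i, W i i = 0) (U s : T → ℝ) :
    ∑ i, ∑ j, s i * Amat W U i j * s j =
      (1/2) * ∑ i, ∑ j, W i j * Real.exp (U i + U j) * (s i - s j)^2 := by
  have h1 : ∀ i, ∑ j, s i * Amat W U i j * s j =
      ∑ j, W i j * Real.exp (U i + U j) * (s i * s i - s i * s j) := by
    intro i
    have h2 : ∀ j, s i * Amat W U i j * s j =
        (if i = j then s i * (∑ k, W i k * Real.exp (U i + U k)) * s i else 0) -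
        W i j * Real.exp (U i + U j) * (s i * s j) := by
      intro j
      by_cases h : i = j
      · subst h; simp [Amat, hd]
      · simp [Amat, h]; ring
    simp_rw [h2]
    rw [Finset.sum_sub_distrib]
    simp only [Finset.sum_ite_eq, Finset.mem_univ, if_true]
    rw [Finset.mul_sum, Finset.sum_mul, ← Finset.sum_sub_distrib]
    exact Finset.sum_congr rfl fun j _ => by ring
  simp_rw [h1]
  have h3 : ∑ i, ∑ j, W i j * Real.exp (U i + U j) * (s i * s i - s i * s j) =
      ∑ i, ∑ j, W i j * Real.exp (U i + U j) * (s j * s j - s i * s j) := by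
    rw [Finset.sum_comm]
    refine Finset.sum_congr rfl fun i _ => Finset.sum_congr rfl fun j _ => ?_
    rw [hs j i, add_comm (U j)]; ring
  have h4 : ∑ i, ∑ j, W i j * Real.exp (U i + U j) * (s i - s j)^2 =
      ∑ i, ∑ j, W i j * Real.exp (U i + U j) * (s i * s i - s i * s j) +
      ∑ i, ∑ j, W i j * Real.exp (U i + U j) * (s j * s j - s i * s j) := by
    simp only [← Finset.sum_add_distrib]
    refine Finset.sum_congr rfl fun i _ => Finset.sum_congr rfl fun j _ => ?_
    ring
  rw [h4, ← h3]; ring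

lemma Amat_quad_V (W : T → T → ℝ) (δ : T) (U : T → ℝ) (s : {i : T // i ≠ δ} → ℝ) :
    ∑ i, ∑ j, extendByZero δ s i * Amat W U i j * extendByZero δ s j =
      s ⬝ᵥ (AVV W δ U).mulVec s := by
  rw [sum_split δ]
  simp only [ext_delta, zero_mul, Finset.sum_const_zero, zero_add]
  simp only [dotProduct, Matrix.mulVec, Finset.mul_sum]
  refine Finset.sum_congr rfl fun i _ => ?_
  rw [sum_split δ]
  simp only [ext_delta, mul_zero, zero_add, ext_coe, AVV, Matrix.of_apply]
  exact Finset.sum_congr rfl fun j _ => by ring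

lemma AVV_posDef {W : T → T → ℝ} (hs : ∀ i j, W i j = W j i) (hd : ∀ i, W i i = 0)
    (hw : ∀ i j, 0 ≤ W i j)
    (hconn : (SimpleGraph.fromRel fun i j : T => 0 < W i j).Connected) (δ : T) (U : T → ℝ) :
    (AVV W δ U).PosDef := by
  refine Matrix.PosDef.of_dotProduct_mulVec_pos ?_ ?_
  · ext i j
    simp only [AVV, Amat, Matrix.conjTranspose_apply, Matrix.of_apply, star_trivial]
    by_cases h : i = j
    · subst h; simp
    · have h' : i.1 ≠ j.1 := fun h2 => h (Subtype.ext h2)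
      rw [if_neg h', if_neg (Ne.symm h'), hs, add_comm]
  · intro s hs0
    rw [star_trivial, ← Amat_quad_V, Amat_quad hs hd]
    set S := extendByZero δ s with hS
    have hnn : ∀ i j, 0 ≤ W i j * Real.exp (U i + U j) * (S i - S j)^2 := fun i j =>
      mul_nonneg (mul_nonneg (hw i j) (Real.exp_pos _).le) (sq_nonneg _)
    have hge : 0 ≤ ∑ i, ∑ j, W i j * Real.exp (U i + U j) * (S i - S j)^2 :=
      Finset.sum_nonneg fun i _ => Finset.sum_nonneg fun j _ => hnn i j
    rcases hge.eq_or_lt with h0 | h0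
    · exfalso
      apply hs0
      have h1 := (Finset.sum_eq_zero_iff_of_nonneg
        (fun i _ => Finset.sum_nonneg fun j _ => hnn i j)).1 h0.symm
      have h2 : ∀ i j, W i j * Real.exp (U i + U j) * (S i - S j)^2 = 0 := by
        intro i j
        exact (Finset.sum_eq_zero_iff_of_nonneg (fun j _ => hnn i j)).1 (h1 i (Finset.mem_univ _)) j
          (Finset.mem_univ _)
      ext i
      rw [← ext_coe δ s i, ← hS]
      refine conn_induct hs hconn (fun j => S j = 0) ?_ δ i.1 (ext_delta δ s)
      intro i j hi hij
      have h3 := h2 i j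
      have h4 := Real.exp_pos (U i + U j)
      have h5 : (S i - S j)^2 = 0 := by
        rcases mul_eq_zero.1 h3 with h | h
        · exact absurd h (mul_pos hij h4).ne'
        · exact h
      have h6 : S i - S j = 0 := by simpa using h5
      rw [hi] at h6; linarith
    · linarith

lemma Hm_posDef_of_u {W : T → T → ℝ} (hs : ∀ i j, W i j = W j i) (hd : ∀ i, W i i = 0)
    (hw : ∀ i j, 0 ≤ W i j)
    (hconn : (SimpleGraph.fromRel fun i j : T => 0 < W i j).Connected) (δ : T)
    (u : {i : T // i ≠ δ} → ℝ) : (Hm (wV W δ) (bV W δ u)).PosDef := by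
  have h := AVV_posDef hs hd hw hconn δ (extendByZero δ u)
  rw [AVV_eq hd] at h
  have hU : IsUnit (Matrix.diagonal (fun i : {i : T // i ≠ δ} => Real.exp (u i))) := by
    rw [Matrix.isUnit_iff_isUnit_det, Matrix.det_diagonal]
    exact (Finset.prod_pos fun i _ => Real.exp_pos _).ne'.isUnit
  rw [← Matrix.IsUnit.posDef_star_left_conjugate_iff hU]
  simpa [Matrix.star_eq_conjTranspose, Matrix.diagonal_conjTranspose] using h

lemma det_AVV {W : T → T → ℝ} (hd : ∀ i, W i i = 0) (δ : T) (u : {i : T // i ≠ δ} → ℝ) :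
    (AVV W δ (extendByZero δ u)).det = (∏ i, Real.exp (u i))^2 * (Hm (wV W δ) (bV W δ u)).det := by
  rw [AVV_eq hd, Matrix.det_mul, Matrix.det_mul, Matrix.det_diagonal]; ring

lemma Hm_mulVec (w : {i : T // i ≠ δ} → {i : T // i ≠ δ} → ℝ) (β x : {i : T // i ≠ δ} → ℝ)
    (i : {i : T // i ≠ δ}) :
    (Hm w β).mulVec x i = 2 * β i * x i - ∑ j, w i j * x j := by
  rw [Hm, Matrix.sub_mulVec, Pi.sub_apply, Matrix.mulVec_diagonal]
  rfl

lemma two_bV (W : T → T → ℝ) (δ : T) (u : {i : T // i ≠ δ} → ℝ) (i : {i : T // i ≠ δ}) :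
    2 * bV W δ u i * Real.exp (u i) = W i.1 δ + ∑ j : {i : T // i ≠ δ}, W i.1 j.1 * Real.exp (u j) := by
  unfold bV betaW
  rw [← mul_assoc, show (2:ℝ) * (1/2) = 1 by norm_num, one_mul, sum_split δ, add_mul, Finset.sum_mul]
  simp only [ext_delta, ext_coe]
  congr 1
  · rw [mul_assoc, ← Real.exp_add]; simp
  · refine Finset.sum_congr rfl fun j _ => ?_
    rw [mul_assoc, ← Real.exp_add]; simp

lemma Hm_exp (W : T → T → ℝ) (δ : T) (u : {i : T // i ≠ δ} → ℝ) :
    (Hm (wV W δ) (bV W δ u)).mulVec (fun i => Real.exp (u i)) = etaV W δ := by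
  ext i
  rw [Hm_mulVec, two_bV]
  simp [wV, etaV]

/-- derivative matrix -/
def Jmat (W : T → T → ℝ) (δ : T) (u : {i : T // i ≠ δ} → ℝ) :
    Matrix {i : T // i ≠ δ} {i : T // i ≠ δ} ℝ :=
  Matrix.diagonal (fun i => -(1/2) * Real.exp (-u i)) * Hm (wV W δ) (bV W δ u) *
    Matrix.diagonal (fun i => Real.exp (u i))

lemma det_Jmat {W : T → T → ℝ} (δ : T) (u : {i : T // i ≠ δ} → ℝ)
    (hP : (Hm (wV W δ) (bV W δ u)).PosDef) :
    |(Jmat W δ u).det| = (1/2)^(Fintype.card {i : T // i ≠ δ}) * (Hm (wV W δ) (bV W δ u)).det := by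
  rw [Jmat, Matrix.det_mul, Matrix.det_mul, Matrix.det_diagonal, Matrix.det_diagonal,
    Finset.prod_mul_distrib, abs_mul, abs_mul, abs_mul, abs_of_pos hP.det_pos,
    Finset.prod_const, abs_pow, Finset.card_univ]
  have h1 : 0 < ∏ i, Real.exp (-u i) := Finset.prod_pos fun i _ => Real.exp_pos _
  have h2 : 0 < ∏ i, Real.exp (u i) := Finset.prod_pos fun i _ => Real.exp_pos _
  rw [abs_of_pos h1, abs_of_pos h2]
  have h3 : (∏ i, Real.exp (-u i)) * ∏ i, Real.exp (u i) = 1 := by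
    rw [← Finset.prod_mul_distrib]
    exact Finset.prod_eq_one fun i _ => by rw [← Real.exp_add]; simp
  rw [show |(-(1/2) : ℝ)| = 1/2 by rw [abs_neg, abs_of_pos]; norm_num]
  linear_combination ((1/2)^(Fintype.card {i : T // i ≠ δ}) * (Hm (wV W δ) (bV W δ u)).det) * h3

/-- coordinate functional of the extension -/
def extL (δ : T) (j : T) : ({i : T // i ≠ δ} → ℝ) →L[ℝ] ℝ :=
  if h : j = δ then 0 else ContinuousLinearMap.proj ⟨j, h⟩

lemma extL_apply (δ : T) (j : T) (u : {i : T // i ≠ δ} → ℝ) : extL δ j u = extendByZero δ u j := by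
  unfold extL extendByZero
  split_ifs <;> simp

lemma hasFDerivAt_bV {W : T → T → ℝ} (δ : T) (u : {i : T // i ≠ δ} → ℝ) :
    HasFDerivAt (bV W δ) (LinearMap.toContinuousLinearMap (Matrix.toLin' (Jmat W δ u))) u := by
  rw [hasFDerivAt_pi']
  intro i
  have hU : ∀ j, HasFDerivAt (fun u => extendByZero δ u j) (extL δ j) u := by
    intro j
    have := (extL δ j).hasFDerivAt (x := u)
    have h2 : (fun u => extendByZero δ u j) = extL δ j := by ext u; rw [extL_apply]
    rw [h2]; exact this
  have h1 : HasFDerivAt (fun u => bV W δ u i) ((1/2 : ℝ) • ∑ j, W i.1 j •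
      (Real.exp (extendByZero δ u j - extendByZero δ u i.1) • (extL δ j - extL δ i.1))) u := by
    unfold bV betaW
    refine HasFDerivAt.const_mul ?_ _
    refine HasFDerivAt.fun_sum fun j _ => ?_
    exact (((hU j).sub (hU i.1)).exp).const_mul _
  refine h1.congr_fderiv ?_
  ext1 h
  simp only [ContinuousLinearMap.smul_apply, ContinuousLinearMap.sum_apply, smul_eq_mul,
    ContinuousLinearMap.sub_apply, extL_apply, ContinuousLinearMap.comp_apply,
    LinearMap.coe_toContinuousLinearMap', Matrix.toLin'_apply, ContinuousLinearMap.proj_apply]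
  unfold Jmat
  rw [← Matrix.mulVec_mulVec, ← Matrix.mulVec_mulVec, Matrix.mulVec_diagonal, Hm_mulVec,
    Matrix.mulVec_diagonal]
  rw [← mul_assoc (2 * bV W δ u i), two_bV, sum_split δ]
  simp only [ext_delta, ext_coe, Matrix.mulVec_diagonal, wV]
  rw [add_mul, Finset.sum_mul, add_sub_assoc, ← Finset.sum_sub_distrib, mul_add, mul_add,
    Finset.mul_sum, Finset.mul_sum]
  congr 1
  · rw [zero_sub, zero_sub]; ring
  · refine Finset.sum_congr rfl fun j _ => ?_
    rw [sub_eq_add_neg (u j), Real.exp_add]; ring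

lemma bV_injective {W : T → T → ℝ} (δ : T)
    (hP : ∀ u, (Hm (wV W δ) (bV W δ u)).PosDef) : Function.Injective (bV W δ) := by
  intro u v huv
  have h1 := inv_eq_of_mulVec (hP u).det_pos.ne' (Hm_exp W δ u)
  have h2 := inv_eq_of_mulVec (hP v).det_pos.ne' (Hm_exp W δ v)
  rw [huv] at h1
  have h3 := h1.symm.trans h2
  ext i
  exact Real.exp_injective (congrFun h3 i)

lemma bV_image {W : T → T → ℝ} (hs : ∀ i j, W i j = W j i)
    (hw : ∀ i j, 0 ≤ W i j)
    (hconn : (SimpleGraph.fromRel fun i j : T => 0 < W i j).Connected) (δ : T)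
    (hP : ∀ u, (Hm (wV W δ) (bV W δ u)).PosDef) :
    bV W δ '' Set.univ = {β | (Hm (wV W δ) β).PosDef} := by
  ext β
  simp only [Set.mem_image, Set.mem_univ, true_and, Set.mem_ofPred_eq]
  constructor
  · rintro ⟨u, rfl⟩; exact hP u
  · intro hβ
    set x := (Hm (wV W δ) β)⁻¹.mulVec (etaV W δ) with hx
    have hHx : (Hm (wV W δ) β).mulVec x = etaV W δ := mulVec_inv_self hβ _
    have hx0 : ∀ i, 0 ≤ x i := by
      apply mmatrix_nonneg hβ (Hm_off (fun i j => hw _ _) β)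
      intro i; rw [hHx]; exact hw _ _
    have heq : ∀ i, 2 * β i * x i = W i.1 δ + ∑ j : {i : T // i ≠ δ}, W i.1 j.1 * x j := by
      intro i
      have := congrFun hHx i
      rw [Hm_mulVec] at this
      simp only [wV, etaV] at this
      linarith
    have hxpos : ∀ i, 0 < x i := by
      intro i
      rcases (hx0 i).eq_or_lt with h0 | h0
      swap
      · exact h0
      exfalso
      have hall := conn_induct hs hconn (fun j => ∃ h : j ≠ δ, x ⟨j, h⟩ = 0) ?_ i.1 δ ⟨i.2, h0.symm⟩
      · obtain ⟨h, _⟩ := hall; exact h rfl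
      · rintro j k ⟨hj, hxj⟩ hjk
        have h1 := heq ⟨j, hj⟩
        rw [hxj, mul_zero] at h1
        have h2 : ∀ l : {i : T // i ≠ δ}, 0 ≤ W j l.1 * x l := fun l => mul_nonneg (hw _ _) (hx0 l)
        have h3 : 0 ≤ ∑ l : {i : T // i ≠ δ}, W j l.1 * x l := Finset.sum_nonneg fun l _ => h2 l
        have h4 := hw j δ
        have hk : k ≠ δ := by
          rintro rfl; simp only at h1; linarith
        refine ⟨hk, ?_⟩
        have h5 : ∑ l : {i : T // i ≠ δ}, W j l.1 * x l = 0 := by simp only at h1; linarith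
        have h6 := (Finset.sum_eq_zero_iff_of_nonneg fun l _ => h2 l).1 h5 ⟨k, hk⟩ (Finset.mem_univ _)
        rcases mul_eq_zero.1 h6 with h | h
        · exact absurd h hjk.ne'
        · exact h
    refine ⟨fun i => Real.log (x i), ?_⟩
    ext i
    have h1 := two_bV W δ (fun i => Real.log (x i)) i
    simp only [Real.exp_log (hxpos _)] at h1
    rw [← heq i] at h1
    have := (hxpos i).ne'
    have h2 := mul_right_cancel₀ this h1
    linarith

lemma measurable_bV {W : T → T → ℝ} (δ : T) : Continuous (bV W δ) := by
  refine continuous_iff_continuousAt.2 fun u => (hasFDerivAt_bV δ u).continuousAt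

/-- The `u`-integral. -/
lemma u_integral {W : T → T → ℝ} (hs : ∀ i j, W i j = W j i) (hd : ∀ i, W i i = 0)
    (hw : ∀ i j, 0 ≤ W i j)
    (hconn : (SimpleGraph.fromRel fun i j : T => 0 < W i j).Connected) (δ : T)
    (a : {i : T // i ≠ δ} → ℝ) (ha : ∀ i, 0 < a i) (η : {i : T // i ≠ δ} → ℝ) (hη : ∀ i, 0 ≤ η i) :
    Integrable (fun u : {i : T // i ≠ δ} → ℝ => √(Hm (wV W δ) (bV W δ u)).det *
      Real.exp (-∑ i, a i ^ 2 * bV W δ u i - (1/2) * quadInv (wV W δ) η (bV W δ u))) ∧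
    ∫ u : {i : T // i ≠ δ} → ℝ, √(Hm (wV W δ) (bV W δ u)).det *
      Real.exp (-∑ i, a i ^ 2 * bV W δ u i - (1/2) * quadInv (wV W δ) η (bV W δ u)) =
      √(2*π) ^ Fintype.card {i : T // i ≠ δ} * (∏ i, a i)⁻¹ *
        Real.exp (-∑ i, a i * η i - (1/2) * ∑ i, ∑ j, wV W δ i j * a i * a j) := by
  have hP := Hm_posDef_of_u hs hd hw hconn δ
  set N := Fintype.card {i : T // i ≠ δ} with hN
  have hb := betaStmt {i : T // i ≠ δ} inferInstance (wV W δ) (fun _ _ => hs _ _) (fun _ _ => hw _ _)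
    a ha η hη
  unfold Gfun at hb
  rw [lintegral_indicator (measurableSet_posDef (w := wV W δ) (fun _ _ => hs _ _)), ← bV_image hs hw hconn δ hP,
    lintegral_image_eq_lintegral_abs_det_fderiv_mul volume MeasurableSet.univ
    (fun u _ => (hasFDerivAt_bV δ u).hasFDerivWithinAt) (bV_injective δ hP).injOn,
    Measure.restrict_univ] at hb
  set F : ({i : T // i ≠ δ} → ℝ) → ℝ := fun u => √(Hm (wV W δ) (bV W δ u)).det *
      Real.exp (-∑ i, a i ^ 2 * bV W δ u i - (1/2) * quadInv (wV W δ) η (bV W δ u)) with hF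
  have hFnn : ∀ u, 0 ≤ F u := fun u => by positivity
  have hpt : ∀ u, ENNReal.ofReal |(LinearMap.toContinuousLinearMap (Matrix.toLin' (Jmat W δ u))).det| *
      ENNReal.ofReal (gfun (wV W δ) a η (bV W δ u)) = ENNReal.ofReal ((1/2)^N) * ENNReal.ofReal (F u) := by
    intro u
    have hdet : (LinearMap.toContinuousLinearMap (Matrix.toLin' (Jmat W δ u))).det = (Jmat W δ u).det := by
      simp [ContinuousLinearMap.det]
    rw [hdet, det_Jmat δ u (hP u), ← ENNReal.ofReal_mul (mul_nonneg (by positivity) (hP u).det_pos.le),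
      ← ENNReal.ofReal_mul (by positivity)]
    congr 1
    rw [mul_assoc]
    congr 1
    have hdp := (hP u).det_pos
    simp only [hF, gfun]
    set d := (Hm (wV W δ) (bV W δ u)).det
    have : √d * √d = d := Real.mul_self_sqrt hdp.le
    have h0 : 0 < √d := Real.sqrt_pos.2 hdp
    field_simp
    rw [← this]; simp only [Real.sqrt_mul_self h0.le]; ring
  simp_rw [hpt] at hb
  have hFm : Measurable F := by
    have hbm : Measurable (bV W δ) := (measurable_bV δ).measurable
    have h1 := ((continuous_Hm (wV W δ)).matrix_det.measurable).comp hbm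
    have h2 := (measurable_quadInv (wV W δ) η).comp hbm
    refine h1.sqrt.mul (Measurable.exp (Measurable.sub ?_ (h2.const_mul _)))
    have h3 : ∀ i, Measurable (fun u => bV W δ u i) := fun i => (measurable_pi_apply i).comp hbm
    exact (Finset.measurable_fun_sum _ fun i _ => (h3 i).const_mul _).neg
  rw [lintegral_const_mul _ hFm.ennreal_ofReal] at hb
  have hpr : 0 < ∏ i, a i := Finset.prod_pos fun i _ => ha _
  have hval : ∫⁻ u, ENNReal.ofReal (F u) = ENNReal.ofReal (√(2*π) ^ N * (∏ i, a i)⁻¹ *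
        Real.exp (-∑ i, a i * η i - (1/2) * ∑ i, ∑ j, wV W δ i j * a i * a j)) := by
    have h2pi : √(2*π) = 2 * √(π/2) := by
      rw [show 2*π = 2^2 * (π/2) by ring, Real.sqrt_mul (by positivity), Real.sqrt_sq (by norm_num)]
    have h3 := congrArg (fun z => ENNReal.ofReal (2^N) * z) hb
    rw [← mul_assoc, ← ENNReal.ofReal_mul (by positivity), ← mul_pow,
      ← ENNReal.ofReal_mul (by positivity)] at h3
    rw [show (2:ℝ) * (1/2) = 1 by norm_num, one_pow, ENNReal.ofReal_one, one_mul] at h3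
    rw [h3, h2pi, mul_pow]
    congr 1
    ring
  have hInt : Integrable F := by
    refine ⟨hFm.aestronglyMeasurable, ?_⟩
    rw [hasFiniteIntegral_iff_ofReal (Filter.Eventually.of_forall hFnn), hval]
    exact ENNReal.ofReal_lt_top
  refine ⟨hInt, ?_⟩
  rw [integral_eq_lintegral_of_nonneg_ae (Filter.Eventually.of_forall hFnn) hFm.aestronglyMeasurable,
    hval, ENNReal.toReal_ofReal (by positivity)]

end uside
section mainpart
variable {T : Type*} [Fintype T] [DecidableEq T]

lemma double_sum_zero (F : T → T → ℝ) (h : ∀ i j, F i j + F j i = 0) : ∑ i, ∑ j, F i j = 0 := by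
  have h1 : ∑ i, ∑ j, F i j = ∑ i, ∑ j, F j i := Finset.sum_comm
  have h2 : ∑ i, ∑ j, F i j + ∑ i, ∑ j, F j i = 0 := by
    simp only [← Finset.sum_add_distrib]
    exact Finset.sum_eq_zero fun i _ => Finset.sum_eq_zero fun j _ => h i j
  linarith

lemma expo_identity {W : T → T → ℝ} (hs : ∀ i j, W i j = W j i) (hd : ∀ i, W i i = 0)
    (U S a b : T → ℝ) :
    -(1/2) * (∑ i, ∑ j, S i * Amat W U i j * S j)
      - (1/2) * ∑ i, ∑ j, W i j * (Real.cosh (U i - U j) - 1)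
      - ∑ i, ((a i ^ 2 + b i ^ 2 - 1) * betaW W U i + b i * thetaW W U S i) =
    -(1/2) * (∑ i, ∑ j, (S i + b i * Real.exp (-U i)) * Amat W U i j * (S j + b j * Real.exp (-U j)))
      - ∑ i, a i ^ 2 * betaW W U i - (1/2) * ∑ i, ∑ j, W i j * (b i * b j)
      + (1/2) * ∑ i, ∑ j, W i j := by
  have h1 := Amat_quad hs hd U S
  have h2 := Amat_quad hs hd U (fun i => S i + b i * Real.exp (-U i))
  rw [h1, h2, ← sub_eq_zero]
  simp only [betaW, thetaW, Finset.mul_sum, ← Finset.sum_add_distrib, ← Finset.sum_sub_distrib,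
    ← Finset.sum_neg_distrib]
  apply double_sum_zero
  intro i j
  rw [hs j i, ← Real.cosh_neg (U j - U i), neg_sub, Real.cosh_eq]
  simp only [neg_sub, sub_eq_add_neg, Real.exp_add, Real.exp_neg, neg_add, neg_neg]
  have := (Real.exp_pos (U i)).ne'
  have := (Real.exp_pos (U j)).ne'
  field_simp
  ring

lemma beta_delta {W : T → T → ℝ} (hs : ∀ i j, W i j = W j i) (hd : ∀ i, W i i = 0) (δ : T)
    (u : {i : T // i ≠ δ} → ℝ) (hP : (Hm (wV W δ) (bV W δ u)).PosDef) :
    betaW W (extendByZero δ u) δ = (1/2) * quadInv (wV W δ) (etaV W δ) (bV W δ u) := by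
  rw [quadInv, inv_eq_of_mulVec hP.det_pos.ne' (Hm_exp W δ u), betaW, sum_split δ, hd]
  simp only [ext_delta, ext_coe, zero_mul, zero_add, sub_zero, dotProduct, etaV]
  congr 1
  exact Finset.sum_congr rfl fun j _ => by rw [hs]

lemma quad_shift {W : T → T → ℝ} (δ : T)
    (u : {i : T // i ≠ δ} → ℝ) (hP : (Hm (wV W δ) (bV W δ u)).PosDef) (α : {i : T // i ≠ δ} → ℝ) :
    quadInv (wV W δ) (etaV W δ - α) (bV W δ u) = quadInv (wV W δ) (etaV W δ) (bV W δ u)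
      - 2 * ∑ i, α i * Real.exp (u i) + quadInv (wV W δ) α (bV W δ u) := by
  have h1 := inv_eq_of_mulVec hP.det_pos.ne' (Hm_exp W δ u)
  have h2 := symm_form hP.isHermitian.inv α (etaV W δ)
  unfold quadInv
  rw [Matrix.mulVec_sub, sub_dotProduct, dotProduct_sub, dotProduct_sub, ← h2, h1]
  simp only [dotProduct]
  ring

lemma quad_z {W : T → T → ℝ} (hd : ∀ i, W i i = 0) (δ : T)
    (u : {i : T // i ≠ δ} → ℝ) (hP : (Hm (wV W δ) (bV W δ u)).PosDef)
    (hA : (AVV W δ (extendByZero δ u)).PosDef) (α : {i : T // i ≠ δ} → ℝ) :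
    (fun i => α i * Real.exp (u i)) ⬝ᵥ ((AVV W δ (extendByZero δ u))⁻¹).mulVec
      (fun i => α i * Real.exp (u i)) = quadInv (wV W δ) α (bV W δ u) := by
  set x := ((Hm (wV W δ) (bV W δ u))⁻¹).mulVec α with hx
  have h1 : (AVV W δ (extendByZero δ u)).mulVec (fun i => Real.exp (-u i) * x i) =
      fun i => α i * Real.exp (u i) := by
    rw [AVV_eq hd, ← Matrix.mulVec_mulVec, ← Matrix.mulVec_mulVec]
    have h2 : (Matrix.diagonal (fun i : {i : T // i ≠ δ} => Real.exp (u i))).mulVec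
        (fun i => Real.exp (-u i) * x i) = x := by
      ext i
      rw [Matrix.mulVec_diagonal, ← mul_assoc, ← Real.exp_add]; simp
    rw [h2, hx, mulVec_inv_self hP]
    ext i
    rw [Matrix.mulVec_diagonal, mul_comm]
  rw [inv_eq_of_mulVec hA.det_pos.ne' h1, quadInv, ← hx]
  simp only [dotProduct]
  refine Finset.sum_congr rfl fun i _ => ?_
  rw [mul_assoc, ← mul_assoc (Real.exp (u i)), ← Real.exp_add]; simp

lemma continuous_ext (δ : T) (j : T) : Continuous (fun u => extendByZero δ u j) := by
  have h2 : (fun u => extendByZero δ u j) = extL δ j := by ext u; rw [extL_apply]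
  rw [h2]; exact (extL δ j).continuous

lemma continuous_ext_all (δ : T) : Continuous (fun u => extendByZero δ u) :=
  continuous_pi fun j => continuous_ext δ j

lemma continuous_AVV (W : T → T → ℝ) (δ : T) : Continuous (AVV W δ) := by
  refine continuous_matrix fun i j => ?_
  simp only [AVV, Amat, Matrix.of_apply]
  split_ifs <;> fun_prop

lemma continuous_rho (W : T → T → ℝ) (δ : T) :
    Continuous (fun p : (T → ℝ) × (T → ℝ) => rhoW W δ p.1 p.2) := by
  unfold rhoW
  refine Continuous.mul (Continuous.mul ?_ ?_) ?_
  · simp only [Amat, Matrix.of_apply]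
    refine Real.continuous_exp.comp (continuous_const.mul (continuous_finsetSum _ fun i _ =>
      continuous_finsetSum _ fun j _ => ?_))
    split_ifs <;> fun_prop
  · exact ((continuous_AVV W δ).comp continuous_fst).matrix_det
  · have := Real.continuous_cosh
    fun_prop

/-- Reduction of the integral against `muW` to an integral over `(V → ℝ) × (V → ℝ)`. -/
lemma integral_muW {W : T → T → ℝ} (hs : ∀ i j, W i j = W j i) (hd : ∀ i, W i i = 0)
    (hw : ∀ i j, 0 ≤ W i j)
    (hconn : (SimpleGraph.fromRel fun i j : T => 0 < W i j).Connected) (δ : T)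
    (Φ : (T → ℝ) × (T → ℝ) → ℂ) (hΦ : Continuous Φ) :
    ∫ p, Φ p ∂(muW W δ) = ∫ p : ({i : T // i ≠ δ} → ℝ) × ({i : T // i ≠ δ} → ℝ),
      ((rhoW W δ (extendByZero δ p.1) (extendByZero δ p.2) *
        ∏ i, Real.exp (-(p.1 i)) / (2 * π) : ℝ) : ℂ) * Φ (extendByZero δ p.1, extendByZero δ p.2) := by
  have hc : Continuous (fun p : (T → ℝ) × (T → ℝ) => rhoW W δ p.1 p.2 *
      ∏ i : {i : T // i ≠ δ}, Real.exp (-(p.1 i.1)) / (2 * Real.pi)) := by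
    refine (continuous_rho W δ).mul (continuous_finsetProd _ fun i _ => ?_)
    fun_prop
  have hm : Continuous (fun p : ({i : T // i ≠ δ} → ℝ) × ({i : T // i ≠ δ} → ℝ) =>
      (extendByZero δ p.1, extendByZero δ p.2)) :=
    ((continuous_ext_all δ).comp continuous_fst).prodMk ((continuous_ext_all δ).comp continuous_snd)
  unfold muW
  rw [integral_withDensity_eq_integral_toReal_smul hc.measurable.ennreal_ofReal
    (Filter.Eventually.of_forall fun _ => ENNReal.ofReal_lt_top)]
  unfold baseMeasure
  rw [integral_map hm.measurable.aemeasurable]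
  · refine integral_congr_ae (Filter.Eventually.of_forall fun p => ?_)
    simp only [ext_coe]
    rw [ENNReal.toReal_ofReal]
    · rw [Complex.real_smul]
    · have := (AVV_posDef hs hd hw hconn δ (extendByZero δ p.1)).det_pos
      unfold rhoW
      positivity
  · exact (hc.measurable.ennreal_ofReal.ennreal_toReal.smul hΦ.measurable).aestronglyMeasurable

end mainpart
section mainlemma
variable {T : Type*} [Fintype T] [DecidableEq T]

/-- The `u`-dependent prefactor. -/
def kfun (W : T → T → ℝ) (δ : T) (α a b : T → ℝ) (u : {i : T // i ≠ δ} → ℝ) : ℝ :=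
  Real.exp (α δ + (1/2) * ∑ i, ∑ j, W i j - (1/2) * ∑ i, ∑ j, W i j * (b i * b j)) *
    ((AVV W δ (extendByZero δ u)).det * ∏ i, Real.exp (-(u i)) / (2 * π)) *
    Real.exp (-(∑ i : {i : T // i ≠ δ}, a i.1 ^ 2 * bV W δ u i) - betaW W (extendByZero δ u) δ
      + ∑ i : {i : T // i ≠ δ}, α i.1 * Real.exp (u i))

/-- The Gaussian factor. -/
def hfun (W : T → T → ℝ) (δ : T) (α b : T → ℝ) (u s : {i : T // i ≠ δ} → ℝ) : ℂ :=
  Complex.exp (((-(1/2) * ((s + fun i => b i.1 * Real.exp (-u i)) ⬝ᵥ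
      (AVV W δ (extendByZero δ u)).mulVec (s + fun i => b i.1 * Real.exp (-u i))) : ℝ) : ℂ) +
      Complex.I * (((fun i : {i : T // i ≠ δ} => α i.1 * Real.exp (u i)) ⬝ᵥ s : ℝ) : ℂ))

lemma pointwise_id {W : T → T → ℝ} (hs : ∀ i j, W i j = W j i) (hd : ∀ i, W i i = 0)
    (δ : T) (α a b : T → ℝ) (haδ : a δ = 1) (hbδ : b δ = 0)
    (u s : {i : T // i ≠ δ} → ℝ) :
    ((rhoW W δ (extendByZero δ u) (extendByZero δ s) *
        ∏ i, Real.exp (-(u i)) / (2 * π) : ℝ) : ℂ) *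
      (Complex.exp (∑ v : T, (α v : ℂ) * Real.exp (extendByZero δ u v) *
        (1 + Complex.I * (extendByZero δ s v : ℂ)))
        * Complex.exp (Complex.ofReal (-∑ j : T,
            (((a j) ^ 2 + (b j) ^ 2 - 1) * betaW W (extendByZero δ u) j
              + b j * thetaW W (extendByZero δ u) (extendByZero δ s) j)))) =
    ((kfun W δ α a b u : ℝ) : ℂ) * hfun W δ α b u s := by
  have hE := expo_identity hs hd (extendByZero δ u) (extendByZero δ s) a b
  have hq : ∑ i, ∑ j, (extendByZero δ s i + b i * Real.exp (-extendByZero δ u i)) *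
      Amat W (extendByZero δ u) i j * (extendByZero δ s j + b j * Real.exp (-extendByZero δ u j)) =
      (s + fun i => b i.1 * Real.exp (-u i)) ⬝ᵥ
      (AVV W δ (extendByZero δ u)).mulVec (s + fun i => b i.1 * Real.exp (-u i)) := by
    rw [← Amat_quad_V]
    have : ∀ i, extendByZero δ (s + fun i => b i.1 * Real.exp (-u i)) i =
        extendByZero δ s i + b i * Real.exp (-extendByZero δ u i) := by
      intro i
      by_cases h : i = δ
      · subst h; simp [ext_delta, hbδ]
      · have h1 := ext_coe δ s ⟨i, h⟩
        have h2 := ext_coe δ u ⟨i, h⟩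
        have h3 := ext_coe δ (s + fun i => b i.1 * Real.exp (-u i)) ⟨i, h⟩
        simp only at h1 h2 h3
        rw [h1, h2, h3]; rfl
    simp only [this]
  rw [hq] at hE
  have hb : ∑ i, a i ^ 2 * betaW W (extendByZero δ u) i = betaW W (extendByZero δ u) δ +
      ∑ i : {i : T // i ≠ δ}, a i.1 ^ 2 * bV W δ u i := by
    rw [sum_split δ, haδ]; simp [bV]
  rw [hb] at hE
  have hα : ∑ v : T, (α v : ℂ) * Real.exp (extendByZero δ u v) *
        (1 + Complex.I * (extendByZero δ s v : ℂ)) =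
      ((α δ + ∑ i : {i : T // i ≠ δ}, α i.1 * Real.exp (u i) : ℝ) : ℂ) +
      Complex.I * (((fun i : {i : T // i ≠ δ} => α i.1 * Real.exp (u i)) ⬝ᵥ s : ℝ) : ℂ) := by
    rw [Fintype.sum_eq_add_sum_subtype_ne _ δ]
    simp only [ext_delta, ext_coe, dotProduct]
    push_cast
    rw [Finset.mul_sum, add_assoc, ← Finset.sum_add_distrib]
    congr 1
    · simp
    · exact Finset.sum_congr rfl fun i _ => by ring
  rw [hα]
  unfold kfun hfun rhoW
  set D := (AVV W δ (extendByZero δ u)).det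
  set Pr := ∏ i, Real.exp (-(u i)) / (2 * π)
  set Q := (s + fun i => b i.1 * Real.exp (-u i)) ⬝ᵥ
      (AVV W δ (extendByZero δ u)).mulVec (s + fun i => b i.1 * Real.exp (-u i))
  set Z := (fun i : {i : T // i ≠ δ} => α i.1 * Real.exp (u i)) ⬝ᵥ s
  set X := ∑ i, ∑ j, extendByZero δ s i * Amat W (extendByZero δ u) i j * extendByZero δ s j
  set Y := ∑ i, ∑ j, W i j * (Real.cosh (extendByZero δ u i - extendByZero δ u j) - 1)
  set B := ∑ j : T, (((a j) ^ 2 + (b j) ^ 2 - 1) * betaW W (extendByZero δ u) j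
              + b j * thetaW W (extendByZero δ u) (extendByZero δ s) j)
  rw [Complex.exp_add, Complex.exp_add]
  rw [← Complex.ofReal_exp, ← Complex.ofReal_exp, ← Complex.ofReal_exp]
  have hreal : ∀ p q r t : ℝ, ∀ z : ℂ, p * q * r = t →
      (p:ℂ) * ((q:ℂ) * z * (r:ℂ)) = (t:ℂ) * z := by
    intro p q r t z h
    rw [← h]; push_cast; ring
  rw [← mul_assoc ((_ : ℝ) : ℂ) ((_ : ℝ) : ℂ) _, ← Complex.ofReal_mul]
  apply hreal
  set α2 := ∑ i : {i : T // i ≠ δ}, α i.1 * Real.exp (u i)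
  set S1 := ∑ i, ∑ j, W i j
  set S2 := ∑ i, ∑ j, W i j * (b i * b j)
  set S3 := ∑ i : {i : T // i ≠ δ}, a i.1 ^ 2 * bV W δ u i
  set bd := betaW W (extendByZero δ u) δ
  have h1 : Real.exp (-(1/2) * X) * Real.exp (-((1/2) * Y)) * Real.exp (α δ + α2) * Real.exp (-B) =
      Real.exp (α δ + 1/2 * S1 - 1/2 * S2) * Real.exp (-S3 - bd + α2) * Real.exp (-(1/2) * Q) := by
    simp only [← Real.exp_add]
    congr 1
    linarith
  linear_combination (D * Pr) * h1

lemma continuous_betaW (W : T → T → ℝ) (i : T) : Continuous (fun u => betaW W u i) := by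
  unfold betaW; fun_prop

lemma continuous_kfun (W : T → T → ℝ) (δ : T) (α a b : T → ℝ) : Continuous (kfun W δ α a b) := by
  unfold kfun
  have h1 : Continuous (fun u => (AVV W δ (extendByZero δ u)).det) :=
    ((continuous_AVV W δ).comp (continuous_ext_all δ)).matrix_det
  have h2 : Continuous (fun u => betaW W (extendByZero δ u) δ) :=
    (continuous_betaW W δ).comp (continuous_ext_all δ)
  have h3 : ∀ i, Continuous (fun u => bV W δ u i) := fun i =>
    (continuous_apply i).comp (measurable_bV δ)
  have h4 : Continuous (fun u : {i : T // i ≠ δ} → ℝ => ∏ i, Real.exp (-(u i)) / (2 * π)) :=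
    continuous_finsetProd _ fun i _ => by fun_prop
  fun_prop

lemma continuous_hfun (W : T → T → ℝ) (δ : T) (α b : T → ℝ) :
    Continuous (fun p : ({i : T // i ≠ δ} → ℝ) × ({i : T // i ≠ δ} → ℝ) => hfun W δ α b p.1 p.2) := by
  unfold hfun
  have h1 : Continuous (fun p : ({i : T // i ≠ δ} → ℝ) × ({i : T // i ≠ δ} → ℝ) =>
      AVV W δ (extendByZero δ p.1)) :=
    (continuous_AVV W δ).comp ((continuous_ext_all δ).comp continuous_fst)
  have h2 : Continuous (fun p : ({i : T // i ≠ δ} → ℝ) × ({i : T // i ≠ δ} → ℝ) =>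
      p.2 + fun i => b i.1 * Real.exp (-p.1 i)) := by fun_prop
  have h3 := h2.dotProduct (h1.matrix_mulVec h2)
  have h4 : Continuous (fun p : ({i : T // i ≠ δ} → ℝ) × ({i : T // i ≠ δ} → ℝ) =>
      (fun i : {i : T // i ≠ δ} => α i.1 * Real.exp (p.1 i)) ⬝ᵥ p.2) := by
    refine Continuous.dotProduct ?_ continuous_snd
    fun_prop
  refine Complex.continuous_exp.comp (Continuous.add ?_ (continuous_const.mul ?_))
  · exact Complex.continuous_ofReal.comp (continuous_const.mul h3)
  · exact Complex.continuous_ofReal.comp h4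

/-- Combination of determinants. -/
lemma det_comb {W : T → T → ℝ} (hd : ∀ i, W i i = 0) (δ : T)
    (u : {i : T // i ≠ δ} → ℝ) (hP : (Hm (wV W δ) (bV W δ u)).PosDef) :
    ((AVV W δ (extendByZero δ u)).det * ∏ i, Real.exp (-(u i)) / (2 * π)) *
      (√(2*π) ^ Fintype.card {i : T // i ≠ δ} / √(AVV W δ (extendByZero δ u)).det) =
    √(Hm (wV W δ) (bV W δ u)).det * (√(2*π) ^ Fintype.card {i : T // i ≠ δ})⁻¹ := by
  rw [det_AVV hd, Finset.prod_div_distrib, Finset.prod_const, Finset.card_univ]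
  set N := Fintype.card {i : T // i ≠ δ}
  set d := (Hm (wV W δ) (bV W δ u)).det with hd'
  have hdp : 0 < d := hP.det_pos
  simp only [Real.exp_neg, Finset.prod_inv_distrib]
  set P := ∏ i, Real.exp (u i)
  have hPp : 0 < P := Finset.prod_pos fun i _ => Real.exp_pos _
  rw [Real.sqrt_mul (sq_nonneg _), Real.sqrt_sq hPp.le]
  have h1 : (2*π)^N = √(2*π)^N * √(2*π)^N := by
    rw [← mul_pow, Real.mul_self_sqrt (by positivity)]
  rw [h1]
  have h2 : √d * √d = d := Real.mul_self_sqrt hdp.le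
  have h3 : 0 < √d := Real.sqrt_pos.2 hdp
  have h4 : 0 < √(2*π)^N := by positivity
  rw [← h2, Real.sqrt_mul_self h3.le]
  field_simp

lemma inner_int {W : T → T → ℝ} (hs : ∀ i j, W i j = W j i) (hd : ∀ i, W i i = 0)
    (hw : ∀ i j, 0 ≤ W i j)
    (hconn : (SimpleGraph.fromRel fun i j : T => 0 < W i j).Connected) (δ : T)
    (α a b : T → ℝ) (u : {i : T // i ≠ δ} → ℝ) :
    Integrable (fun s => ((kfun W δ α a b u : ℝ) : ℂ) * hfun W δ α b u s) ∧
    ∫ s, ((kfun W δ α a b u : ℝ) : ℂ) * hfun W δ α b u s =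
      ((Real.exp (α δ + (1/2) * ∑ i, ∑ j, W i j - (1/2) * ∑ i, ∑ j, W i j * (b i * b j)) *
        (√(2*π) ^ Fintype.card {i : T // i ≠ δ})⁻¹ * (√(Hm (wV W δ) (bV W δ u)).det *
      Real.exp (-∑ i : {i : T // i ≠ δ}, a i.1 ^ 2 * bV W δ u i -
        (1/2) * quadInv (wV W δ) (etaV W δ - fun i => α i.1) (bV W δ u))) : ℝ) : ℂ) *
      Complex.exp (-(Complex.I * ((∑ i : {i : T // i ≠ δ}, α i.1 * b i.1 : ℝ) : ℂ))) := by
  have hP := Hm_posDef_of_u hs hd hw hconn δ u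
  have hA := AVV_posDef hs hd hw hconn δ (extendByZero δ u)
  obtain ⟨g1, g2⟩ := gauss1 hA (fun i : {i : T // i ≠ δ} => α i.1 * Real.exp (u i))
    (fun i => b i.1 * Real.exp (-u i))
  refine ⟨g1.const_mul _, ?_⟩
  rw [integral_const_mul]
  have g3 : ∫ s, hfun W δ α b u s = _ := g2
  rw [g3, quad_z hd δ u hP hA, ← mul_assoc, ← Complex.ofReal_mul]
  have hzc : (fun i : {i : T // i ≠ δ} => α i.1 * Real.exp (u i)) ⬝ᵥ
      (fun i => b i.1 * Real.exp (-u i)) = ∑ i : {i : T // i ≠ δ}, α i.1 * b i.1 := by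
    simp only [dotProduct]
    refine Finset.sum_congr rfl fun i _ => ?_
    have : Real.exp (u i) * Real.exp (-u i) = 1 := by rw [← Real.exp_add]; simp
    linear_combination (α i.1 * b i.1) * this
  rw [hzc]
  congr 2
  have hdc := det_comb hd δ u hP
  rw [quad_shift δ u hP]
  unfold kfun
  rw [beta_delta hs hd δ u hP]
  set D := (AVV W δ (extendByZero δ u)).det
  set Pr := ∏ i, Real.exp (-(u i)) / (2 * π)
  set q1 := quadInv (wV W δ) (etaV W δ) (bV W δ u)
  set q2 := quadInv (wV W δ) (fun i => α i.1) (bV W δ u)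
  set α2 := ∑ i : {i : T // i ≠ δ}, α i.1 * Real.exp (u i)
  set S3 := ∑ i : {i : T // i ≠ δ}, a i.1 ^ 2 * bV W δ u i
  have h1 : Real.exp (-S3 - 1/2 * q1 + α2) * Real.exp (-(1/2) * q2) =
      Real.exp (-S3 - 1/2 * (q1 - 2 * α2 + q2)) := by
    rw [← Real.exp_add]; congr 1; ring
  rw [← h1]
  set E := Real.exp (α δ + (1/2) * ∑ i, ∑ j, W i j - (1/2) * ∑ i, ∑ j, W i j * (b i * b j))
  linear_combination (E * Real.exp (-S3 - 1/2 * q1 + α2) * Real.exp (-(1/2) * q2)) * hdc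

lemma kfun_nonneg {W : T → T → ℝ} (hs : ∀ i j, W i j = W j i) (hd : ∀ i, W i i = 0)
    (hw : ∀ i j, 0 ≤ W i j)
    (hconn : (SimpleGraph.fromRel fun i j : T => 0 < W i j).Connected) (δ : T)
    (α a b : T → ℝ) (u : {i : T // i ≠ δ} → ℝ) : 0 ≤ kfun W δ α a b u := by
  have := (AVV_posDef hs hd hw hconn δ (extendByZero δ u)).det_pos
  unfold kfun
  positivity

lemma norm_hfun (W : T → T → ℝ) (δ : T) (α b : T → ℝ) (u s : {i : T // i ≠ δ} → ℝ) :
    ((‖hfun W δ α b u s‖ : ℝ) : ℂ) = hfun W δ 0 b u s := by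
  unfold hfun
  rw [Complex.norm_exp]
  simp only [Complex.add_re, Complex.ofReal_re, Complex.mul_re, Complex.I_re, Complex.I_im,
    Complex.ofReal_im, zero_mul, mul_zero, sub_zero, add_zero, Pi.zero_apply]
  have : (fun _ : {i : T // i ≠ δ} => (0:ℝ)) ⬝ᵥ s = 0 := by simp [dotProduct]
  rw [this]
  push_cast
  simp

lemma kfun_le {W : T → T → ℝ} (hs : ∀ i j, W i j = W j i) (hd : ∀ i, W i i = 0)
    (hw : ∀ i j, 0 ≤ W i j)
    (hconn : (SimpleGraph.fromRel fun i j : T => 0 < W i j).Connected) (δ : T)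
    (α a b : T → ℝ) (hα : ∀ i, α i ≤ 0) (u : {i : T // i ≠ δ} → ℝ) :
    kfun W δ α a b u ≤ kfun W δ 0 a b u := by
  have := (AVV_posDef hs hd hw hconn δ (extendByZero δ u)).det_pos
  unfold kfun
  have h1 : ∑ i : {i : T // i ≠ δ}, α i.1 * Real.exp (u i) ≤ 0 :=
    Finset.sum_nonpos fun i _ => mul_nonpos_of_nonpos_of_nonneg (hα _) (Real.exp_pos _).le
  have h2 : ∑ i : {i : T // i ≠ δ}, (0 : T → ℝ) i.1 * Real.exp (u i) = 0 := by simp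
  rw [h2]
  have h3 := hα δ
  have h4 : (0 : T → ℝ) δ = 0 := rfl
  rw [h4]
  gcongr

lemma main_integrable {W : T → T → ℝ} (hs : ∀ i j, W i j = W j i) (hd : ∀ i, W i i = 0)
    (hw : ∀ i j, 0 ≤ W i j)
    (hconn : (SimpleGraph.fromRel fun i j : T => 0 < W i j).Connected) (δ : T)
    (α a b : T → ℝ) (hα : ∀ i, α i ≤ 0) (ha : ∀ i, 0 < a i) :
    Integrable (fun p : ({i : T // i ≠ δ} → ℝ) × ({i : T // i ≠ δ} → ℝ) =>
      ((kfun W δ α a b p.1 : ℝ) : ℂ) * hfun W δ α b p.1 p.2) (volume.prod volume) := by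
  have hcont : Continuous (fun p : ({i : T // i ≠ δ} → ℝ) × ({i : T // i ≠ δ} → ℝ) =>
      ((kfun W δ α a b p.1 : ℝ) : ℂ) * hfun W δ α b p.1 p.2) :=
    (Complex.continuous_ofReal.comp ((continuous_kfun W δ α a b).comp continuous_fst)).mul
      (continuous_hfun W δ α b)
  have hmeas : AEStronglyMeasurable (fun p : ({i : T // i ≠ δ} → ℝ) × ({i : T // i ≠ δ} → ℝ) =>
      ((kfun W δ α a b p.1 : ℝ) : ℂ) * hfun W δ α b p.1 p.2) (volume.prod volume) :=
    hcont.measurable.aestronglyMeasurable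
  rw [integrable_prod_iff hmeas]
  refine ⟨Filter.Eventually.of_forall fun u => (inner_int hs hd hw hconn δ α a b u).1, ?_⟩
  have hu := (u_integral hs hd hw hconn δ (fun i => a i.1) (fun i => ha _) (etaV W δ)
    (fun i => hw _ _)).1
  refine Integrable.mono' (hu.const_mul (Real.exp ((0 : T → ℝ) δ + (1/2) * ∑ i, ∑ j, W i j
    - (1/2) * ∑ i, ∑ j, W i j * (b i * b j)) *
        (√(2*π) ^ Fintype.card {i : T // i ≠ δ})⁻¹)) hmeas.norm.integral_prod_right' ?_
  refine Filter.Eventually.of_forall fun u => ?_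
  rw [Real.norm_of_nonneg (integral_nonneg fun _ => norm_nonneg _)]
  have hk := kfun_nonneg hs hd hw hconn δ α a b u
  have hle := kfun_le hs hd hw hconn δ α a b hα u
  have h0 := (inner_int hs hd hw hconn δ 0 a b u).2
  have h1 : ∀ s, ‖((kfun W δ α a b u : ℝ) : ℂ) * hfun W δ α b u s‖ =
      kfun W δ α a b u * ‖hfun W δ α b u s‖ := by
    intro s
    rw [norm_mul, Complex.norm_real, Real.norm_of_nonneg hk]
  simp only [h1]
  rw [integral_const_mul]
  rw [integral_const_mul] at h0
  simp only [← norm_hfun W δ α b u] at h0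
  rw [integral_complex_ofReal, ← Complex.ofReal_mul] at h0
  have h2 : ∑ i : {i : T // i ≠ δ}, (0 : T → ℝ) i.1 * b i.1 = 0 := by simp
  have h3 : (etaV W δ - fun i : {i : T // i ≠ δ} => (0 : T → ℝ) i.1) = etaV W δ := by
    ext i; simp
  rw [h2, h3] at h0
  simp only [Complex.ofReal_zero, mul_zero, neg_zero, Complex.exp_zero, mul_one] at h0
  have h4 := Complex.ofReal_injective h0
  rw [← h4]
  exact mul_le_mul_of_nonneg_right hle (integral_nonneg fun _ => norm_nonneg _)

/-- The closed form of the generating integral. -/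
theorem main_formula {W : T → T → ℝ} (hs : ∀ i j, W i j = W j i) (hd : ∀ i, W i i = 0)
    (hw : ∀ i j, 0 ≤ W i j)
    (hconn : (SimpleGraph.fromRel fun i j : T => 0 < W i j).Connected) (δ : T)
    (α a b : T → ℝ) (hα : ∀ i, α i ≤ 0) (ha : ∀ i, 0 < a i) (haδ : a δ = 1) (hbδ : b δ = 0) :
    ∫ p, Complex.exp (∑ v : T, (α v : ℂ) * Real.exp (p.1 v) * (1 + Complex.I * (p.2 v : ℂ)))
        * Complex.exp (Complex.ofReal (-∑ j : T,
            (((a j) ^ 2 + (b j) ^ 2 - 1) * betaW W p.1 j + b j * thetaW W p.1 p.2 j)))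
        ∂(muW W δ) =
      ((Real.exp (∑ i, α i * a i + (1/2) * ∑ i, ∑ j, W i j * (1 - a i * a j - b i * b j)) *
        (∏ i, a i)⁻¹ : ℝ) : ℂ) * Complex.exp (-(Complex.I * ((∑ i, α i * b i : ℝ) : ℂ))) := by
  rw [integral_muW hs hd hw hconn δ]
  swap
  · unfold betaW thetaW
    fun_prop
  simp only [pointwise_id hs hd δ α a b haδ hbδ]
  have hI := main_integrable hs hd hw hconn δ α a b hα ha
  rw [Measure.volume_eq_prod, integral_prod _ hI]
  simp only [(inner_int hs hd hw hconn δ α a b _).2]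
  rw [integral_mul_const, integral_complex_ofReal, integral_const_mul,
    (u_integral hs hd hw hconn δ (fun i => a i.1) (fun i => ha _)
      (etaV W δ - fun i : {i : T // i ≠ δ} => α i.1) (fun i => by
        have h1 := hw i.1 δ; have h2 := hα i.1
        simp only [Pi.sub_apply, etaV]; linarith)).2]
  have hb : ∑ i, α i * b i = ∑ i : {i : T // i ≠ δ}, α i.1 * b i.1 := by
    rw [sum_split δ, hbδ]; simp
  rw [hb]
  congr 2
  have hprod : ∏ i, a i = ∏ i : {i : T // i ≠ δ}, a i.1 := by
    rw [Fintype.prod_eq_mul_prod_subtype_ne _ δ, haδ, one_mul]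
  have hsα : ∑ i, α i * a i = α δ + ∑ i : {i : T // i ≠ δ}, α i.1 * a i.1 := by
    rw [sum_split δ, haδ, mul_one]
  have hWa : ∑ i, ∑ j, W i j * (a i * a j) = 2 * ∑ i : {i : T // i ≠ δ}, a i.1 * W i.1 δ +
      ∑ i : {i : T // i ≠ δ}, ∑ j : {i : T // i ≠ δ}, wV W δ i j * a i.1 * a j.1 := by
    rw [sum_split δ, sum_split δ (fun j => W δ j * (a δ * a j)), hd, haδ]
    simp only [sum_split δ (fun j => W _ j * (a _ * a j)), haδ, Finset.sum_add_distrib, wV]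
    have h1 : ∑ i : {i : T // i ≠ δ}, W δ i.1 * (1 * a i.1) = ∑ i : {i : T // i ≠ δ}, a i.1 * W i.1 δ :=
      Finset.sum_congr rfl fun i _ => by rw [hs]; ring
    have h2 : ∑ i : {i : T // i ≠ δ}, W i.1 δ * (a i.1 * 1) = ∑ i : {i : T // i ≠ δ}, a i.1 * W i.1 δ :=
      Finset.sum_congr rfl fun i _ => by ring
    have h3 : ∑ i : {i : T // i ≠ δ}, ∑ j : {i : T // i ≠ δ}, W i.1 j.1 * (a i.1 * a j.1) =
       ∑ i : {i : T // i ≠ δ}, ∑ j : {i : T // i ≠ δ}, W i.1 j.1 * a i.1 * a j.1 :=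
      Finset.sum_congr rfl fun i _ => Finset.sum_congr rfl fun j _ => by ring
    rw [h1, h2, h3]; ring
  have hsplit : ∑ i, ∑ j, W i j * (1 - a i * a j - b i * b j) =
      ∑ i, ∑ j, W i j - ∑ i, ∑ j, W i j * (a i * a j) - ∑ i, ∑ j, W i j * (b i * b j) := by
    simp only [← Finset.sum_sub_distrib]
    exact Finset.sum_congr rfl fun i _ => Finset.sum_congr rfl fun j _ => by ring
  have hη : ∑ i : {i : T // i ≠ δ}, a i.1 * (etaV W δ - fun i : {i : T // i ≠ δ} => α i.1) i =
      ∑ i : {i : T // i ≠ δ}, a i.1 * W i.1 δ - ∑ i : {i : T // i ≠ δ}, α i.1 * a i.1 := by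
    rw [← Finset.sum_sub_distrib]
    exact Finset.sum_congr rfl fun i _ => by simp only [Pi.sub_apply, etaV]; ring
  rw [hprod, hsα, hsplit, hWa, hη]
  have h4 : √(2*π) ^ Fintype.card {i : T // i ≠ δ} ≠ 0 := by positivity
  set N := √(2*π) ^ Fintype.card {i : T // i ≠ δ}
  set P := (∏ i : {i : T // i ≠ δ}, a i.1)⁻¹
  rw [show ∀ x y : ℝ, x * N⁻¹ * (N * P * y) = x * y * P from fun x y => by field_simp,
    ← Real.exp_add]
  congr 2
  ring

end mainlemma
section final
variable {Vinf : Type*} [DecidableEq Vinf]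

/-- Extension of a vector on `Vn` to the wired vertex set, with constant value `c` off `Vn`. -/
def vecExt (Vn S : Finset Vinf) (c : ℝ) (a : Vinf → ℝ) : Option {i : Vinf // i ∈ S} → ℝ :=
  fun v => v.elim c (fun i => if i.1 ∈ Vn then a i.1 else c)

lemma sum_ext (Vn S : Finset Vinf) (hsub : Vn ⊆ S) (a b : Vinf → ℝ)
    (f g : Option {i : Vinf // i ∈ S} → ℝ) :
    ∑ j : {j : Vinf // j ∈ Vn}, (((a j.1) ^ 2 + (b j.1) ^ 2 - 1) * f (some ⟨j.1, hsub j.2⟩)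
        + b j.1 * g (some ⟨j.1, hsub j.2⟩)) =
    ∑ v, ((vecExt Vn S 1 a v ^ 2 + vecExt Vn S 0 b v ^ 2 - 1) * f v + vecExt Vn S 0 b v * g v) := by
  rw [Fintype.sum_option]
  simp only [vecExt, Option.elim_none, Option.elim_some]
  norm_num
  refine Fintype.sum_of_injective (fun j : {j : Vinf // j ∈ Vn} => (⟨j.1, hsub j.2⟩ : {i // i ∈ S}))
    ?_ _ _ ?_ ?_
  · intro i j h
    exact Subtype.ext (congrArg (fun x : {i // i ∈ S} => x.1) h)
  · intro i hi
    have : i.1 ∉ Vn := fun h => hi ⟨⟨i.1, h⟩, rfl⟩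
    simp [this]
  · intro i
    simp [i.2]

lemma closed_alpha (Vn S : Finset Vinf) (hsub : Vn ⊆ S) (α : Vinf → ℝ)
    (hαfin : {i : Vinf | α i ≠ 0}.Finite) (c : ℝ) (a : Vinf → ℝ) :
    ∑ v, alphaExt α S v * vecExt Vn S c a v = c * ∑' i, α i + ∑ i ∈ Vn, α i * (a i - c) := by
  have hsum : Summable α := summable_of_hasFiniteSupport hαfin
  have h1 := hsum.sum_add_tsum_subtype_compl S
  rw [Fintype.sum_option]
  simp only [alphaExt, vecExt, Option.elim_none, Option.elim_some]
  have h2 : ∑ i : {i // i ∈ S}, α i.1 * (if i.1 ∈ Vn then a i.1 else c) =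
      ∑ i ∈ S, α i * (if i ∈ Vn then a i else c) :=
    Finset.sum_coe_sort S (fun i => α i * (if i ∈ Vn then a i else c))
  have h3 : ∑ i ∈ Vn, α i * (a i - c) = ∑ i ∈ S, α i * ((if i ∈ Vn then a i else c) - c) := by
    rw [← Finset.sum_subset hsub]
    · exact Finset.sum_congr rfl fun i hi => by rw [if_pos hi]
    · intro i _ hi; rw [if_neg hi]; ring
  rw [h2, h3, ← h1]
  simp only [mul_sub, Finset.sum_sub_distrib, ← Finset.sum_mul]
  ring

lemma closed_W (W : Vinf → Vinf → ℝ) (hsymm : ∀ i j, W i j = W j i)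
    (hlocsum : ∀ i, Summable (W i))
    (Vn S : Finset Vinf) (hsub : Vn ⊆ S) (a b : Vinf → ℝ) :
    (1/2) * ∑ i, ∑ j, wiredW W S i j * (1 - vecExt Vn S 1 a i * vecExt Vn S 1 a j
      - vecExt Vn S 0 b i * vecExt Vn S 0 b j) =
    ∑ i ∈ Vn, (∑' j, W i j) * (1 - a i) -
      (1/2) * ∑ i ∈ Vn, ∑ j ∈ Vn, W i j * ((1 - a i) * (1 - a j) + b i * b j) := by
  set A : Vinf → ℝ := fun i => if i ∈ Vn then a i else 1 with hA
  set B : Vinf → ℝ := fun i => if i ∈ Vn then b i else 0 with hB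
  have h1 : ∀ i, ∑' j : {j : Vinf // j ∉ S}, W i j.1 = ∑' j, W i j - ∑ j ∈ S, W i j := by
    intro i
    have := (hlocsum i).sum_add_tsum_subtype_compl S
    linarith
  simp only [Fintype.sum_option]
  simp only [wiredW, vecExt, Option.elim_none, Option.elim_some, h1]
  have e1 : ∀ g : Vinf → ℝ, ∑ i : {i // i ∈ S}, g i.1 = ∑ i ∈ S, g i := fun g =>
    Finset.sum_coe_sort S g
  have e2 : ∑ i : {i // i ∈ S}, (∑' j, W i.1 j - ∑ j ∈ S, W i.1 j) *
      (1 - 1 * (if i.1 ∈ Vn then a i.1 else 1) - 0 * (if i.1 ∈ Vn then b i.1 else 0)) =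
      ∑ i ∈ S, (∑' j, W i j - ∑ j ∈ S, W i j) * (1 - A i) := by
    rw [← e1]
    exact Finset.sum_congr rfl fun i _ => by simp only [hA]; ring
  have e3 : ∑ i : {i // i ∈ S}, (∑' j, W i.1 j - ∑ j ∈ S, W i.1 j) *
      (1 - (if i.1 ∈ Vn then a i.1 else 1) * 1 - (if i.1 ∈ Vn then b i.1 else 0) * 0) =
      ∑ i ∈ S, (∑' j, W i j - ∑ j ∈ S, W i j) * (1 - A i) := by
    rw [← e1]
    exact Finset.sum_congr rfl fun i _ => by simp only [hA]; ring
  have e4 : ∑ i : {i // i ∈ S}, ∑ j : {i // i ∈ S}, W i.1 j.1 *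
      (1 - (if i.1 ∈ Vn then a i.1 else 1) * (if j.1 ∈ Vn then a j.1 else 1) -
        (if i.1 ∈ Vn then b i.1 else 0) * (if j.1 ∈ Vn then b j.1 else 0)) =
      ∑ i ∈ S, ∑ j ∈ S, W i j * (1 - A i * A j - B i * B j) := by
    rw [← e1]
    exact Finset.sum_congr rfl fun i _ => by rw [← e1]
  rw [Finset.sum_add_distrib, e2, e3, e4]
  have f1 : ∑ i ∈ Vn, (∑' j, W i j) * (1 - a i) = ∑ i ∈ S, (∑' j, W i j) * (1 - A i) := by
    rw [← Finset.sum_subset hsub]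
    · exact Finset.sum_congr rfl fun i hi => by simp only [hA]; rw [if_pos hi]
    · intro i _ hi; simp only [hA]; rw [if_neg hi]; ring
  have f2 : ∑ i ∈ Vn, ∑ j ∈ Vn, W i j * ((1 - a i) * (1 - a j) + b i * b j) =
      ∑ i ∈ S, ∑ j ∈ S, W i j * ((1 - A i) * (1 - A j) + B i * B j) := by
    rw [← Finset.sum_subset hsub (f := fun i => ∑ j ∈ S, W i j * ((1 - A i) * (1 - A j) + B i * B j))]
    · refine Finset.sum_congr rfl fun i hi => ?_
      rw [← Finset.sum_subset hsub]
      · exact Finset.sum_congr rfl fun j hj => by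
          simp only [hA, hB]; rw [if_pos hi, if_pos hj, if_pos hi, if_pos hj]
      · intro j _ hj; simp only [hA, hB]; rw [if_neg hj, if_neg hj]; ring
    · intro i _ hi
      refine Finset.sum_eq_zero fun j _ => ?_
      simp only [hA, hB]; rw [if_neg hi, if_neg hi]; ring
  rw [f1, f2]
  have g1 : ∑ i ∈ S, (∑' j, W i j - ∑ j ∈ S, W i j) * (1 - A i) =
      ∑ i ∈ S, (∑' j, W i j) * (1 - A i) - ∑ i ∈ S, ∑ j ∈ S, W i j * (1 - A i) := by
    rw [← Finset.sum_sub_distrib]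
    exact Finset.sum_congr rfl fun i _ => by rw [sub_mul, Finset.sum_mul]
  have g2 : ∑ i ∈ S, ∑ j ∈ S, W i j * (1 - A i) = ∑ i ∈ S, ∑ j ∈ S, W i j * (1 - A j) := by
    rw [Finset.sum_comm]
    exact Finset.sum_congr rfl fun i _ => Finset.sum_congr rfl fun j _ => by rw [hsymm]
  have g3 : ∑ i ∈ S, ∑ j ∈ S, W i j * (1 - A i * A j - B i * B j) =
      ∑ i ∈ S, ∑ j ∈ S, W i j * (1 - A i) + ∑ i ∈ S, ∑ j ∈ S, W i j * (1 - A j)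
      - ∑ i ∈ S, ∑ j ∈ S, W i j * ((1 - A i) * (1 - A j) + B i * B j) := by
    simp only [← Finset.sum_add_distrib, ← Finset.sum_sub_distrib]
    exact Finset.sum_congr rfl fun i _ => Finset.sum_congr rfl fun j _ => by ring
  rw [g1, g3, ← g2]
  ring

lemma closed_prod (Vn S : Finset Vinf) (hsub : Vn ⊆ S) (a : Vinf → ℝ) :
    ∏ v, vecExt Vn S 1 a v = ∏ i ∈ Vn, a i := by
  rw [Fintype.prod_option]
  simp only [vecExt, Option.elim_none, Option.elim_some, one_mul]
  have e1 : ∏ i : {i // i ∈ S}, (if i.1 ∈ Vn then a i.1 else 1) =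
    ∏ i ∈ S, (if i ∈ Vn then a i else 1) := Finset.prod_coe_sort S (fun i => if i ∈ Vn then a i else 1)
  rw [e1, ← Finset.prod_subset hsub]
  · exact Finset.prod_congr rfl fun i hi => by rw [if_pos hi]
  · intro i _ hi; rw [if_neg hi]

/-- The generating integral on the wired graph over `S ⊇ Vn` only depends on `Vn`. -/
lemma wired_formula (W : Vinf → Vinf → ℝ)
    (hsymm : ∀ i j, W i j = W j i)
    (hdiag : ∀ i, W i i = 0)
    (hnonneg : ∀ i j, 0 ≤ W i j)
    (hlocfin : ∀ i, {j : Vinf | 0 < W i j}.Finite)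
    (Vn S : Finset Vinf) (hsub : Vn ⊆ S)
    (hconn : (SimpleGraph.fromRel
      fun i j : Option {i : Vinf // i ∈ S} => 0 < wiredW W S i j).Connected)
    (α : Vinf → ℝ) (hα : ∀ i, α i ≤ 0) (hαfin : {i : Vinf | α i ≠ 0}.Finite)
    (a b : Vinf → ℝ) (ha : ∀ i ∈ Vn, 0 < a i) :
    ∫ p, Complex.exp (∑ v : Option {i : Vinf // i ∈ S},
          (alphaExt α S v : ℂ) * Real.exp (p.1 v) * (1 + Complex.I * (p.2 v : ℂ)))
        * Complex.exp (Complex.ofReal (-∑ j : {j : Vinf // j ∈ Vn},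
            (((a j.1) ^ 2 + (b j.1) ^ 2 - 1)
                * betaW (wiredW W S) p.1 (some ⟨j.1, hsub j.2⟩)
              + b j.1 * thetaW (wiredW W S) p.1 p.2 (some ⟨j.1, hsub j.2⟩))))
        ∂(muW (wiredW W S) none) =
      ((Real.exp (1 * ∑' i, α i + ∑ i ∈ Vn, α i * (a i - 1) +
        (∑ i ∈ Vn, (∑' j, W i j) * (1 - a i) -
      (1/2) * ∑ i ∈ Vn, ∑ j ∈ Vn, W i j * ((1 - a i) * (1 - a j) + b i * b j))) *
        (∏ i ∈ Vn, a i)⁻¹ : ℝ) : ℂ) *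
        Complex.exp (-(Complex.I * ((0 * ∑' i, α i + ∑ i ∈ Vn, α i * (b i - 0) : ℝ) : ℂ))) := by
  have hlocsum : ∀ i, Summable (W i) := by
    intro i
    refine summable_of_hasFiniteSupport ((hlocfin i).subset ?_)
    intro j hj
    exact lt_of_le_of_ne (hnonneg i j) (Ne.symm hj)
  have hs : ∀ i j, wiredW W S i j = wiredW W S j i := by
    rintro (_ | i) (_ | j) <;> simp [wiredW]
    exact hsymm _ _
  have hd : ∀ i, wiredW W S i i = 0 := by
    rintro (_ | i) <;> simp [wiredW, hdiag]
  have hw : ∀ i j, 0 ≤ wiredW W S i j := by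
    rintro (_ | i) (_ | j)
    · exact le_rfl
    · exact tsum_nonneg fun k => hnonneg _ _
    · exact tsum_nonneg fun k => hnonneg _ _
    · exact hnonneg _ _
  have hα' : ∀ v, alphaExt α S v ≤ 0 := by
    rintro (_ | i)
    · exact tsum_nonpos fun k => hα _
    · exact hα _
  have ha' : ∀ v, 0 < vecExt Vn S 1 a v := by
    rintro (_ | i)
    · exact one_pos
    · simp only [vecExt, Option.elim_some]
      split_ifs with h
      · exact ha _ h
      · exact one_pos
  have h := main_formula hs hd hw hconn none (alphaExt α S) (vecExt Vn S 1 a) (vecExt Vn S 0 b)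
    hα' ha' rfl rfl
  rw [closed_alpha Vn S hsub α hαfin 1 a, closed_alpha Vn S hsub α hαfin 0 b,
    closed_W W hsymm hlocsum Vn S hsub a b, closed_prod Vn S hsub a] at h
  rw [← h]
  refine integral_congr_ae (Filter.Eventually.of_forall fun p => ?_)
  simp only
  rw [sum_ext Vn S hsub a b (betaW (wiredW W S) p.1) (thetaW (wiredW W S) p.1 p.2)]

end final

/-- generating martingale, finite-volume identity: for
`α ∈ (−∞,0]^{V_∞}` zero outside a finite set and `a ∈ (0,∞)^{V_n}`, `b ∈ ℝ^{V_n}`,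
`∫ exp(Σ_{j∈Ṽ_{n+1}} α^{(n+1)}_j e^{u_j}(1+is_j))·exp(−Σ_{j∈V_n}[(a_j²+b_j²−1)β^{V_{n+1}}_j
 + b_jθ^{V_{n+1}}_j]) dμ^W_{n+1}
 = ∫ exp(Σ_{j∈Ṽ_n} α^{(n)}_j e^{u_j}(1+is_j))·exp(−Σ_{j∈V_n}[(a_j²+b_j²−1)β^{V_n}_j
 + b_jθ^{V_n}_j]) dμ^W_n`. -/
theorem stmt3 {Vinf : Type*} [DecidableEq Vinf] [Infinite Vinf]
    (W : Vinf → Vinf → ℝ)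
    (hsymm : ∀ i j, W i j = W j i)
    (hdiag : ∀ i, W i i = 0)
    (hnonneg : ∀ i j, 0 ≤ W i j)
    (hlocfin : ∀ i, {j : Vinf | 0 < W i j}.Finite)
    (hconn : (SimpleGraph.fromRel fun i j : Vinf => 0 < W i j).Connected)
    (Vn Vm : Finset Vinf) (hsub : Vn ⊆ Vm)
    (hconn_n : (SimpleGraph.fromRel
      fun i j : Option {i : Vinf // i ∈ Vn} => 0 < wiredW W Vn i j).Connected)
    (hconn_m : (SimpleGraph.fromRel
      fun i j : Option {i : Vinf // i ∈ Vm} => 0 < wiredW W Vm i j).Connected)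
    (α : Vinf → ℝ) (hα : ∀ i, α i ≤ 0) (hαfin : {i : Vinf | α i ≠ 0}.Finite)
    (a b : Vinf → ℝ) (ha : ∀ i ∈ Vn, 0 < a i) :
    ∫ p, Complex.exp (∑ v : Option {i : Vinf // i ∈ Vm},
          (alphaExt α Vm v : ℂ) * Real.exp (p.1 v) * (1 + Complex.I * (p.2 v : ℂ)))
        * Complex.exp (Complex.ofReal (-∑ j : {j : Vinf // j ∈ Vn},
            (((a j.1) ^ 2 + (b j.1) ^ 2 - 1)
                * betaW (wiredW W Vm) p.1 (some ⟨j.1, hsub j.2⟩)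
              + b j.1 * thetaW (wiredW W Vm) p.1 p.2 (some ⟨j.1, hsub j.2⟩))))
        ∂(muW (wiredW W Vm) none)
      = ∫ p, Complex.exp (∑ v : Option {i : Vinf // i ∈ Vn},
          (alphaExt α Vn v : ℂ) * Real.exp (p.1 v) * (1 + Complex.I * (p.2 v : ℂ)))
        * Complex.exp (Complex.ofReal (-∑ j : {j : Vinf // j ∈ Vn},
            (((a j.1) ^ 2 + (b j.1) ^ 2 - 1) * betaW (wiredW W Vn) p.1 (some j)
              + b j.1 * thetaW (wiredW W Vn) p.1 p.2 (some j))))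
        ∂(muW (wiredW W Vn) none) := by
  exact (wired_formula W hsymm hdiag hnonneg hlocfin Vn Vm hsub hconn_m α hα hαfin a b ha).trans
    (wired_formula W hsymm hdiag hnonneg hlocfin Vn Vn (Finset.Subset.refl Vn) hconn_n α hα hαfin
      a b ha).symm
end
end

section
/- (Ward identity for the exponential, Grassmann-free version.) For every α∈(−∞,0]^Ṽ, the complex integral ∫ exp(Σ_{j∈Ṽ} α_j e^{u_j}(1+i s_j)) dμ^W(u,s) equals exp(Σ_{j∈Ṽ} α_j), where i denotes the imaginary unit. -/
open MeasureTheory Real Finset BigOperators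

noncomputable section

lemma w17_x_pos (c z : ℝ) (hc : 0 < c) : 0 < (z + √(z ^ 2 + 4 * c)) / 2 := by
  have : |z| < √(z ^ 2 + 4 * c) := by
    rw [← Real.sqrt_sq_eq_abs]
    exact Real.sqrt_lt_sqrt (sq_nonneg _) (by linarith)
  have := neg_abs_le z
  linarith

lemma w17_x_eq (c z : ℝ) (hc : 0 < c) :
    (z + √(z ^ 2 + 4 * c)) / 2 - c / ((z + √(z ^ 2 + 4 * c)) / 2) = z := by
  have h := w17_x_pos c z hc
  have hr : √(z ^ 2 + 4 * c) ^ 2 = z ^ 2 + 4 * c := Real.sq_sqrt (by positivity)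
  rw [sub_eq_iff_eq_add, ← sub_eq_iff_eq_add', eq_div_iff h.ne']
  nlinarith

lemma w17_gauss_odd (c : ℝ) (hc : 0 < c) :
    ∫⁻ z : ℝ, ENNReal.ofReal ((1 + z / √(z ^ 2 + 4 * c)) * Real.exp (-z ^ 2 / 2))
      = ENNReal.ofReal (√(2 * π)) := by
  have hg : Integrable (fun z : ℝ => Real.exp (-z ^ 2 / 2)) := by
    have := integrable_exp_neg_mul_sq (b := 1 / 2) (by norm_num)
    refine this.congr (Filter.Eventually.of_forall fun z => ?_)
    simp only; congr 1; ring
  have hb : ∀ z : ℝ, |z / √(z ^ 2 + 4 * c)| ≤ 1 := by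
    intro z
    have h0 : 0 < √(z ^ 2 + 4 * c) := Real.sqrt_pos.2 (by positivity)
    rw [abs_div, abs_of_pos h0, div_le_one h0, ← Real.sqrt_sq_eq_abs]
    exact Real.sqrt_le_sqrt (by linarith)
  have hm : Measurable (fun z : ℝ => z / √(z ^ 2 + 4 * c)) := by fun_prop
  have hg2 : Integrable (fun z : ℝ => z / √(z ^ 2 + 4 * c) * Real.exp (-z ^ 2 / 2)) := by
    refine hg.bdd_mul (c := 1) hm.aestronglyMeasurable ?_
    exact Filter.Eventually.of_forall hb
  have hodd : ∫ z : ℝ, z / √(z ^ 2 + 4 * c) * Real.exp (-z ^ 2 / 2) = 0 := by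
    have h := integral_neg_eq_self (fun z : ℝ => z / √(z ^ 2 + 4 * c) * Real.exp (-z ^ 2 / 2)) volume
    have h2 : ∀ z : ℝ, -z / √((-z) ^ 2 + 4 * c) * Real.exp (-(-z) ^ 2 / 2)
        = -(z / √(z ^ 2 + 4 * c) * Real.exp (-z ^ 2 / 2)) := by
      intro z; rw [neg_sq]; ring
    simp_rw [h2] at h
    rw [integral_neg] at h
    linarith
  have hintz : ∫ z : ℝ, (1 + z / √(z ^ 2 + 4 * c)) * Real.exp (-z ^ 2 / 2) = √(2 * π) := by
    simp_rw [add_mul, one_mul]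
    rw [integral_add hg hg2, hodd, add_zero]
    have := integral_gaussian (1 / 2)
    rw [show 2 * π = π / (1 / 2) by ring, ← this]
    congr 1; ext z; congr 1; ring
  rw [← hintz, ofReal_integral_eq_lintegral_ofReal]
  · simp_rw [add_mul, one_mul]; exact hg.add hg2
  · refine Filter.Eventually.of_forall fun z => ?_
    have := (abs_le.1 (hb z)).1
    exact mul_nonneg (by linarith) (Real.exp_pos _).le

lemma w17_ig (c : ℝ) (hc : 0 ≤ c) :
    ∫⁻ y in Set.Ioi (0 : ℝ), ENNReal.ofReal (Real.exp (-(y / 2) - c ^ 2 / (2 * y)) / √y)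
      = ENNReal.ofReal (√(2 * π) * Real.exp (-c)) := by
  rcases hc.eq_or_lt with rfl | hc
  · have h1 := Real.integral_rpow_mul_exp_neg_mul_Ioi (a := 1 / 2) (r := 1 / 2) (by norm_num) (by norm_num)
    have h0 : ∀ y ∈ Set.Ioi (0 : ℝ), y ^ ((1 / 2 : ℝ) - 1) * Real.exp (-(1 / 2 * y))
        = Real.exp (-(y / 2) - 0 ^ 2 / (2 * y)) / √y := by
      intro y hy
      have hy : 0 < y := hy
      rw [Real.sqrt_eq_rpow, show (1 / 2 : ℝ) - 1 = - (1 / 2) by norm_num, Real.rpow_neg hy.le]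
      rw [div_eq_mul_inv, mul_comm]
      congr 2; ring
    have h2 : IntegrableOn (fun y : ℝ => y ^ ((1 / 2 : ℝ) - 1) * Real.exp (-(1 / 2 * y))) (Set.Ioi 0) := by
      by_contra h
      rw [integral_undef h, Real.Gamma_one_half_eq] at h1
      have : 0 < (1 / (1 / 2) : ℝ) ^ (1 / 2 : ℝ) * √π := by positivity
      linarith
    rw [setLIntegral_congr_fun measurableSet_Ioi (fun y hy => by rw [← h0 y hy]),
      ← ofReal_integral_eq_lintegral_ofReal h2, h1]
    · rw [Real.Gamma_one_half_eq, neg_zero, Real.exp_zero, mul_one, Real.sqrt_mul (by norm_num),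
        ← Real.sqrt_eq_rpow]
      norm_num
    · refine (ae_restrict_iff' measurableSet_Ioi).2 (Filter.Eventually.of_forall fun y hy => ?_)
      have hy : 0 < y := hy
      positivity
  · set x : ℝ → ℝ := fun z => (z + √(z ^ 2 + 4 * c)) / 2 with hx
    have hxp : ∀ z, 0 < x z := fun z => w17_x_pos c z hc
    have hxe : ∀ z, x z - c / x z = z := fun z => w17_x_eq c z hc
    have hder : ∀ z ∈ Set.univ, HasDerivWithinAt (fun z => x z ^ 2)
        (x z * (1 + z / √(z ^ 2 + 4 * c))) Set.univ z := by
      intro z _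
      have h0 : z ^ 2 + 4 * c ≠ 0 := by positivity
      have := ((((hasDerivAt_id z).add (((hasDerivAt_pow 2 z).add_const (4 * c)).sqrt h0)).div_const 2).pow 2)
      refine (this.congr_deriv ?_).hasDerivWithinAt
      simp [hx]
      field_simp
    have hinj : Set.InjOn (fun z => x z ^ 2) Set.univ := by
      intro a _ b _ hab
      have : x a = x b := by
        have := hxp a; have := hxp b
        exact (pow_left_inj₀ (hxp a).le (hxp b).le two_ne_zero).1 hab
      rw [← hxe a, ← hxe b, this]
    have himg : (fun z => x z ^ 2) '' Set.univ = Set.Ioi 0 := by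
      ext y
      simp only [Set.image_univ, Set.mem_range, Set.mem_Ioi]
      constructor
      · rintro ⟨z, rfl⟩; have := hxp z; positivity
      · intro hy
        have hs : 0 < √y := Real.sqrt_pos.2 hy
        refine ⟨√y - c / √y, ?_⟩
        have : (√y - c / √y) ^ 2 + 4 * c = (√y + c / √y) ^ 2 := by field_simp; ring
        simp only [hx]
        rw [this, Real.sqrt_sq (by positivity)]
        ring_nf
        exact Real.sq_sqrt hy.le
    rw [← himg, lintegral_image_eq_lintegral_abs_deriv_mul MeasurableSet.univ hder hinj,
      setLIntegral_univ, mul_comm (√(2 * π)), ENNReal.ofReal_mul (Real.exp_pos _).le, ← w17_gauss_odd c hc,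
      ← lintegral_const_mul' _ _ ENNReal.ofReal_ne_top]
    refine lintegral_congr fun z => ?_
    rw [← ENNReal.ofReal_mul (abs_nonneg _), ← ENNReal.ofReal_mul (Real.exp_pos _).le]
    congr 1
    have h0 : 0 < √(z ^ 2 + 4 * c) := Real.sqrt_pos.2 (by positivity)
    have h1 : 0 ≤ 1 + z / √(z ^ 2 + 4 * c) := by
      have h := hxp z
      simp only [hx] at h
      rw [one_add_div h0.ne']
      apply div_nonneg _ h0.le
      linarith
    have hp := hxp z
    rw [abs_of_nonneg (mul_nonneg hp.le h1), Real.sqrt_sq hp.le]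
    have h3 : -(x z ^ 2 / 2) - c ^ 2 / (2 * x z ^ 2) = -c + (-z ^ 2 / 2) := by
      conv_rhs => rw [← hxe z]
      field_simp
      ring
    rw [h3, Real.exp_add]
    field_simp

open Matrix in
open scoped MatrixOrder in
lemma w17_gaussian {ι : Type*} [Fintype ι] [DecidableEq ι] (A : Matrix ι ι ℝ) (hA : A.PosDef)
    (b : ι → ℝ) :
    ∫ s : ι → ℝ, Complex.exp (-(1 / 2) * ((s ⬝ᵥ A *ᵥ s : ℝ) : ℂ) + Complex.I * ((b ⬝ᵥ s : ℝ) : ℂ))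
      = ((√(2 * π) ^ Fintype.card ι / √A.det * Real.exp (-(1 / 2) * (b ⬝ᵥ A⁻¹ *ᵥ b)) : ℝ) : ℂ) := by
  obtain ⟨B, hB, hBA⟩ : ∃ B : Matrix ι ι ℝ, IsUnit B ∧ A = Bᵀ * B := by
    obtain ⟨B, hB⟩ := CStarAlgebra.nonneg_iff_eq_star_mul_self.1 (Matrix.nonneg_iff_posSemidef.2 hA.posSemidef)
    refine ⟨B, ?_, by simpa [Matrix.star_eq_conjTranspose] using hB⟩
    rw [Matrix.isUnit_iff_isUnit_det]
    have := hA.det_pos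
    rw [hB, Matrix.det_mul] at this
    exact (right_ne_zero_of_mul this.ne').isUnit
  have hBd : IsUnit B.det := (Matrix.isUnit_iff_isUnit_det _).1 hB
  have hBd0 : B.det ≠ 0 := hBd.ne_zero
  set e : ι → ℝ := (B⁻¹)ᵀ *ᵥ b with he
  set g : (ι → ℝ) → ℂ := fun v => Complex.exp (-∑ i, (1 / 2 : ℂ) * (v i : ℂ) ^ 2
      + ∑ i, (Complex.I * (e i : ℂ)) * (v i : ℂ)) with hg
  have h1 : ∀ s : ι → ℝ, Complex.exp (-(1 / 2) * ((s ⬝ᵥ A *ᵥ s : ℝ) : ℂ)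
      + Complex.I * ((b ⬝ᵥ s : ℝ) : ℂ)) = g (toLin' B s) := by
    intro s
    have ha : s ⬝ᵥ A *ᵥ s = ∑ i, (B *ᵥ s) i ^ 2 := by
      rw [hBA, ← Matrix.mulVec_mulVec, Matrix.dotProduct_mulVec, Matrix.vecMul_transpose]
      simp [dotProduct, sq]
    have hb : b ⬝ᵥ s = ∑ i, e i * (B *ᵥ s) i := by
      change _ = e ⬝ᵥ (B *ᵥ s)
      rw [he, Matrix.dotProduct_mulVec, Matrix.mulVec_transpose, Matrix.vecMul_vecMul,
        Matrix.nonsing_inv_mul _ hBd, Matrix.vecMul_one]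
    simp only [hg, toLin'_apply]
    rw [ha, hb]
    push_cast
    rw [← Finset.mul_sum, Finset.mul_sum Finset.univ _ Complex.I]
    congr 2
    · ring
    · refine Finset.sum_congr rfl fun i _ => ?_; ring
  simp_rw [h1]
  have h2 : ∫ v, g v = ((√(2 * π) ^ Fintype.card ι * Real.exp (-(1 / 2) * (b ⬝ᵥ A⁻¹ *ᵥ b)) : ℝ) : ℂ) := by
    simp only [hg]
    rw [GaussianFourier.integral_cexp_neg_sum_mul_add (b := fun _ => (1 / 2 : ℂ)) (by intro i; norm_num)]
    have hc : ((π : ℂ) / (1 / 2)) ^ (1 / 2 : ℂ) = ((√(2 * π) : ℝ) : ℂ) := by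
      rw [Real.sqrt_eq_rpow, Complex.ofReal_cpow (by positivity)]
      push_cast
      congr 1; ring
    have hbb : b ⬝ᵥ A⁻¹ *ᵥ b = ∑ i, e i ^ 2 := by
      rw [hBA, Matrix.mul_inv_rev, ← Matrix.mulVec_mulVec, Matrix.dotProduct_mulVec,
        ← Matrix.mulVec_transpose, ← Matrix.transpose_nonsing_inv]
      simp [dotProduct, sq, he]
    rw [Finset.prod_mul_distrib, hc, ← Complex.exp_sum, hbb]
    push_cast
    rw [Finset.prod_const, Finset.card_univ, Finset.mul_sum]
    congr 2
    refine Finset.sum_congr rfl fun i _ => ?_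
    rw [mul_pow, Complex.I_sq]; ring
  have h3 : ∫ s, g (toLin' B s) = ∫ v, g v ∂(Measure.map (toLin' B) volume) := by
    rw [integral_map]
    · exact (LinearMap.continuous_of_finiteDimensional _).aemeasurable
    · apply Continuous.aestronglyMeasurable
      simp only [hg]
      fun_prop
  rw [h3, Real.map_matrix_volume_pi_eq_smul_volume_pi hBd0, integral_smul_measure, h2,
    ENNReal.toReal_ofReal (abs_nonneg _)]
  have h4 : √A.det = |B.det| := by
    rw [hBA, Matrix.det_mul, Matrix.det_transpose, Real.sqrt_mul_self_eq_abs]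
  rw [h4, abs_inv, Complex.real_smul, ← Complex.ofReal_mul]
  congr 1
  ring

open Matrix in
lemma w17_Mmatrix {ι : Type*} [Fintype ι] [DecidableEq ι] (w : Matrix ι ι ℝ) (d : ι → ℝ)
    (hw : ∀ i j, 0 ≤ w i j) (hH : (diagonal d - w).PosDef) (x : ι → ℝ)
    (hx : ∀ i, 0 ≤ ((diagonal d - w) *ᵥ x) i) : ∀ i, 0 ≤ x i := by
  set H := diagonal d - w with hHd
  set n : ι → ℝ := fun i => max (-x i) 0 with hn
  have hoff : ∀ i j, i ≠ j → H i j ≤ 0 := by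
    intro i j hij; simp [hHd, hij, hw i j]
  have h1 : 0 ≤ n ⬝ᵥ H *ᵥ x :=
    Finset.sum_nonneg fun i _ => mul_nonneg (le_max_right _ _) (hx i)
  have h2 : n ⬝ᵥ H *ᵥ x ≤ -(n ⬝ᵥ H *ᵥ n) := by
    simp only [dotProduct, mulVec, Finset.mul_sum, ← Finset.sum_neg_distrib]
    refine Finset.sum_le_sum fun i _ => Finset.sum_le_sum fun j _ => ?_
    have hni : 0 ≤ n i := le_max_right _ _
    by_cases hij : i = j
    · subst hij
      have : n i * x i = - (n i * n i) := by
        simp only [hn]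
        rcases le_total (-x i) 0 with h | h
        · simp [max_eq_right h]
        · simp [max_eq_left h]
      apply le_of_eq
      linear_combination H i i * this
    · have := hoff i j hij
      have h3 : -n j ≤ x j := by have := le_max_left (-x j) 0; simp only [hn]; linarith
      nlinarith [mul_nonneg hni (mul_nonneg (neg_nonneg.2 this) (by linarith : 0 ≤ x j + n j))]
  have hn0 : n = 0 := by
    by_contra h
    have := hH.dotProduct_mulVec_pos h
    simp only [star_trivial] at this
    linarith
  intro i
  have := congrFun hn0 i
  simp only [hn, Pi.zero_apply] at this
  have := le_max_left (-x i) 0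
  linarith

/-- The quantity `exp(-⟨1,H1⟩/2 - ⟨η,H⁻¹η⟩/2 + ⟨η,1⟩)/√det H`. -/
def w17Q {ι : Type*} [Fintype ι] [DecidableEq ι] (H : Matrix ι ι ℝ) (η : ι → ℝ) : ℝ :=
  Real.exp (-(1 / 2) * (∑ i, ∑ j, H i j) - 1 / 2 * (∑ i, η i * (H⁻¹.mulVec η) i) + ∑ i, η i) / √H.det

open Classical in
/-- The density of the random potential. -/
def w17G {ι : Type*} [Fintype ι] (w : Matrix ι ι ℝ) (η : ι → ℝ) (d : ι → ℝ) : ENNReal :=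
  if (Matrix.diagonal d - w).PosDef then ENNReal.ofReal (w17Q (Matrix.diagonal d - w) η) else 0

lemma w17_Q_nonneg {ι : Type*} [Fintype ι] [DecidableEq ι] (H : Matrix ι ι ℝ) (η : ι → ℝ) :
    0 ≤ w17Q H η := by unfold w17Q; positivity

open Matrix in
lemma w17_measSet {ι : Type*} [Fintype ι] [DecidableEq ι] (w : Matrix ι ι ℝ)
    (hw : ∀ i j, w i j = w j i) : MeasurableSet {d : ι → ℝ | (diagonal d - w).PosDef} := by
  have hH : ∀ d : ι → ℝ, (diagonal d - w).IsHermitian := by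
    intro d
    ext i j
    simp only [conjTranspose_apply, star_trivial, Matrix.sub_apply, hw j i, Matrix.diagonal_apply]
    by_cases h : i = j
    · subst h; rfl
    · simp [h, Ne.symm h]
  have h1 : {d : ι → ℝ | (diagonal d - w).PosDef} =
      {d : ι → ℝ | (diagonal d - w).det ≠ 0} ∩
        ⋂ x : ι → ℝ, {d : ι → ℝ | 0 ≤ x ⬝ᵥ (diagonal d - w) *ᵥ x} := by
    ext d
    simp only [Set.mem_ofPred_eq, Set.mem_inter_iff, Set.mem_iInter]
    constructor
    · intro h
      exact ⟨h.det_pos.ne', fun x => by simpa using h.posSemidef.dotProduct_mulVec_nonneg x⟩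
    · rintro ⟨h0, h⟩
      have : (diagonal d - w).PosSemidef :=
        PosSemidef.of_dotProduct_mulVec_nonneg (hH d) (fun x => by simpa using h x)
      exact this.posDef_iff_det_ne_zero.2 h0
  have hc : Continuous fun d : ι → ℝ => diagonal d - w := by fun_prop
  rw [h1]
  refine MeasurableSet.inter ?_ (IsClosed.measurableSet ?_)
  · exact (measurableSet_singleton (0 : ℝ)).compl.preimage (hc.matrix_det).measurable
  · refine isClosed_iInter fun x => isClosed_le continuous_const ?_
    exact Continuous.dotProduct continuous_const (hc.matrix_mulVec continuous_const)

open Matrix in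
lemma w17_measG {ι : Type*} [Fintype ι] (w : Matrix ι ι ℝ)
    (hw : ∀ i j, w i j = w j i) (η : ι → ℝ) : Measurable (w17G w η) := by
  classical
  have hc : Continuous fun d : ι → ℝ => diagonal d - w := by fun_prop
  have hinv : ∀ i, Measurable fun d : ι → ℝ => ((diagonal d - w)⁻¹.mulVec η) i := by
    intro i
    simp only [Matrix.inv_def, Ring.inverse_eq_inv', smul_mulVec, Pi.smul_apply, smul_eq_mul]
    refine (hc.matrix_det).measurable.inv.mul ?_
    exact ((continuous_apply i).comp ((hc.matrix_adjugate).matrix_mulVec continuous_const)).measurable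
  have hij : ∀ i j, Measurable fun d : ι → ℝ => (diagonal d - w) i j := by
    intro i j
    exact (hc.matrix_elem i j).measurable
  have hQ : Measurable fun d : ι → ℝ => w17Q (diagonal d - w) η := by
    unfold w17Q
    refine Measurable.div (Real.measurable_exp.comp ?_) (hc.matrix_det.measurable.sqrt)
    refine Measurable.add (Measurable.sub (Measurable.const_mul ?_ _) (Measurable.const_mul ?_ _)) measurable_const
    · exact Finset.measurable_sum _ fun i _ => Finset.measurable_sum _ fun j _ => hij i j
    · exact Finset.measurable_sum _ fun i _ => (hinv i).const_mul _
  have h := hQ.ennreal_ofReal.indicator (w17_measSet w hw)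
  convert h using 1
  ext d
  unfold w17G
  rw [Set.indicator_apply]
  congr!

/-- Statement of the total mass identity on the index type `ι`. -/
def w17P (ι : Type*) [Fintype ι] : Prop :=
  ∀ (w : Matrix ι ι ℝ) (η : ι → ℝ), (∀ i j, w i j = w j i) → (∀ i j, 0 ≤ w i j) → (∀ i, 0 ≤ η i) →
    ∫⁻ d : ι → ℝ, w17G w η d = ENNReal.ofReal (√(2 * π) ^ Fintype.card ι)

open Matrix in
lemma w17_P_equiv {ι κ : Type*} [Fintype ι] [Fintype κ] (e : ι ≃ κ) (h : w17P ι) : w17P κ := by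
  classical
  intro w η hw hn hη
  have h1 := h (w.submatrix e e) (η ∘ e) (fun i j => hw _ _) (fun i j => hn _ _) (fun i => hη _)
  rw [← Fintype.card_congr e, ← h1]
  rw [(volume_measurePreserving_piCongrLeft (fun _ : κ => ℝ) e).lintegral_map_equiv]
  refine lintegral_congr fun d => ?_
  have hd : MeasurableEquiv.piCongrLeft (fun _ : κ => ℝ) e d = d ∘ e.symm := by
    ext k
    obtain ⟨i, rfl⟩ := e.surjective k
    simp [MeasurableEquiv.coe_piCongrLeft, Equiv.piCongrLeft_apply_apply]
  rw [hd]
  have hH : (diagonal d - w.submatrix e e) = (diagonal (d ∘ e.symm) - w).submatrix e e := by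
    ext i j
    simp [Matrix.diagonal_apply]
  unfold w17G
  have hpd : (diagonal d - w.submatrix e e).PosDef ↔ (diagonal (d ∘ e.symm) - w).PosDef := by
    rw [hH]
    constructor
    · intro hh
      have := hh.submatrix (e := e.symm) e.symm.injective
      simpa using this
    · intro hh
      exact hh.submatrix e.injective
  have hQ : w17Q (diagonal d - w.submatrix e e) (η ∘ e) = w17Q (diagonal (d ∘ e.symm) - w) η := by
    rw [hH]
    unfold w17Q
    rw [Matrix.det_submatrix_equiv_self, Matrix.inv_submatrix_equiv, Matrix.submatrix_mulVec_equiv]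
    simp only [Matrix.submatrix_apply, Function.comp_apply]
    have hηη : ((η ∘ e) ∘ e.symm) = η := by ext; simp
    rw [hηη, e.sum_comp (fun i => η i * ((diagonal (d ∘ e.symm) - w)⁻¹ *ᵥ η) i), e.sum_comp η]
    congr 6
    rw [← e.sum_comp]
    exact Finset.sum_congr rfl fun i _ => e.sum_comp (fun j => (diagonal (d ∘ e.symm) - w) (e i) j)
  congr! 1
  · exact hpd.symm
  · congr 1
    convert hQ.symm

/-- Bordered matrix. -/
def w17M {ι : Type*} (A : Matrix ι ι ℝ) (b : ι → ℝ) (τ : ℝ) : Matrix (ι ⊕ Unit) (ι ⊕ Unit) ℝ :=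
  Matrix.fromBlocks A (Matrix.of fun i _ => -b i) (Matrix.of fun _ j => -b j) (Matrix.of fun _ _ => τ)

open Matrix in
lemma w17_schur {ι : Type*} [Fintype ι] [DecidableEq ι] (A : Matrix ι ι ℝ) (b : ι → ℝ) (τ : ℝ) :
    (Matrix.of fun _ _ => τ : Matrix Unit Unit ℝ) -
      (Matrix.of fun _ j => -b j : Matrix Unit ι ℝ) * A⁻¹ * (Matrix.of fun i _ => -b i : Matrix ι Unit ℝ)
      = Matrix.of fun _ _ => τ - b ⬝ᵥ A⁻¹ *ᵥ b := by
  ext i j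
  rw [Matrix.mul_assoc]
  simp [Matrix.mul_apply, dotProduct, mulVec]

open Matrix in
lemma w17_M_det {ι : Type*} [Fintype ι] [DecidableEq ι] (A : Matrix ι ι ℝ) (hA : A.PosDef)
    (b : ι → ℝ) (τ : ℝ) : (w17M A b τ).det = A.det * (τ - b ⬝ᵥ A⁻¹ *ᵥ b) := by
  have : Invertible A := hA.isUnit.invertible
  unfold w17M
  rw [det_fromBlocks₁₁, Matrix.invOf_eq_nonsing_inv, w17_schur, Matrix.det_unique (n := Unit)]
  rfl

open Matrix in
lemma w17_M_posDef {ι : Type*} [Fintype ι] [DecidableEq ι] (A : Matrix ι ι ℝ) (hA : A.PosDef)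
    (b : ι → ℝ) (τ : ℝ) : (w17M A b τ).PosDef ↔ 0 < τ - b ⬝ᵥ A⁻¹ *ᵥ b := by
  have : Invertible A := hA.isUnit.invertible
  have hdet := w17_M_det A hA b τ
  have hS : (w17M A b τ).PosSemidef ↔ 0 ≤ τ - b ⬝ᵥ A⁻¹ *ᵥ b := by
    have h := PosDef.fromBlocks₁₁ (A := A) (Matrix.of fun i _ => -b i : Matrix ι Unit ℝ)
      (Matrix.of fun _ _ => τ) hA
    have hT : (Matrix.of fun i _ => -b i : Matrix ι Unit ℝ)ᴴ = Matrix.of fun _ j => -b j := by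
      ext i j; simp
    rw [hT, w17_schur] at h
    unfold w17M
    rw [h]
    constructor
    · intro h; simpa using h.diag_nonneg (i := ())
    · intro h
      have : (Matrix.of fun _ _ => τ - b ⬝ᵥ A⁻¹ *ᵥ b : Matrix Unit Unit ℝ)
        = Matrix.diagonal fun _ => τ - b ⬝ᵥ A⁻¹ *ᵥ b := by ext i j; simp
      rw [this]
      exact PosSemidef.diagonal fun _ => h
  constructor
  · intro h
    have h1 := hS.1 h.posSemidef
    have h2 := h.det_pos
    rw [hdet] at h2
    exact (pos_iff_pos_of_mul_pos h2).1 hA.det_pos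
  · intro h
    rw [(hS.2 h.le).posDef_iff_det_ne_zero, hdet]
    exact (mul_pos hA.det_pos h).ne'

open Matrix in
lemma w17_M_Q {ι : Type*} [Fintype ι] [DecidableEq ι] (A : Matrix ι ι ℝ) (hA : A.PosDef)
    (b : ι → ℝ) (τ : ℝ) (h : 0 < τ - b ⬝ᵥ A⁻¹ *ᵥ b) (η : ι ⊕ Unit → ℝ) (c y : ℝ)
    (hc : c = η (Sum.inr ()) + b ⬝ᵥ A⁻¹ *ᵥ (fun i => η (Sum.inl i)))
    (hy : y = τ - b ⬝ᵥ A⁻¹ *ᵥ b) :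
    w17Q (w17M A b τ) η = w17Q A (fun i => η (Sum.inl i) + b i) * Real.exp c *
      (Real.exp (-(y / 2) - c ^ 2 / (2 * y)) / √y) := by
  have hAu : IsUnit A.det := (Matrix.isUnit_iff_isUnit_det _).1 hA.isUnit
  have hMu : IsUnit (w17M A b τ).det :=
    (Matrix.isUnit_iff_isUnit_det _).1 ((w17_M_posDef A hA b τ).2 h).isUnit
  set e : ι → ℝ := fun i => η (Sum.inl i) with he
  have hy0 : 0 < y := hy ▸ h
  have hAT : A⁻¹ᵀ = A⁻¹ := by
    have := hA.inv.isHermitian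
    simpa [IsHermitian] using this
  have hsym : e ⬝ᵥ A⁻¹ *ᵥ b = b ⬝ᵥ A⁻¹ *ᵥ e := by
    rw [Matrix.dotProduct_mulVec, ← Matrix.mulVec_transpose, hAT, dotProduct_comm]
  set x : ι ⊕ Unit → ℝ := Sum.elim (A⁻¹ *ᵥ e + (c / y) • A⁻¹ *ᵥ b) (fun _ => c / y) with hx
  have hMx : w17M A b τ *ᵥ x = η := by
    unfold w17M
    rw [hx, fromBlocks_mulVec]
    have hAA : ∀ v : ι → ℝ, A *ᵥ A⁻¹ *ᵥ v = v := fun v => by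
      rw [mulVec_mulVec, Matrix.mul_nonsing_inv _ hAu, one_mulVec]
    ext i
    rcases i with i | i
    · have h1 : (A *ᵥ (A⁻¹ *ᵥ e + (c / y) • A⁻¹ *ᵥ b)) i = e i + c / y * b i := by
        rw [mulVec_add, mulVec_smul, hAA, hAA]; rfl
      simp only [Sum.elim_inl, Pi.add_apply, Sum.elim_comp_inl, Sum.elim_comp_inr, h1]
      simp [mulVec, dotProduct, he]
      ring
    · have h1 : ((of fun _ j => -b j : Matrix Unit ι ℝ) *ᵥ (A⁻¹ *ᵥ e + (c / y) • A⁻¹ *ᵥ b)) i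
          = -(b ⬝ᵥ A⁻¹ *ᵥ e + c / y * (b ⬝ᵥ A⁻¹ *ᵥ b)) := by
        change (fun j => -b j) ⬝ᵥ _ = _
        change (-b) ⬝ᵥ _ = _
        rw [neg_dotProduct, dotProduct_add, dotProduct_smul, smul_eq_mul]
      have h2 : ((of fun _ _ => τ : Matrix Unit Unit ℝ) *ᵥ (fun _ => c / y)) i = τ * (c / y) := by
        simp [mulVec, dotProduct]
      simp only [Sum.elim_inr, Pi.add_apply, Sum.elim_comp_inl, Sum.elim_comp_inr, h1, h2]
      have h3 : c / y * y = c := by field_simp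
      rw [show i = () from rfl]
      linear_combination h3 + hc - (c / y) * hy
  have hinv : (w17M A b τ)⁻¹ *ᵥ η = x := by
    rw [← hMx, mulVec_mulVec, Matrix.nonsing_inv_mul _ hMu, one_mulVec]
  unfold w17Q
  rw [hinv, w17_M_det A hA, ← hy, Real.sqrt_mul hA.det_pos.le]
  have h1 : ∑ i, η i * x i = e ⬝ᵥ A⁻¹ *ᵥ e + c ^ 2 / y := by
    rw [Fintype.sum_sum_type]
    simp only [hx, Sum.elim_inl, Sum.elim_inr, Finset.univ_unique, Finset.sum_singleton]
    change e ⬝ᵥ _ + _ = _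
    rw [dotProduct_add, dotProduct_smul, hsym, smul_eq_mul]
    change _ + η (Sum.inr ()) * _ = _
    have : c ^ 2 / y = c * (c / y) := by ring
    rw [this]
    linear_combination (- (c / y)) * hc
  have h2 : ∑ i, (fun i => η (Sum.inl i) + b i) i * (A⁻¹ *ᵥ (fun i => η (Sum.inl i) + b i)) i
      = e ⬝ᵥ A⁻¹ *ᵥ e + 2 * (b ⬝ᵥ A⁻¹ *ᵥ e) + b ⬝ᵥ A⁻¹ *ᵥ b := by
    change (e + b) ⬝ᵥ A⁻¹ *ᵥ (e + b) = _
    rw [mulVec_add, add_dotProduct, dotProduct_add, dotProduct_add, hsym]; ring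
  have h3 : ∑ i, ∑ j, w17M A b τ i j = (∑ i, ∑ j, A i j) - 2 * ∑ i, b i + τ := by
    simp [w17M, Fintype.sum_sum_type, Finset.sum_add_distrib]
    ring
  rw [h1, h2, h3, Fintype.sum_sum_type, Finset.sum_add_distrib, show ∀ p q r s t : ℝ, p / q * r * (s / t) = p * r * s / (q * t) from fun p q r s t => by ring,
    ← Real.exp_add, ← Real.exp_add]
  congr 2
  simp only [Finset.univ_unique, Finset.sum_singleton]
  change _ + (_ + η (Sum.inr ())) = _
  have : c ^ 2 / (2 * y) = 1 / 2 * (c ^ 2 / y) := by field_simp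
  rw [this]
  linear_combination (-(1 : ℝ)) * hc + (1 / 2) * hy

open Matrix in
lemma w17_inner {ι : Type*} [Fintype ι] [DecidableEq ι] (A : Matrix ι ι ℝ) (hA : A.PosDef)
    (b : ι → ℝ) (η : ι ⊕ Unit → ℝ) (wn : ℝ)
    (hc : 0 ≤ η (Sum.inr ()) + b ⬝ᵥ A⁻¹ *ᵥ (fun i => η (Sum.inl i))) (F : ℝ → ENNReal)
    (hF1 : ∀ t, (w17M A b (t - wn)).PosDef → F t = ENNReal.ofReal (w17Q (w17M A b (t - wn)) η))
    (hF0 : ∀ t, ¬ (w17M A b (t - wn)).PosDef → F t = 0) :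
    ∫⁻ t, F t = ENNReal.ofReal (√(2 * π)) *
      ENNReal.ofReal (w17Q A (fun i => η (Sum.inl i) + b i)) := by
  set c := η (Sum.inr ()) + b ⬝ᵥ A⁻¹ *ᵥ (fun i => η (Sum.inl i)) with hcd
  set q := wn + b ⬝ᵥ A⁻¹ *ᵥ b with hq
  set K := w17Q A (fun i => η (Sum.inl i) + b i) * Real.exp c with hK
  have hK0 : 0 ≤ K := mul_nonneg (w17_Q_nonneg _ _) (Real.exp_pos _).le
  rw [← lintegral_add_right_eq_self F q]
  have h1 : ∀ y, F (y + q) = (Set.Ioi (0 : ℝ)).indicator (fun y => ENNReal.ofReal K *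
      ENNReal.ofReal (Real.exp (-(y / 2) - c ^ 2 / (2 * y)) / √y)) y := by
    intro y
    have hy : y = (y + q - wn) - b ⬝ᵥ A⁻¹ *ᵥ b := by rw [hq]; ring
    have hpd := w17_M_posDef A hA b (y + q - wn)
    rw [← hy] at hpd
    by_cases h : 0 < y
    · rw [Set.indicator_of_mem (by exact h), hF1 _ (hpd.2 h),
        w17_M_Q A hA b (y + q - wn) (hy ▸ h) η c y hcd hy, ENNReal.ofReal_mul hK0]
    · rw [Set.indicator_of_notMem (by exact h), hF0 _ (fun h' => h (hpd.1 h'))]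
  simp_rw [h1]
  rw [lintegral_indicator measurableSet_Ioi, lintegral_const_mul' _ _ ENNReal.ofReal_ne_top,
    w17_ig c hc, ← ENNReal.ofReal_mul hK0, ← ENNReal.ofReal_mul (Real.sqrt_nonneg _), hK]
  congr 1
  rw [Real.exp_neg]
  field_simp

open Matrix in
lemma w17_P_step {ι : Type*} [Fintype ι] (h : w17P ι) : w17P (ι ⊕ Unit) := by
  classical
  intro w η hw hn hη
  set b : ι → ℝ := fun i => w (Sum.inl i) (Sum.inr ()) with hb
  set w' : Matrix ι ι ℝ := Matrix.of fun i j => w (Sum.inl i) (Sum.inl j) with hw'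
  set wn := w (Sum.inr ()) (Sum.inr ()) with hwn
  have hM : ∀ (d' : ι → ℝ) (t : ℝ), diagonal (Sum.elim d' (fun _ : Unit => t)) - w
      = w17M (diagonal d' - w') b (t - wn) := by
    intro d' t
    ext i j
    rcases i with i | i <;> rcases j with j | j
    · simp [w17M, hw', Matrix.diagonal_apply]
    · simp [w17M, hb]
    · simp [w17M, hb, hw (Sum.inr i)]
    · simp [w17M, hwn]
  rw [(volume_measurePreserving_sumPiEquivProdPi_symm (fun _ : ι ⊕ Unit => ℝ)).lintegral_map_equiv]
  have hmeas := w17_measG w hw η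
  rw [Measure.volume_eq_prod, lintegral_prod _ (by
    exact (hmeas.comp (MeasurableEquiv.measurable _)).aemeasurable)]
  have hsym : ∀ (d' : ι → ℝ) (t : Unit → ℝ),
      (MeasurableEquiv.sumPiEquivProdPi (fun _ : ι ⊕ Unit => ℝ)).symm (d', t) = Sum.elim d' t := by
    intro d' t
    ext i
    rcases i with i | i <;> rfl
  have hin : ∀ d' : ι → ℝ, ∫⁻ t : Unit → ℝ,
      w17G w η ((MeasurableEquiv.sumPiEquivProdPi (fun _ : ι ⊕ Unit => ℝ)).symm (d', t))
      = ENNReal.ofReal (√(2 * π)) * w17G w' (fun i => η (Sum.inl i) + b i) d' := by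
    intro d'
    simp_rw [hsym]
    rw [((volume_preserving_funUnique Unit ℝ).symm _).lintegral_map_equiv]
    have hu : ∀ t : ℝ, Sum.elim d' ((MeasurableEquiv.funUnique Unit ℝ).symm t) =
        Sum.elim d' (fun _ : Unit => t) := fun t => rfl
    simp_rw [hu]
    by_cases hA : (diagonal d' - w').PosDef
    · have hG : w17G w' (fun i => η (Sum.inl i) + b i) d'
          = ENNReal.ofReal (w17Q (diagonal d' - w') (fun i => η (Sum.inl i) + b i)) := by
        unfold w17G; convert if_pos ?_; convert hA
      rw [hG]
      have hAu : IsUnit (diagonal d' - w').det := (Matrix.isUnit_iff_isUnit_det _).1 hA.isUnit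
      refine w17_inner (diagonal d' - w') hA b η wn ?_ _ ?_ ?_
      · refine add_nonneg (hη _) (Finset.sum_nonneg fun i _ => mul_nonneg (hn _ _) ?_)
        refine w17_Mmatrix w' d' (fun i j => hn _ _) hA _ ?_ i
        intro i
        rw [mulVec_mulVec, Matrix.mul_nonsing_inv _ hAu, one_mulVec]
        exact hη _
      · intro t ht
        rw [← hM] at ht ⊢
        unfold w17G; convert if_pos ?_; convert ht
      · intro t ht
        rw [← hM] at ht
        unfold w17G; convert if_neg ?_; convert ht
    · have hG : w17G w' (fun i => η (Sum.inl i) + b i) d' = 0 := by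
        unfold w17G; convert if_neg ?_; convert hA
      rw [hG, mul_zero]
      rw [lintegral_eq_zero_iff' ?_]
      · refine Filter.Eventually.of_forall fun t => ?_
        change w17G w η _ = 0
        unfold w17G; convert if_neg ?_
        intro hp
        apply hA
        have h2 : (w17M (diagonal d' - w') b (t - wn)).PosDef := by rw [← hM]; convert hp
        have h3 := h2.submatrix (e := Sum.inl) Sum.inl_injective
        convert h3
        ext i j
        rfl
      · refine (hmeas.comp ?_).aemeasurable
        rw [measurable_pi_iff]
        rintro (i | i)
        · exact measurable_const
        · exact measurable_id
  simp_rw [hin]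
  rw [lintegral_const_mul' _ _ ENNReal.ofReal_ne_top, h w' _ (fun i j => hw _ _) (fun i j => hn _ _)
    (fun i => add_nonneg (hη _) (hn _ _)), ← ENNReal.ofReal_mul (Real.sqrt_nonneg _),
    Fintype.card_sum, Fintype.card_unit, pow_succ, mul_comm]

lemma w17_P_empty : w17P PEmpty := by
  intro w η hw hn hη
  have : ∀ d : PEmpty → ℝ, w17G w η d = 1 := by
    intro d
    have hp : (Matrix.diagonal d - w).PosDef := by
      refine Matrix.PosDef.of_dotProduct_mulVec_pos (Subsingleton.elim _ _) fun x hx => ?_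
      exact absurd (Subsingleton.elim _ _) hx
    unfold w17G
    rw [if_pos (by convert hp)]
    simp [w17Q]
  simp_rw [this]
  simp [volume_pi]

lemma w17_P_all (ι : Type*) [Fintype ι] : w17P ι := by
  refine Fintype.induction_empty_option (P := fun t _ => w17P t) ?_ ?_ ?_ ι
  · intro α β _ e h
    let _ := Fintype.ofEquiv β e.symm
    exact w17_P_equiv e h
  · exact w17_P_empty
  · intro α _ h
    exact w17_P_equiv (Equiv.optionEquivSumPUnit α).symm (w17_P_step h)

/-- The map from the `u` variables to the potential. -/
def w17f {ι : Type*} [Fintype ι] (w : Matrix ι ι ℝ) (a u : ι → ℝ) : ι → ℝ :=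
  fun i => a i * Real.exp (-u i) + ∑ j, w i j * Real.exp (u j - u i)

/-- Every vertex is connected to the pinning point. -/
def w17C {ι : Type*} (w : Matrix ι ι ℝ) (a : ι → ℝ) : Prop :=
  ∀ S : Set ι, (∀ i ∈ S, a i = 0 ∧ ∀ j, w i j ≠ 0 → j ∈ S) → S = ∅

open Matrix in
lemma w17_f_mulVec {ι : Type*} [Fintype ι] [DecidableEq ι] (w : Matrix ι ι ℝ) (a u : ι → ℝ) :
    (diagonal (w17f w a u) - w) *ᵥ (fun i => Real.exp (u i)) = a := by
  ext i
  rw [sub_mulVec, Pi.sub_apply, mulVec_diagonal]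
  simp only [w17f, mulVec, dotProduct]
  rw [add_mul, Finset.sum_mul, mul_assoc, ← Real.exp_add]
  have : ∀ j, w i j * Real.exp (u j - u i) * Real.exp (u i) = w i j * Real.exp (u j) := by
    intro j; rw [mul_assoc, ← Real.exp_add]; congr 2; ring
  simp [this]

open Matrix in
lemma w17_herm {ι : Type*} [Fintype ι] [DecidableEq ι] (w : Matrix ι ι ℝ)
    (hw : ∀ i j, w i j = w j i) (d : ι → ℝ) : (diagonal d - w).IsHermitian := by
  ext i j
  simp only [conjTranspose_apply, star_trivial, Matrix.sub_apply, hw j i, Matrix.diagonal_apply]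
  by_cases h : i = j
  · subst h; rfl
  · simp [h, Ne.symm h]

open Matrix in
lemma w17_f_posDef {ι : Type*} [Fintype ι] [DecidableEq ι] (w : Matrix ι ι ℝ) (a u : ι → ℝ)
    (hw : ∀ i j, w i j = w j i) (hn : ∀ i j, 0 ≤ w i j) (ha : ∀ i, 0 ≤ a i) (hC : w17C w a) :
    (diagonal (w17f w a u) - w).PosDef := by
  refine PosDef.of_dotProduct_mulVec_pos (w17_herm w hw _) fun x hx => ?_
  rw [star_trivial]
  set z : ι → ℝ := fun i => Real.exp (-u i) * x i with hz
  have hxz : ∀ i, x i = Real.exp (u i) * z i := by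
    intro i; simp only [hz]; rw [← mul_assoc, ← Real.exp_add]; simp
  have key : x ⬝ᵥ (diagonal (w17f w a u) - w) *ᵥ x = ∑ i, a i * Real.exp (u i) * z i ^ 2
      + 1 / 2 * ∑ i, ∑ j, w i j * Real.exp (u i + u j) * (z i - z j) ^ 2 := by
    have e1 : ∀ i, x i * ((diagonal (w17f w a u) - w) *ᵥ x) i = a i * Real.exp (u i) * z i ^ 2 +
        ∑ j, w i j * Real.exp (u i + u j) * (z i ^ 2 - z i * z j) := by
      intro i
      rw [sub_mulVec, Pi.sub_apply, mulVec_diagonal]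
      simp only [w17f, mulVec, dotProduct]
      rw [add_mul, mul_sub, mul_add, Finset.sum_mul, Finset.mul_sum, Finset.mul_sum, add_sub_assoc,
        ← Finset.sum_sub_distrib]
      congr 1
      · rw [hxz i, Real.exp_neg]
        field_simp
      · refine Finset.sum_congr rfl fun j _ => ?_
        rw [hxz i, hxz j, Real.exp_sub, Real.exp_add]
        field_simp
    have e2 : ∑ i, ∑ j, w i j * Real.exp (u i + u j) * (z i ^ 2 - z i * z j)
        = ∑ i, ∑ j, w i j * Real.exp (u i + u j) * (z j ^ 2 - z i * z j) := by
      rw [Finset.sum_comm]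
      refine Finset.sum_congr rfl fun i _ => Finset.sum_congr rfl fun j _ => ?_
      rw [hw j i, add_comm (u j)]; ring
    have e3 : ∑ i, ∑ j, w i j * Real.exp (u i + u j) * (z i - z j) ^ 2
        = ∑ i, ∑ j, w i j * Real.exp (u i + u j) * (z i ^ 2 - z i * z j)
          + ∑ i, ∑ j, w i j * Real.exp (u i + u j) * (z j ^ 2 - z i * z j) := by
      simp_rw [← Finset.sum_add_distrib]
      refine Finset.sum_congr rfl fun i _ => Finset.sum_congr rfl fun j _ => ?_
      ring
    rw [e3, ← e2]
    simp only [dotProduct]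
    simp_rw [e1]
    rw [Finset.sum_add_distrib]
    ring
  rw [key]
  have t1 : ∀ i, 0 ≤ a i * Real.exp (u i) * z i ^ 2 := fun i => by have := ha i; positivity
  have t2 : ∀ i j, 0 ≤ w i j * Real.exp (u i + u j) * (z i - z j) ^ 2 :=
    fun i j => by have := hn i j; positivity
  have s1 : 0 ≤ ∑ i, a i * Real.exp (u i) * z i ^ 2 := Finset.sum_nonneg fun i _ => t1 i
  have s2 : 0 ≤ ∑ i, ∑ j, w i j * Real.exp (u i + u j) * (z i - z j) ^ 2 :=
    Finset.sum_nonneg fun i _ => Finset.sum_nonneg fun j _ => t2 i j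
  by_contra hneg
  have z1 : ∑ i, a i * Real.exp (u i) * z i ^ 2 = 0 := by linarith
  have z2 : ∑ i, ∑ j, w i j * Real.exp (u i + u j) * (z i - z j) ^ 2 = 0 := by linarith
  rw [Finset.sum_eq_zero_iff_of_nonneg fun i _ => t1 i] at z1
  rw [Finset.sum_eq_zero_iff_of_nonneg fun i _ => Finset.sum_nonneg fun j _ => t2 i j] at z2
  have hS := hC {i | z i ≠ 0} (by
    intro i hi
    have hi : z i ≠ 0 := hi
    refine ⟨?_, ?_⟩
    · have := z1 i (Finset.mem_univ _)
      simpa [hi, Real.exp_ne_zero] using this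
    · intro j hj
      have h := z2 i (Finset.mem_univ _)
      rw [Finset.sum_eq_zero_iff_of_nonneg fun j _ => t2 i j] at h
      have h := h j (Finset.mem_univ _)
      have h : z i - z j = 0 := by simpa [hj, Real.exp_ne_zero] using h
      change z j ≠ 0
      intro h0; apply hi; linarith)
  apply hx
  ext i
  have : z i = 0 := by
    by_contra h
    have : i ∈ ({i | z i ≠ 0} : Set ι) := h
    rw [hS] at this
    exact this
  rw [hxz, this]; simp

open Matrix in
lemma w17_f_inj {ι : Type*} [Fintype ι] [DecidableEq ι] (w : Matrix ι ι ℝ) (a : ι → ℝ)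
    (hw : ∀ i j, w i j = w j i) (hn : ∀ i j, 0 ≤ w i j) (ha : ∀ i, 0 ≤ a i) (hC : w17C w a) :
    Function.Injective (w17f w a) := by
  intro u v huv
  have h1 := w17_f_mulVec w a u
  have h2 := w17_f_mulVec w a v
  rw [← huv] at h2
  have hu := (w17_f_posDef w a u hw hn ha hC).isUnit
  have := Matrix.mulVec_injective_of_isUnit hu (h1.trans h2.symm)
  ext i
  exact Real.exp_injective (congrFun this i)

open Matrix in
lemma w17_f_range {ι : Type*} [Fintype ι] [DecidableEq ι] (w : Matrix ι ι ℝ) (a : ι → ℝ)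
    (hw : ∀ i j, w i j = w j i) (hn : ∀ i j, 0 ≤ w i j) (ha : ∀ i, 0 ≤ a i) (hC : w17C w a) :
    w17f w a '' Set.univ = {d | (diagonal d - w).PosDef} := by
  ext d
  simp only [Set.image_univ, Set.mem_range, Set.mem_ofPred_eq]
  constructor
  · rintro ⟨u, rfl⟩; exact w17_f_posDef w a u hw hn ha hC
  · intro hd
    set x := (diagonal d - w)⁻¹ *ᵥ a with hx
    have hu : IsUnit (diagonal d - w).det := (Matrix.isUnit_iff_isUnit_det _).1 hd.isUnit
    have hHx : (diagonal d - w) *ᵥ x = a := by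
      rw [hx, mulVec_mulVec, Matrix.mul_nonsing_inv _ hu, one_mulVec]
    have hx0 := w17_Mmatrix w d hn hd x (by rw [hHx]; exact ha)
    have hrow : ∀ i, d i * x i = a i + ∑ j, w i j * x j := by
      intro i
      have := congrFun hHx i
      rw [sub_mulVec, Pi.sub_apply, mulVec_diagonal] at this
      simp only [mulVec, dotProduct] at this
      linarith
    have hS := hC {i | x i = 0} (by
      intro i hi
      have hi : x i = 0 := hi
      have h := hrow i
      rw [hi, mul_zero] at h
      have hs : 0 ≤ ∑ j, w i j * x j := Finset.sum_nonneg fun j _ => mul_nonneg (hn _ _) (hx0 _)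
      have := ha i
      refine ⟨by linarith, ?_⟩
      have hs0 : ∑ j, w i j * x j = 0 := by linarith
      rw [Finset.sum_eq_zero_iff_of_nonneg fun j _ => mul_nonneg (hn _ _) (hx0 _)] at hs0
      intro j hj
      have := hs0 j (Finset.mem_univ _)
      change x j = 0
      simpa [hj] using this)
    have hpos : ∀ i, 0 < x i := by
      intro i
      refine lt_of_le_of_ne (hx0 i) fun h => ?_
      have : i ∈ ({i | x i = 0} : Set ι) := h.symm
      rw [hS] at this
      exact this
    refine ⟨fun i => Real.log (x i), ?_⟩
    ext i
    simp only [w17f, Real.exp_sub, Real.exp_neg, Real.exp_log (hpos _)]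
    have := hrow i
    have hp := (hpos i).ne'
    rw [← mul_left_inj' hp, this, add_mul, Finset.sum_mul, mul_assoc, inv_mul_cancel₀ hp, mul_one]
    congr 1
    refine Finset.sum_congr rfl fun j _ => ?_
    field_simp

open Matrix in
lemma w17_f_deriv {ι : Type*} [Fintype ι] [DecidableEq ι] (w : Matrix ι ι ℝ) (a u : ι → ℝ) :
    HasFDerivAt (w17f w a) (LinearMap.toContinuousLinearMap (toLin' (-(diagonal (fun i => Real.exp (-u i)) *
      (diagonal (w17f w a u) - w) * diagonal (fun i => Real.exp (u i)))))) u := by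
  rw [hasFDerivAt_pi']
  intro i
  have hpr : ∀ j, HasFDerivAt (fun v : ι → ℝ => v j) (ContinuousLinearMap.proj (R := ℝ) j) u :=
    fun j => (ContinuousLinearMap.proj (R := ℝ) (φ := fun _ : ι => ℝ) j).hasFDerivAt
  have h := ((hpr i).neg.exp.const_mul (a i)).add
    (HasFDerivAt.fun_sum (u := Finset.univ) fun j _ => (((hpr j).sub (hpr i)).exp.const_mul (w i j)))
  refine h.congr_fderiv ?_
  ext v
  have hR : ((-(diagonal (fun i => Real.exp (-u i)) *
      (diagonal (w17f w a u) - w) * diagonal (fun i => Real.exp (u i)))) *ᵥ v) i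
      = -(Real.exp (-u i) * (w17f w a u i * (Real.exp (u i) * v i) - ∑ j, w i j * (Real.exp (u j) * v j))) := by
    rw [neg_mulVec, ← mulVec_mulVec, ← mulVec_mulVec, Pi.neg_apply, mulVec_diagonal, sub_mulVec,
      Pi.sub_apply, mulVec_diagonal, mulVec_diagonal]
    simp only [mulVec, dotProduct]
    congr 4
    ext j
    change _ * (diagonal _ *ᵥ v) j = _
    rw [mulVec_diagonal]
  change _ = ((-(diagonal (fun i => Real.exp (-u i)) *
      (diagonal (w17f w a u) - w) * diagonal (fun i => Real.exp (u i)))) *ᵥ v) i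
  rw [hR]
  have hL : (a i • Real.exp (-u i) • -(ContinuousLinearMap.proj (R := ℝ) (φ := fun _ : ι => ℝ) i) +
      ∑ j, w i j • Real.exp (u j - u i) • ((ContinuousLinearMap.proj (R := ℝ) (φ := fun _ : ι => ℝ) j) -
        (ContinuousLinearMap.proj (R := ℝ) (φ := fun _ : ι => ℝ) i))) v
      = a i * (Real.exp (-u i) * -v i) + ∑ j, w i j * (Real.exp (u j - u i) * (v j - v i)) := by
    simp [ContinuousLinearMap.sum_apply]
  refine Eq.trans hL ?_
  simp only [w17f]
  have h0 : ∀ j, w i j * (Real.exp (u j - u i) * (v j - v i))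
      = Real.exp (-u i) * (w i j * (Real.exp (u j) * v j)) - w i j * Real.exp (u j - u i) * v i := by
    intro j
    rw [Real.exp_sub, Real.exp_neg]
    field_simp
  simp_rw [h0]
  rw [Finset.sum_sub_distrib, ← Finset.mul_sum, ← Finset.sum_mul]
  have h1 : Real.exp (-u i) * Real.exp (u i) = 1 := by rw [← Real.exp_add]; simp
  linear_combination (a i * Real.exp (-u i) + ∑ j, w i j * Real.exp (u j - u i)) * v i * h1

lemma w17_main {ι : Type*} [Fintype ι] [DecidableEq ι] (w : Matrix ι ι ℝ) (a η : ι → ℝ)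
    (hw : ∀ i j, w i j = w j i) (hn : ∀ i j, 0 ≤ w i j) (ha : ∀ i, 0 ≤ a i) (hη : ∀ i, 0 ≤ η i)
    (hC : w17C w a) :
    ∫⁻ u : ι → ℝ, ENNReal.ofReal ((Matrix.diagonal (w17f w a u) - w).det *
      w17Q (Matrix.diagonal (w17f w a u) - w) η) = ENNReal.ofReal (√(2 * π) ^ Fintype.card ι) := by
  rw [← w17_P_all ι w η hw hn hη]
  have hG : ∫⁻ d : ι → ℝ, w17G w η d = ∫⁻ d in {d : ι → ℝ | (Matrix.diagonal d - w).PosDef}, w17G w η d := by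
    rw [← lintegral_indicator (w17_measSet w hw)]
    refine lintegral_congr fun d => ?_
    by_cases h : (Matrix.diagonal d - w).PosDef
    · rw [Set.indicator_of_mem (by exact h)]
    · rw [Set.indicator_of_notMem (by exact h)]
      unfold w17G; convert if_neg ?_; convert h
  rw [hG, ← w17_f_range w a hw hn ha hC, lintegral_image_eq_lintegral_abs_det_fderiv_mul volume
    MeasurableSet.univ (fun u _ => (w17_f_deriv w a u).hasFDerivWithinAt)
    (w17_f_inj w a hw hn ha hC).injOn, setLIntegral_univ]
  refine lintegral_congr fun u => ?_
  have hpd := w17_f_posDef w a u hw hn ha hC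
  have hG1 : w17G w η (w17f w a u) = ENNReal.ofReal (w17Q (Matrix.diagonal (w17f w a u) - w) η) := by
    unfold w17G; convert if_pos ?_; convert hpd
  rw [hG1, ← ENNReal.ofReal_mul (abs_nonneg _)]
  congr 2
  rw [ContinuousLinearMap.det, LinearMap.coe_toContinuousLinearMap, LinearMap.det_toLin',
    Matrix.det_neg, Matrix.det_mul, Matrix.det_mul, Matrix.det_diagonal, Matrix.det_diagonal,
    abs_mul, abs_pow, abs_neg, abs_one, one_pow, one_mul, mul_right_comm, ← Finset.prod_mul_distrib]
  simp_rw [← Real.exp_add]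
  simp [abs_of_pos hpd.det_pos]

section w17Final

variable {V : Type*} [Fintype V] [DecidableEq V]

lemma w17_ext_δ (δ : V) (x : {i : V // i ≠ δ} → ℝ) : extendByZero δ x δ = 0 := by
  simp [extendByZero]

lemma w17_ext_ne (δ : V) (x : {i : V // i ≠ δ} → ℝ) (i : {i : V // i ≠ δ}) :
    extendByZero δ x i.1 = x i := by
  simp [extendByZero, i.2]

/-- Restriction of the weights. -/
def w17w (W : V → V → ℝ) (δ : V) : Matrix {i : V // i ≠ δ} {i : V // i ≠ δ} ℝ :=
  Matrix.of fun i j => W i.1 j.1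

/-- Pinning vector. -/
def w17a (W : V → V → ℝ) (δ : V) : {i : V // i ≠ δ} → ℝ := fun i => W i.1 δ

lemma w17_sum (δ : V) {M : Type*} [AddCommMonoid M] (f : V → M) :
    ∑ i, f i = f δ + ∑ i : {i : V // i ≠ δ}, f i.1 :=
  Fintype.sum_eq_add_sum_subtype_ne f δ

lemma w17_conn (W : V → V → ℝ) (δ : V) (hsymm : ∀ i j, W i j = W j i)
    (hconn : (SimpleGraph.fromRel fun i j : V => 0 < W i j).Connected) :
    w17C (w17w W δ) (w17a W δ) := by
  intro S hS
  by_contra hne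
  obtain ⟨i, hi⟩ := Set.nonempty_iff_ne_empty.2 hne
  have key : ∀ x y : V, (SimpleGraph.fromRel fun i j : V => 0 < W i j).Reachable x y →
      (∃ h : x ≠ δ, (⟨x, h⟩ : {i : V // i ≠ δ}) ∈ S) → (∃ h : y ≠ δ, (⟨y, h⟩ : {i : V // i ≠ δ}) ∈ S) := by
    rintro x y ⟨p⟩
    induction p with
    | nil => exact id
    | cons hadj p ih =>
      rename_i x z y
      rintro ⟨hx, hxS⟩
      apply ih
      obtain ⟨h1, h2⟩ := hS _ hxS
      have hW : W x z ≠ 0 := by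
        rw [SimpleGraph.fromRel_adj] at hadj
        rcases hadj.2 with h | h
        · exact h.ne'
        · rw [hsymm]; exact h.ne'
      have hz : z ≠ δ := by
        rintro rfl
        exact hW h1
      exact ⟨hz, h2 ⟨z, hz⟩ hW⟩
  obtain ⟨h, _⟩ := key i.1 δ (hconn.preconnected _ _) ⟨i.2, hi⟩
  exact h rfl

open Matrix in
lemma w17_AVV (W : V → V → ℝ) (δ : V) (hdiag : ∀ i, W i i = 0) (u : {i : V // i ≠ δ} → ℝ) :
    AVV W δ (extendByZero δ u) = diagonal (fun i => Real.exp (u i)) *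
      (diagonal (w17f (w17w W δ) (w17a W δ) u) - w17w W δ) * diagonal (fun i => Real.exp (u i)) := by
  ext i j
  rw [mul_diagonal, diagonal_mul, Matrix.sub_apply]
  simp only [AVV, Amat, Matrix.of_apply]
  by_cases hij : i = j
  · subst hij
    rw [if_pos rfl, diagonal_apply_eq, w17_sum δ, w17_ext_δ]
    simp only [w17_ext_ne, w17w, w17a, w17f, Matrix.of_apply, hdiag, sub_zero, add_zero]
    rw [mul_add, add_mul, Finset.mul_sum, Finset.sum_mul]
    congr 1
    · rw [Real.exp_neg]; field_simp
    · refine Finset.sum_congr rfl fun k _ => ?_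
      rw [Real.exp_sub, Real.exp_add]; field_simp
  · rw [if_neg (fun h => hij (Subtype.ext h)), diagonal_apply_ne _ hij]
    simp only [w17_ext_ne, w17w, Matrix.of_apply]
    rw [Real.exp_add]; ring

open Matrix in
lemma w17_quad (W : V → V → ℝ) (δ : V) (U : V → ℝ) (s : {i : V // i ≠ δ} → ℝ) :
    ∑ i, ∑ j, extendByZero δ s i * Amat W U i j * extendByZero δ s j = s ⬝ᵥ AVV W δ U *ᵥ s := by
  rw [w17_sum δ]
  simp only [w17_sum δ (M := ℝ), w17_ext_δ, w17_ext_ne, zero_mul, mul_zero, zero_add,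
    Finset.sum_const_zero]
  simp only [dotProduct, mulVec, AVV, Matrix.of_apply, Finset.mul_sum, mul_assoc]

lemma w17_cosh (W : V → V → ℝ) (δ : V) (hsymm : ∀ i j, W i j = W j i) (hdiag : ∀ i, W i i = 0)
    (u : {i : V // i ≠ δ} → ℝ) :
    1 / 2 * ∑ i, ∑ j, W i j * (Real.cosh (extendByZero δ u i - extendByZero δ u j) - 1)
      = 1 / 2 * (∑ i, ∑ j, (Matrix.diagonal (w17f (w17w W δ) (w17a W δ) u) - w17w W δ) i j)
        + 1 / 2 * ∑ i, w17a W δ i * Real.exp (u i) - ∑ i, w17a W δ i := by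
  have hL : ∑ i, ∑ j, W i j * (Real.cosh (extendByZero δ u i - extendByZero δ u j) - 1)
      = 2 * ∑ i, w17a W δ i * (Real.cosh (u i) - 1)
        + ∑ i, ∑ j, w17w W δ i j * (Real.cosh (u i - u j) - 1) := by
    rw [w17_sum δ]
    simp only [w17_sum δ (M := ℝ), w17_ext_δ, w17_ext_ne, hdiag, zero_mul, zero_add, zero_sub, sub_zero,
      Real.cosh_neg, Finset.sum_add_distrib, hsymm δ]
    simp only [w17a, w17w, Matrix.of_apply]
    ring
  have hR : ∑ i, ∑ j, (Matrix.diagonal (w17f (w17w W δ) (w17a W δ) u) - w17w W δ) i j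
      = ∑ i, w17a W δ i * Real.exp (-u i) + ∑ i, ∑ j, w17w W δ i j * (Real.exp (u j - u i) - 1) := by
    rw [← Finset.sum_add_distrib]
    refine Finset.sum_congr rfl fun i _ => ?_
    simp only [Matrix.sub_apply, Finset.sum_sub_distrib, Matrix.diagonal_apply, Finset.sum_ite_eq,
      Finset.mem_univ, if_true, w17f, mul_sub, mul_one]
    ring
  have hS : ∑ i, ∑ j, w17w W δ i j * (Real.exp (u j - u i) - 1)
      = ∑ i, ∑ j, w17w W δ i j * (Real.exp (u i - u j) - 1) := by
    rw [Finset.sum_comm]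
    refine Finset.sum_congr rfl fun i _ => Finset.sum_congr rfl fun j _ => ?_
    simp only [w17w, Matrix.of_apply, hsymm j.1]
  have hc : ∑ i, ∑ j, w17w W δ i j * (Real.cosh (u i - u j) - 1)
      = 1 / 2 * (∑ i, ∑ j, w17w W δ i j * (Real.exp (u j - u i) - 1)
        + ∑ i, ∑ j, w17w W δ i j * (Real.exp (u i - u j) - 1)) := by
    simp_rw [← Finset.sum_add_distrib, Finset.mul_sum]
    refine Finset.sum_congr rfl fun i _ => Finset.sum_congr rfl fun j _ => ?_
    rw [Real.cosh_eq, neg_sub]; ring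
  have ha : ∑ i, w17a W δ i * (Real.cosh (u i) - 1)
      = 1 / 2 * (∑ i, w17a W δ i * Real.exp (-u i)) + 1 / 2 * (∑ i, w17a W δ i * Real.exp (u i))
        - ∑ i, w17a W δ i := by
    simp_rw [Finset.mul_sum, ← Finset.sum_add_distrib, ← Finset.sum_sub_distrib]
    refine Finset.sum_congr rfl fun i _ => ?_
    rw [Real.cosh_eq]; ring
  rw [hL, hR, hc, ha, ← hS]
  ring

/-- The part of the density not depending on `s`. -/
def w17K (W : V → V → ℝ) (δ : V) (u : {i : V // i ≠ δ} → ℝ) : ℝ :=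
  (AVV W δ (extendByZero δ u)).det
    * Real.exp (-((1 / 2) * ∑ i, ∑ j, W i j * (Real.cosh (extendByZero δ u i - extendByZero δ u j) - 1)))
    * ∏ i : {i : V // i ≠ δ}, Real.exp (-(u i)) / (2 * Real.pi)

open Matrix in
lemma w17_D (W : V → V → ℝ) (δ : V) (u s : {i : V // i ≠ δ} → ℝ) :
    rhoW W δ (extendByZero δ u) (extendByZero δ s) *
      ∏ i : {i : V // i ≠ δ}, Real.exp (-(extendByZero δ u i.1)) / (2 * Real.pi)
    = w17K W δ u * Real.exp (-(1 / 2) * (s ⬝ᵥ AVV W δ (extendByZero δ u) *ᵥ s)) := by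
  unfold rhoW w17K
  rw [w17_quad]
  simp only [w17_ext_ne]
  ring

open Matrix in
lemma w17_R (W : V → V → ℝ) (δ : V) (hsymm : ∀ i j, W i j = W j i) (hdiag : ∀ i, W i i = 0)
    (α : V → ℝ) (u : {i : V // i ≠ δ} → ℝ)
    (hH : (diagonal (w17f (w17w W δ) (w17a W δ) u) - w17w W δ).PosDef) :
    w17K W δ u * Real.exp (α δ + ∑ i : {i : V // i ≠ δ}, α i.1 * Real.exp (u i)) *
      (√(2 * π) ^ Fintype.card {i : V // i ≠ δ} / √(AVV W δ (extendByZero δ u)).det *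
        Real.exp (-(1 / 2) * ((fun i : {i : V // i ≠ δ} => α i.1 * Real.exp (u i)) ⬝ᵥ
          (AVV W δ (extendByZero δ u))⁻¹ *ᵥ (fun i : {i : V // i ≠ δ} => α i.1 * Real.exp (u i)))))
    = Real.exp (∑ i, α i) * (√(2 * π) ^ Fintype.card {i : V // i ≠ δ})⁻¹ *
      ((diagonal (w17f (w17w W δ) (w17a W δ) u) - w17w W δ).det *
        w17Q (diagonal (w17f (w17w W δ) (w17a W δ) u) - w17w W δ) (fun i => w17a W δ i - α i.1)) := by
  unfold w17K w17Q
  rw [w17_cosh W δ hsymm hdiag, w17_AVV W δ hdiag]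
  have hmv := w17_f_mulVec (w17w W δ) (w17a W δ) u
  set H := diagonal (w17f (w17w W δ) (w17a W δ) u) - w17w W δ with hHd
  set a := w17a W δ with had
  set E : Matrix {i : V // i ≠ δ} {i : V // i ≠ δ} ℝ := diagonal (fun i => Real.exp (u i)) with hE
  set β : {i : V // i ≠ δ} → ℝ := fun i => α i.1 with hβ
  set P : ℝ := ∏ i, Real.exp (u i) with hP
  have hP0 : 0 < P := Finset.prod_pos fun i _ => Real.exp_pos _
  have hEdet : E.det = P := by rw [hE, det_diagonal]
  have hEu : IsUnit E.det := by rw [hEdet]; exact hP0.ne'.isUnit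
  have hHu : IsUnit H.det := (Matrix.isUnit_iff_isUnit_det _).1 hH.isUnit
  have hET : Eᵀ = E := diagonal_transpose _
  have hb : (fun i : {i : V // i ≠ δ} => α i.1 * Real.exp (u i)) = E *ᵥ β := by
    ext i; rw [hE, mulVec_diagonal]; ring
  have hbb : (E *ᵥ β) ⬝ᵥ (E * H * E)⁻¹ *ᵥ (E *ᵥ β) = β ⬝ᵥ H⁻¹ *ᵥ β := by
    rw [mulVec_mulVec, Matrix.mul_inv_rev, Matrix.mul_inv_rev, ← vecMul_transpose, hET,
      ← dotProduct_mulVec, mulVec_mulVec]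
    congr 2
    rw [← Matrix.mul_assoc, ← Matrix.mul_assoc, ← Matrix.mul_assoc, Matrix.mul_nonsing_inv _ hEu,
      Matrix.one_mul, Matrix.mul_assoc, Matrix.nonsing_inv_mul _ hEu, Matrix.mul_one]
  have hHa : H⁻¹ *ᵥ a = fun i => Real.exp (u i) := by
    rw [← hmv, mulVec_mulVec, Matrix.nonsing_inv_mul _ hHu, one_mulVec]
  have hAT : H⁻¹ᵀ = H⁻¹ := by
    have := hH.inv.isHermitian
    simpa [IsHermitian] using this
  have hsym : a ⬝ᵥ H⁻¹ *ᵥ β = β ⬝ᵥ H⁻¹ *ᵥ a := by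
    rw [Matrix.dotProduct_mulVec, ← Matrix.mulVec_transpose, hAT, dotProduct_comm]
  have hq : ∑ i, (fun i => a i - β i) i * (H⁻¹ *ᵥ (fun i => a i - β i)) i
      = ∑ i, a i * Real.exp (u i) - 2 * ∑ i, β i * Real.exp (u i) + β ⬝ᵥ H⁻¹ *ᵥ β := by
    change (a - β) ⬝ᵥ H⁻¹ *ᵥ (a - β) = _
    rw [mulVec_sub, sub_dotProduct, dotProduct_sub, dotProduct_sub, hsym, hHa]
    simp only [dotProduct]
    ring
  have hprod : ∏ i : {i : V // i ≠ δ}, Real.exp (-(u i)) / (2 * Real.pi)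
      = P⁻¹ * ((√(2 * π) ^ Fintype.card {i : V // i ≠ δ})⁻¹) ^ 2 := by
    simp_rw [Real.exp_neg, div_eq_mul_inv]
    rw [Finset.prod_mul_distrib, Finset.prod_inv_distrib, Finset.prod_const, Finset.card_univ,
      inv_pow, inv_pow, ← pow_mul, mul_comm _ 2, pow_mul, Real.sq_sqrt (by positivity)]
  have hdet : (E * H * E).det = P ^ 2 * H.det := by
    rw [det_mul, det_mul, hEdet]; ring
  have hsq : √(P ^ 2 * H.det) = P * √H.det := by
    rw [Real.sqrt_mul (sq_nonneg _), Real.sqrt_sq hP0.le]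
  have hs0 : 0 < √H.det := Real.sqrt_pos.2 hH.det_pos
  have hs2 : H.det = √H.det ^ 2 := (Real.sq_sqrt hH.det_pos.le).symm
  have hexp : Real.exp (-(1 / 2 * (∑ i, ∑ j, H i j) + 1 / 2 * ∑ i, a i * Real.exp (u i) - ∑ i, a i)) *
      Real.exp (α δ + ∑ i, β i * Real.exp (u i)) * Real.exp (-(1 / 2) * (β ⬝ᵥ H⁻¹ *ᵥ β))
      = Real.exp (∑ i, α i) * Real.exp (-(1 / 2) * (∑ i, ∑ j, H i j)
        - 1 / 2 * (∑ i, (fun i => a i - β i) i * (H⁻¹ *ᵥ (fun i => a i - β i)) i) + ∑ i, (a i - β i)) := by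
    rw [← Real.exp_add, ← Real.exp_add, ← Real.exp_add, hq, w17_sum δ α, Finset.sum_sub_distrib]
    congr 1
    ring
  rw [hb, hbb, hprod, hdet, hsq]
  have hT : 0 < √(2 * π) ^ Fintype.card {i : V // i ≠ δ} := by positivity
  set T := √(2 * π) ^ Fintype.card {i : V // i ≠ δ} with hTd
  calc _ = (Real.exp (-(1 / 2 * (∑ i, ∑ j, H i j) + 1 / 2 * ∑ i, a i * Real.exp (u i) - ∑ i, a i)) *
      Real.exp (α δ + ∑ i, β i * Real.exp (u i)) * Real.exp (-(1 / 2) * (β ⬝ᵥ H⁻¹ *ᵥ β))) *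
        (H.det / √H.det * T⁻¹) := by
        rw [← hb]
        field_simp
        rfl
    _ = _ := by
        rw [hexp]
        simp only [hβ]
        field_simp

end w17Final

section w17Last
variable {V : Type*} [Fintype V] [DecidableEq V]

open Matrix in
lemma w17_A_posDef (W : V → V → ℝ) (δ : V) (hdiag : ∀ i, W i i = 0) (u : {i : V // i ≠ δ} → ℝ)
    (hH : (diagonal (w17f (w17w W δ) (w17a W δ) u) - w17w W δ).PosDef) :
    (AVV W δ (extendByZero δ u)).PosDef := by
  rw [w17_AVV W δ hdiag]
  have hE : IsUnit (diagonal (fun i => Real.exp (u i)) : Matrix {i : V // i ≠ δ} {i : V // i ≠ δ} ℝ) := by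
    rw [Matrix.isUnit_iff_isUnit_det, det_diagonal]
    exact (Finset.prod_pos fun i _ => Real.exp_pos _).ne'.isUnit
  have h := (Matrix.IsUnit.posDef_star_left_conjugate_iff hE (x := diagonal (w17f (w17w W δ) (w17a W δ) u) - w17w W δ)).2 hH
  have hs : star (diagonal (fun i => Real.exp (u i)) : Matrix {i : V // i ≠ δ} {i : V // i ≠ δ} ℝ)
      = diagonal (fun i => Real.exp (u i)) := by
    rw [star_eq_conjTranspose, diagonal_conjTranspose]; rfl
  rwa [hs] at h

lemma w17_cont_Amat (W : V → V → ℝ) (i j : V) : Continuous fun u : V → ℝ => Amat W u i j := by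
  unfold Amat
  by_cases h : i = j
  · simp only [Matrix.of_apply, h, if_true]; fun_prop
  · simp only [Matrix.of_apply, h, if_false]; fun_prop

lemma w17_cont_det (W : V → V → ℝ) (δ : V) : Continuous fun u : V → ℝ => (AVV W δ u).det := by
  refine Continuous.matrix_det ?_
  refine continuous_matrix fun i j => ?_
  exact w17_cont_Amat W i.1 j.1

lemma w17_cont_dens (W : V → V → ℝ) (δ : V) :
    Continuous fun p : (V → ℝ) × (V → ℝ) => rhoW W δ p.1 p.2 *
      ∏ i : {i : V // i ≠ δ}, Real.exp (-(p.1 i.1)) / (2 * Real.pi) := by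
  unfold rhoW
  have h1 : Continuous fun p : (V → ℝ) × (V → ℝ) => (AVV W δ p.1).det :=
    (w17_cont_det W δ).comp continuous_fst
  have h2 : ∀ i j, Continuous fun p : (V → ℝ) × (V → ℝ) => Amat W p.1 i j := fun i j =>
    (w17_cont_Amat W i j).comp continuous_fst
  have h3 : Continuous fun p : (V → ℝ) × (V → ℝ) => ∑ i, ∑ j, p.2 i * Amat W p.1 i j * p.2 j := by
    refine continuous_finsetSum _ fun i _ => continuous_finsetSum _ fun j _ => ?_
    have := h2 i j
    fun_prop
  have h4 : Continuous fun p : (V → ℝ) × (V → ℝ) =>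
      ∏ i : {i : V // i ≠ δ}, Real.exp (-(p.1 i.1)) / (2 * Real.pi) := by
    refine continuous_finsetProd _ fun i _ => ?_
    fun_prop
  have h5 : Continuous fun p : (V → ℝ) × (V → ℝ) =>
      ∑ i, ∑ j, W i j * (Real.cosh (p.1 i - p.1 j) - 1) := by
    refine continuous_finsetSum _ fun i _ => continuous_finsetSum _ fun j _ => ?_
    have : Continuous fun p : (V → ℝ) × (V → ℝ) => Real.cosh (p.1 i - p.1 j) :=
      Real.continuous_cosh.comp (by fun_prop)
    fun_prop
  fun_prop

lemma w17_cont_ext (δ : V) : Continuous (extendByZero δ) := by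
  refine continuous_pi fun i => ?_
  unfold extendByZero
  by_cases h : i = δ
  · simp only [h, dif_pos]; fun_prop
  · simp only [h, dif_neg, not_false_eq_true]; fun_prop

lemma w17_unfold (W : V → V → ℝ) (δ : V) (g : (V → ℝ) × (V → ℝ) → ℂ) (hg : Continuous g)
    (hpos : ∀ p : ({i : V // i ≠ δ} → ℝ) × ({i : V // i ≠ δ} → ℝ),
      0 ≤ rhoW W δ (extendByZero δ p.1) (extendByZero δ p.2) *
      ∏ i : {i : V // i ≠ δ}, Real.exp (-(extendByZero δ p.1 i.1)) / (2 * Real.pi)) :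
    ∫ p, g p ∂(muW W δ) = ∫ p : ({i : V // i ≠ δ} → ℝ) × ({i : V // i ≠ δ} → ℝ),
      ((rhoW W δ (extendByZero δ p.1) (extendByZero δ p.2) *
      ∏ i : {i : V // i ≠ δ}, Real.exp (-(extendByZero δ p.1 i.1)) / (2 * Real.pi) : ℝ) : ℂ) *
        g (extendByZero δ p.1, extendByZero δ p.2) := by
  unfold muW
  have hc := w17_cont_dens W δ
  have hext : Continuous (fun p : ({i : V // i ≠ δ} → ℝ) × ({i : V // i ≠ δ} → ℝ) =>
      (extendByZero δ p.1, extendByZero δ p.2)) :=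
    ((w17_cont_ext δ).comp continuous_fst).prodMk ((w17_cont_ext δ).comp continuous_snd)
  rw [integral_withDensity_eq_integral_toReal_smul hc.measurable.ennreal_ofReal
    (Filter.Eventually.of_forall fun _ => ENNReal.ofReal_lt_top)]
  unfold baseMeasure
  rw [integral_map hext.measurable.aemeasurable]
  · refine integral_congr_ae (Filter.Eventually.of_forall fun p => ?_)
    simp only
    rw [ENNReal.toReal_ofReal (hpos p), Complex.real_smul]
  · refine Measurable.aestronglyMeasurable ?_
    exact (hc.measurable.ennreal_ofReal.ennreal_toReal).smul hg.measurable

lemma w17_cont_K (W : V → V → ℝ) (δ : V) : Continuous (w17K W δ) := by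
  unfold w17K
  have h0 := w17_cont_ext δ
  have h1 : Continuous fun u => (AVV W δ (extendByZero δ u)).det := (w17_cont_det W δ).comp h0
  have h2 : ∀ i, Continuous fun u => extendByZero δ u i := fun i => (continuous_apply i).comp h0
  have h5 : Continuous fun u : {i : V // i ≠ δ} → ℝ =>
      ∑ i, ∑ j, W i j * (Real.cosh (extendByZero δ u i - extendByZero δ u j) - 1) := by
    refine continuous_finsetSum _ fun i _ => continuous_finsetSum _ fun j _ => ?_
    have : Continuous fun u : {i : V // i ≠ δ} → ℝ =>
        Real.cosh (extendByZero δ u i - extendByZero δ u j) :=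
      Real.continuous_cosh.comp ((h2 i).sub (h2 j))
    fun_prop
  have h4 : Continuous fun u : {i : V // i ≠ δ} → ℝ =>
      ∏ i : {i : V // i ≠ δ}, Real.exp (-(u i)) / (2 * Real.pi) := by
    refine continuous_finsetProd _ fun i _ => ?_
    fun_prop
  fun_prop

open Matrix in
lemma w17_cont_D (W : V → V → ℝ) (δ : V) :
    Continuous fun p : ({i : V // i ≠ δ} → ℝ) × ({i : V // i ≠ δ} → ℝ) =>
      w17K W δ p.1 * Real.exp (-(1 / 2) * (p.2 ⬝ᵥ AVV W δ (extendByZero δ p.1) *ᵥ p.2)) := by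
  have hext : Continuous (fun p : ({i : V // i ≠ δ} → ℝ) × ({i : V // i ≠ δ} → ℝ) =>
      (extendByZero δ p.1, extendByZero δ p.2)) :=
    ((w17_cont_ext δ).comp continuous_fst).prodMk ((w17_cont_ext δ).comp continuous_snd)
  have h := (w17_cont_dens W δ).comp hext
  refine h.congr fun p => ?_
  exact w17_D W δ p.1 p.2

open Matrix in
lemma w17_gaussian_real {ι : Type*} [Fintype ι] [DecidableEq ι] (A : Matrix ι ι ℝ) (hA : A.PosDef) :
    ∫⁻ s : ι → ℝ, ENNReal.ofReal (Real.exp (-(1 / 2) * (s ⬝ᵥ A *ᵥ s)))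
      = ENNReal.ofReal (√(2 * π) ^ Fintype.card ι / √A.det) := by
  have h := w17_gaussian A hA 0
  have h1 : ∀ s : ι → ℝ, Complex.exp (-(1 / 2) * ((s ⬝ᵥ A *ᵥ s : ℝ) : ℂ) +
      Complex.I * (((0 : ι → ℝ) ⬝ᵥ s : ℝ) : ℂ))
      = ((Real.exp (-(1 / 2) * (s ⬝ᵥ A *ᵥ s)) : ℝ) : ℂ) := by
    intro s
    rw [zero_dotProduct]
    push_cast
    simp
  simp_rw [h1] at h
  rw [integral_complex_ofReal] at h
  have h2 := Complex.ofReal_injective h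
  rw [zero_dotProduct, mul_zero, Real.exp_zero, mul_one] at h2
  have hp : 0 < √(2 * π) ^ Fintype.card ι / √A.det := by
    have := Real.sqrt_pos.2 hA.det_pos
    positivity
  have hi : Integrable (fun s : ι → ℝ => Real.exp (-(1 / 2) * (s ⬝ᵥ A *ᵥ s))) := by
    by_contra hc
    rw [integral_undef hc] at h2
    exact hp.ne h2
  rw [← h2, ofReal_integral_eq_lintegral_ofReal hi
    (Filter.Eventually.of_forall fun _ => (Real.exp_pos _).le)]

end w17Last

/-- Ward identity for the exponential: for every `α ∈ (−∞,0]^Ṽ`,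
`∫ exp(Σ_j α_j e^{u_j}(1 + i s_j)) dμ^W(u,s) = exp(Σ_j α_j)`. -/
theorem stmt17 {V : Type*} [Fintype V] [DecidableEq V]
    (W : V → V → ℝ) (δ : V)
    (hsymm : ∀ i j, W i j = W j i)
    (hdiag : ∀ i, W i i = 0)
    (hnonneg : ∀ i j, 0 ≤ W i j)
    (hconn : (SimpleGraph.fromRel fun i j : V => 0 < W i j).Connected)
    (α : V → ℝ) (hα : ∀ j, α j ≤ 0) :
    ∫ p, Complex.exp (∑ j, (α j : ℂ) * Real.exp (p.1 j) * (1 + Complex.I * (p.2 j : ℂ)))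
        ∂(muW W δ)
      = Complex.exp (∑ j, (α j : ℂ)) := by
  have hw : ∀ i j, w17w W δ i j = w17w W δ j i := fun i j => hsymm _ _
  have hn : ∀ i j, 0 ≤ w17w W δ i j := fun i j => hnonneg _ _
  have ha : ∀ i, 0 ≤ w17a W δ i := fun i => hnonneg _ _
  have hC := w17_conn W δ hsymm hconn
  have hH := fun u => w17_f_posDef (w17w W δ) (w17a W δ) u hw hn ha hC
  have hA := fun u => w17_A_posDef W δ hdiag u (hH u)
  have hK : ∀ u, 0 ≤ w17K W δ u := by
    intro u
    unfold w17K
    have := (hA u).det_pos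
    positivity
  have hD0 : ∀ u s, 0 ≤ w17K W δ u *
      Real.exp (-(1 / 2) * (s ⬝ᵥ Matrix.mulVec (AVV W δ (extendByZero δ u)) s)) := fun u s =>
    mul_nonneg (hK u) (Real.exp_pos _).le
  set n := √(2 * π) ^ Fintype.card {i : V // i ≠ δ} with hnd
  have hn0 : 0 < n := by positivity
  -- integrals of the reduced density
  have hR : ∀ β : V → ℝ, (∀ j, β j ≤ 0) → ∫⁻ u, ENNReal.ofReal
      (w17K W δ u * Real.exp (β δ + ∑ i : {i : V // i ≠ δ}, β i.1 * Real.exp (u i)) *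
      (n / √(AVV W δ (extendByZero δ u)).det *
        Real.exp (-(1 / 2) * ((fun i : {i : V // i ≠ δ} => β i.1 * Real.exp (u i)) ⬝ᵥ
          Matrix.mulVec (AVV W δ (extendByZero δ u))⁻¹
            (fun i : {i : V // i ≠ δ} => β i.1 * Real.exp (u i))))))
      = ENNReal.ofReal (Real.exp (∑ i, β i)) := by
    intro β hβ
    have h := w17_main (w17w W δ) (w17a W δ) (fun i => w17a W δ i - β i.1) hw hn ha
      (fun i => sub_nonneg.2 ((hβ _).trans (ha i))) hC
    calc _ = ∫⁻ u, ENNReal.ofReal (Real.exp (∑ i, β i) * n⁻¹) * ENNReal.ofReal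
          ((Matrix.diagonal (w17f (w17w W δ) (w17a W δ) u) - w17w W δ).det *
        w17Q (Matrix.diagonal (w17f (w17w W δ) (w17a W δ) u) - w17w W δ)
          (fun i => w17a W δ i - β i.1)) := by
          refine lintegral_congr fun u => ?_
          rw [← ENNReal.ofReal_mul (by positivity), w17_R W δ hsymm hdiag β u (hH u)]
      _ = _ := by
          rw [lintegral_const_mul' _ _ ENNReal.ofReal_ne_top, h,
            ← ENNReal.ofReal_mul (by positivity), mul_assoc, inv_mul_cancel₀ hn0.ne', mul_one]
  -- integrability of the density
  have hDi : Integrable (fun p : ({i : V // i ≠ δ} → ℝ) × ({i : V // i ≠ δ} → ℝ) =>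
      w17K W δ p.1 * Real.exp (-(1 / 2) * (p.2 ⬝ᵥ
        Matrix.mulVec (AVV W δ (extendByZero δ p.1)) p.2))) := by
    refine ⟨(w17_cont_D W δ).aestronglyMeasurable, ?_⟩
    refine (hasFiniteIntegral_iff_ofReal (Filter.Eventually.of_forall fun p => ?_)).2 ?_
    · exact hD0 p.1 p.2
    rw [Measure.volume_eq_prod,
      lintegral_prod _ (w17_cont_D W δ).measurable.ennreal_ofReal.aemeasurable]
    have h0 := hR 0 (fun _ => le_rfl)
    refine lt_of_eq_of_lt ?_ (ENNReal.ofReal_lt_top (r := Real.exp (∑ i, (0 : V → ℝ) i)))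
    rw [← h0]
    refine lintegral_congr fun u => ?_
    have hsp : ∀ s : {i : V // i ≠ δ} → ℝ, ENNReal.ofReal (w17K W δ u *
        Real.exp (-(1 / 2) * (s ⬝ᵥ Matrix.mulVec (AVV W δ (extendByZero δ u)) s)))
        = ENNReal.ofReal (w17K W δ u) *
          ENNReal.ofReal (Real.exp (-(1 / 2) * (s ⬝ᵥ Matrix.mulVec (AVV W δ (extendByZero δ u)) s))) :=
      fun s => ENNReal.ofReal_mul (hK u)
    rw [lintegral_congr hsp, lintegral_const_mul' _ _ ENNReal.ofReal_ne_top, w17_gaussian_real _ (hA u),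
      ← ENNReal.ofReal_mul (hK u)]
    have hz : (fun i : {i : V // i ≠ δ} => (0 : V → ℝ) i.1 * Real.exp (u i)) = 0 := by
      ext i; simp
    rw [hz, zero_dotProduct]
    simp [hnd]
  -- rewriting the integral
  have hgc : Continuous fun p : (V → ℝ) × (V → ℝ) =>
      Complex.exp (∑ j, (α j : ℂ) * Real.exp (p.1 j) * (1 + Complex.I * (p.2 j : ℂ))) := by
    fun_prop
  rw [w17_unfold W δ _ hgc (fun p => by rw [w17_D]; exact hD0 _ _)]
  have hg : ∀ u s : {i : V // i ≠ δ} → ℝ,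
      ∑ j, (α j : ℂ) * Real.exp (extendByZero δ u j) * (1 + Complex.I * (extendByZero δ s j : ℂ))
      = ((α δ + ∑ i : {i : V // i ≠ δ}, α i.1 * Real.exp (u i) : ℝ) : ℂ) + Complex.I *
        (((fun i : {i : V // i ≠ δ} => α i.1 * Real.exp (u i)) ⬝ᵥ s : ℝ) : ℂ) := by
    intro u s
    rw [w17_sum δ]
    simp only [w17_ext_δ, w17_ext_ne, dotProduct]
    push_cast
    simp only [Complex.ofReal_zero, Complex.exp_zero, mul_zero, add_zero, mul_one, mul_add,
      Finset.sum_add_distrib, Finset.mul_sum]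
    rw [add_assoc]
    congr 2
    refine Finset.sum_congr rfl fun i _ => ?_
    ring
  simp_rw [w17_D, hg]
  have hFi : Integrable (fun p : ({i : V // i ≠ δ} → ℝ) × ({i : V // i ≠ δ} → ℝ) =>
      ((w17K W δ p.1 * Real.exp (-(1 / 2) * (p.2 ⬝ᵥ
        Matrix.mulVec (AVV W δ (extendByZero δ p.1)) p.2)) : ℝ) : ℂ) *
      Complex.exp (((α δ + ∑ i : {i : V // i ≠ δ}, α i.1 * Real.exp (p.1 i) : ℝ) : ℂ) + Complex.I *
        (((fun i : {i : V // i ≠ δ} => α i.1 * Real.exp (p.1 i)) ⬝ᵥ p.2 : ℝ) : ℂ))) := by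
    refine hDi.mono ?_ (Filter.Eventually.of_forall fun p => ?_)
    · refine Continuous.aestronglyMeasurable ?_
      refine (Complex.continuous_ofReal.comp (w17_cont_D W δ)).mul ?_
      simp only [dotProduct]
      fun_prop
    · rw [norm_mul, Complex.norm_real, Complex.norm_exp]
      refine mul_le_of_le_one_right (norm_nonneg _) ?_
      rw [Real.exp_le_one_iff, Complex.add_re, Complex.ofReal_re, Complex.re_mul_ofReal,
        Complex.I_re, zero_mul, add_zero]
      exact add_nonpos (hα _) (Finset.sum_nonpos fun i _ =>
        mul_nonpos_of_nonpos_of_nonneg (hα _) (Real.exp_pos _).le)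
  have hin : ∀ u : {i : V // i ≠ δ} → ℝ, ∫ s : {i : V // i ≠ δ} → ℝ,
      ((w17K W δ u * Real.exp (-(1 / 2) * (s ⬝ᵥ
        Matrix.mulVec (AVV W δ (extendByZero δ u)) s)) : ℝ) : ℂ) *
      Complex.exp (((α δ + ∑ i : {i : V // i ≠ δ}, α i.1 * Real.exp (u i) : ℝ) : ℂ) + Complex.I *
        (((fun i : {i : V // i ≠ δ} => α i.1 * Real.exp (u i)) ⬝ᵥ s : ℝ) : ℂ))
      = ((w17K W δ u * Real.exp (α δ + ∑ i : {i : V // i ≠ δ}, α i.1 * Real.exp (u i)) *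
      (n / √(AVV W δ (extendByZero δ u)).det *
        Real.exp (-(1 / 2) * ((fun i : {i : V // i ≠ δ} => α i.1 * Real.exp (u i)) ⬝ᵥ
          Matrix.mulVec (AVV W δ (extendByZero δ u))⁻¹
            (fun i : {i : V // i ≠ δ} => α i.1 * Real.exp (u i))))) : ℝ) : ℂ) := by
    intro u
    rw [Complex.ofReal_mul, ← w17_gaussian _ (hA u), ← integral_const_mul]
    refine integral_congr_ae (Filter.Eventually.of_forall fun s => ?_)
    simp only
    rw [Complex.exp_add, Complex.exp_add, Complex.ofReal_mul, Complex.ofReal_mul,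
      Complex.ofReal_exp, Complex.ofReal_exp, Complex.ofReal_mul]
    push_cast
    ring
  rw [Measure.volume_eq_prod] at hFi ⊢
  rw [integral_prod _ hFi]
  have hI := hFi.integral_prod_left
  simp only [hin] at hI ⊢
  rw [integral_complex_ofReal, ← Complex.ofReal_sum, ← Complex.ofReal_exp]
  congr 1
  have hIr := hI.re
  simp only [RCLike.re_to_complex, Complex.ofReal_re] at hIr
  have h0 : ∀ u, 0 ≤ (w17K W δ u * Real.exp (α δ + ∑ i : {i : V // i ≠ δ}, α i.1 * Real.exp (u i)) *
      (n / √(AVV W δ (extendByZero δ u)).det *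
        Real.exp (-(1 / 2) * ((fun i : {i : V // i ≠ δ} => α i.1 * Real.exp (u i)) ⬝ᵥ
          Matrix.mulVec (AVV W δ (extendByZero δ u))⁻¹
            (fun i : {i : V // i ≠ δ} => α i.1 * Real.exp (u i)))))) := by
    intro u
    have := hK u
    positivity
  rw [integral_eq_lintegral_of_nonneg_ae (Filter.Eventually.of_forall h0) hIr.1, hR α hα,
    ENNReal.toReal_ofReal (Real.exp_pos _).le]
end
end
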